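/- Lower bound via Guerra's interpolation: liminf_{n→∞} F_n(λ) ≥ sup_{(q₁,q₂) ∈ Γ(λ)} 𝓕(λ,q₁,q₂). -/

import Mathlib

open MeasureTheory ProbabilityTheory Filter Real
open scoped Topology

noncomputable section

/-- Standard Gaussian measure on `ℝ`. -/
def stdG : Measure ℝ := gaussianReal 0 1

/-- The weight `exp(√γ·x·z + γ·x·x₀ − γ·x²/2)` appearing in the scalar Gaussian channel. -/
def scalarWeight (γ x₀ z x : ℝ) : ℝ :=
  Real.exp (Real.sqrt γ * x * z + γ * x * x₀ - γ * x ^ 2 / 2)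

/-- Free energy `ψ_P(γ)` of the scalar Gaussian channel with prior `P`. -/
def psiF (P : Measure ℝ) [IsProbabilityMeasure P] (γ : ℝ) : ℝ :=
  ∫ p : ℝ × ℝ, Real.log (∫ x, scalarWeight γ p.1 p.2 x ∂P) ∂(P.prod stdG)

/-- Posterior mean `⟨x⟩_γ` in the scalar Gaussian channel (`x₀` is the signal, `z` the noise). -/
def postMean (P : Measure ℝ) (γ x₀ z : ℝ) : ℝ :=
  (∫ x, x * scalarWeight γ x₀ z x ∂P) / (∫ x, scalarWeight γ x₀ z x ∂P)

/-- Overlap `F_P(γ) = E[X₀·⟨x⟩_γ]` of the scalar Gaussian channel. -/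
def Fov (P : Measure ℝ) [IsProbabilityMeasure P] (γ : ℝ) : ℝ :=
  ∫ p : ℝ × ℝ, p.1 * postMean P γ p.1 p.2 ∂(P.prod stdG)

/-- The set `Γ(λ)` of fixed points of the state evolution equations. -/
def Gam (PU PV : Measure ℝ) [IsProbabilityMeasure PU] [IsProbabilityMeasure PV]
    (lam : ℝ) : Set (ℝ × ℝ) :=
  {q | 0 ≤ q.1 ∧ 0 ≤ q.2 ∧ q.2 = Fov PU (lam * q.1) ∧ q.1 = Fov PV (lam * q.2)}

/-- The replica-symmetric potential `𝓕(λ,q₁,q₂)`. -/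
def rsF (PU PV : Measure ℝ) [IsProbabilityMeasure PU] [IsProbabilityMeasure PV]
    (lam q₁ q₂ : ℝ) : ℝ :=
  psiF PU (lam * q₁) + psiF PV (lam * q₂) - lam / 2 * q₁ * q₂

/-- Prior distribution of the pair of vectors `(u,v)`. -/
def prior (PU PV : Measure ℝ) [IsProbabilityMeasure PU] [IsProbabilityMeasure PV]
    (n : ℕ) : Measure ((Fin n → ℝ) × (Fin n → ℝ)) :=
  (Measure.pi fun _ => PU).prod (Measure.pi fun _ => PV)

/-- Law of the Gaussian noise matrix `Z`. -/
def noiseM (n : ℕ) : Measure (Fin n → Fin n → ℝ) :=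
  Measure.pi fun _ => Measure.pi fun _ => stdG

/-- Joint law of `((U,V),Z)`. -/
def sampleM (PU PV : Measure ℝ) [IsProbabilityMeasure PU] [IsProbabilityMeasure PV]
    (n : ℕ) : Measure (((Fin n → ℝ) × (Fin n → ℝ)) × (Fin n → Fin n → ℝ)) :=
  (prior PU PV n).prod (noiseM n)

/-- Hamiltonian `H_n(u,v)` of the planted bipartite model. -/
def Ham (lam : ℝ) (n : ℕ) (U V : Fin n → ℝ) (Z : Fin n → Fin n → ℝ)
    (u v : Fin n → ℝ) : ℝ :=
  ∑ i : Fin n, ∑ j : Fin n,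
    (Real.sqrt (lam / n) * u i * v j * Z i j
      + lam / n * (u i * U i * v j * V j)
      - lam / (2 * n) * (u i ^ 2 * v j ^ 2))

/-- Partition function `Z_n = ∫ e^{H_n(u,v)} dP₀ⁿ(u,v)`. -/
def partFun (PU PV : Measure ℝ) [IsProbabilityMeasure PU] [IsProbabilityMeasure PV]
    (lam : ℝ) (n : ℕ)
    (ω : ((Fin n → ℝ) × (Fin n → ℝ)) × (Fin n → Fin n → ℝ)) : ℝ :=
  ∫ uv, Real.exp (Ham lam n ω.1.1 ω.1.2 ω.2 uv.1 uv.2) ∂(prior PU PV n)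

/-- Free energy `F_n(λ) = (1/n)·E[log Z_n]`. -/
def freeEnergy (PU PV : Measure ℝ) [IsProbabilityMeasure PU] [IsProbabilityMeasure PV]
    (n : ℕ) (lam : ℝ) : ℝ :=
  (1 / (n : ℝ)) * ∫ ω, Real.log (partFun PU PV lam n ω) ∂(sampleM PU PV n)

/-- Gibbs (posterior) expectation `⟨f(u,v)⟩` given the realization `ω = ((U,V),Z)`. -/
def gibbs (PU PV : Measure ℝ) [IsProbabilityMeasure PU] [IsProbabilityMeasure PV]
    (lam : ℝ) (n : ℕ)
    (ω : ((Fin n → ℝ) × (Fin n → ℝ)) × (Fin n → Fin n → ℝ))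
    (f : (Fin n → ℝ) × (Fin n → ℝ) → ℝ) : ℝ :=
  (∫ uv, f uv * Real.exp (Ham lam n ω.1.1 ω.1.2 ω.2 uv.1 uv.2) ∂(prior PU PV n))
    / partFun PU PV lam n ω

/-- Rescaled scalar product `x·y = (1/n)·Σᵢ xᵢyᵢ`. -/
def ovDot (n : ℕ) (x y : Fin n → ℝ) : ℝ := (1 / (n : ℝ)) * ∑ i, x i * y i

set_option linter.unusedSectionVars false
set_option linter.unusedVariables false

section parta

instance stdG_prob : IsProbabilityMeasure stdG := by unfold stdG; infer_instance

/-- standard Gaussian product measure -/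
def gam (κ : Type*) [Fintype κ] : Measure (κ → ℝ) := Measure.pi fun _ => stdG

instance gam_prob (κ : Type*) [Fintype κ] : IsProbabilityMeasure (gam κ) := by
  unfold gam; infer_instance

lemma stdG_shift (v : ℝ) : stdG.map (fun y => y + v)
    = stdG.withDensity (fun y => ENNReal.ofReal (Real.exp (v * y - v ^ 2 / 2))) := by
  unfold stdG
  rw [gaussianReal_map_add_const, gaussianReal_of_var_ne_zero _ one_ne_zero,
    gaussianReal_of_var_ne_zero _ one_ne_zero, ← withDensity_mul]
  · congr 1
    ext y
    simp only [gaussianPDF, Pi.mul_apply, gaussianPDFReal]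
    rw [← ENNReal.ofReal_mul (by positivity), mul_assoc (_ : ℝ) (Real.exp _) (Real.exp _), ← Real.exp_add]
    congr 3
    simp
    ring
  · exact measurable_gaussianPDF _ _
  · fun_prop

lemma stdG_integrable_exp_abs (C : ℝ) : Integrable (fun y => Real.exp (C * |y|)) stdG := by
  unfold stdG
  have := integrable_exp_mul_abs (X := fun x : ℝ => x) (μ := gaussianReal 0 1) (t := C)
    (integrable_exp_mul_gaussianReal C) (by simpa using integrable_exp_mul_gaussianReal (-C))
  simpa using this

/-- the reference dominating function -/
def ex {κ : Type*} [Fintype κ] (C : ℝ) (y : κ → ℝ) : ℝ := Real.exp (C * ∑ k, |y k|)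

variable {κ : Type*} [Fintype κ]

lemma ex_pos (C : ℝ) (y : κ → ℝ) : 0 < ex C y := Real.exp_pos _

lemma ex_cont (C : ℝ) : Continuous (ex (κ := κ) C) := by unfold ex; fun_prop

lemma ex_mono {C D : ℝ} (h : C ≤ D) (y : κ → ℝ) : ex C y ≤ ex D y := by
  unfold ex
  gcongr

lemma ex_one_le {C : ℝ} (h : 0 ≤ C) (y : κ → ℝ) : 1 ≤ ex C y := by
  unfold ex
  rw [← Real.exp_zero]
  gcongr
  exact mul_nonneg h (Finset.sum_nonneg fun _ _ => abs_nonneg _)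

lemma ex_mul (C D : ℝ) (y : κ → ℝ) : ex C y * ex D y = ex (C + D) y := by
  unfold ex
  rw [← Real.exp_add]; ring_nf

lemma ex_integrable (C : ℝ) : Integrable (ex (κ := κ) C) (gam κ) := by
  have : Integrable (fun y : κ → ℝ => ∏ k, Real.exp (C * |y k|)) (gam κ) :=
    Integrable.fintype_prod (f := fun _ (x : ℝ) => Real.exp (C * |x|))
      (fun _ => stdG_integrable_exp_abs C)
  refine this.congr (Eventually.of_forall fun y => ?_)
  simp only [ex, Finset.mul_sum, Real.exp_sum]

/-- uniform sub-exponential growth of a family on a set of parameters -/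
def SubE {α : Type*} (A : Set α) (f : α → (κ → ℝ) → ℝ) : Prop :=
  ∃ C : ℝ, 0 ≤ C ∧ ∀ a ∈ A, ∀ y, |f a y| ≤ C * ex C y

namespace SubE
variable {α : Type*} {A : Set α} {f g : α → (κ → ℝ) → ℝ}

lemma of_bound {C D : ℝ} (hC : 0 ≤ C) (h : ∀ a ∈ A, ∀ y, |f a y| ≤ C * ex D y) : SubE A f := by
  refine ⟨max C |D|, by positivity, fun a ha y => (h a ha y).trans ?_⟩
  have h1 := ex_mono (κ := κ) ((le_abs_self D).trans (le_max_right C |D|)) y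
  have := ex_pos D y
  gcongr
  exact le_max_left _ _

lemma add (hf : SubE A f) (hg : SubE A g) : SubE A (fun a y => f a y + g a y) := by
  obtain ⟨C, hC, h⟩ := hf
  obtain ⟨D, hD, h'⟩ := hg
  refine of_bound (C := C + D) (D := max C D) (by positivity) fun a ha y => ?_
  refine (abs_add_le _ _).trans ?_
  have h1 := ex_mono (le_max_left C D) y
  have h2 := ex_mono (le_max_right C D) y
  calc _ ≤ C * ex C y + D * ex D y := add_le_add (h a ha y) (h' a ha y)
    _ ≤ C * ex (max C D) y + D * ex (max C D) y := by gcongr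
    _ = _ := by ring

lemma mul (hf : SubE A f) (hg : SubE A g) : SubE A (fun a y => f a y * g a y) := by
  obtain ⟨C, hC, h⟩ := hf
  obtain ⟨D, hD, h'⟩ := hg
  refine of_bound (C := C * D) (D := C + D) (by positivity) fun a ha y => ?_
  rw [abs_mul, ← ex_mul]
  calc _ ≤ (C * ex C y) * (D * ex D y) :=
        mul_le_mul (h a ha y) (h' a ha y) (abs_nonneg _) (mul_nonneg hC (ex_pos _ _).le)
    _ = _ := by ring

lemma const (c : ℝ) : SubE A (fun _ (_ : κ → ℝ) => c) :=
  of_bound (C := |c|) (D := 0) (abs_nonneg _) fun a _ y => by simp [ex]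

lemma of_bdd {C : ℝ} (h : ∀ a ∈ A, ∀ y, |f a y| ≤ C) : SubE A f :=
  of_bound (C := |C|) (D := 0) (abs_nonneg _) fun a ha y => by
    simpa [ex] using (h a ha y).trans (le_abs_self _)

lemma neg (hf : SubE A f) : SubE A (fun a y => - f a y) := by
  obtain ⟨C, hC, h⟩ := hf
  exact ⟨C, hC, fun a ha y => by simpa using h a ha y⟩

lemma sub (hf : SubE A f) (hg : SubE A g) : SubE A (fun a y => f a y - g a y) := by
  simpa [sub_eq_add_neg] using hf.add hg.neg

lemma pow_two (hf : SubE A f) : SubE A (fun a y => f a y ^ 2) := by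
  simpa [sq] using hf.mul hf

lemma sum {ι : Type*} (s : Finset ι) {F : ι → α → (κ → ℝ) → ℝ} (h : ∀ i ∈ s, SubE A (F i)) :
    SubE A (fun a y => ∑ i ∈ s, F i a y) := by
  classical
  induction s using Finset.induction_on with
  | empty => simpa using const (A := A) (κ := κ) 0
  | insert i s hi ih =>
    simp only [Finset.sum_insert hi]
    exact (h i (by simp)).add (ih fun j hj => h j (by simp [hj]))

lemma coord (k : κ) : SubE A (fun _ (y : κ → ℝ) => y k) := by
  refine of_bound (C := 1) (D := 1) zero_le_one fun a _ y => ?_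
  have : |y k| ≤ ∑ k, |y k| :=
    Finset.single_le_sum (f := fun k => |y k|) (fun _ _ => abs_nonneg _) (Finset.mem_univ k)
  have h2 := Real.add_one_le_exp (∑ k, |y k|)
  simp only [ex, one_mul]
  linarith

lemma congr (hf : SubE A f) (h : ∀ a ∈ A, ∀ y, g a y = f a y) : SubE A g := by
  obtain ⟨C, hC, h1⟩ := hf
  exact ⟨C, hC, fun a ha y => by rw [h a ha y]; exact h1 a ha y⟩

lemma mono_abs (hf : SubE A f) (h : ∀ a ∈ A, ∀ y, |g a y| ≤ |f a y|) : SubE A g := by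
  obtain ⟨C, hC, h1⟩ := hf
  exact ⟨C, hC, fun a ha y => (h a ha y).trans (h1 a ha y)⟩

lemma mono_set {B : Set α} (hf : SubE A f) (h : B ⊆ A) : SubE B f := by
  obtain ⟨C, hC, h1⟩ := hf
  exact ⟨C, hC, fun a ha y => h1 a (h ha) y⟩

lemma comp {β : Type*} (hf : SubE A f) {B : Set β} (u : β → α) (h : ∀ b ∈ B, u b ∈ A) :
    SubE B (fun b => f (u b)) := by
  obtain ⟨C, hC, h1⟩ := hf
  exact ⟨C, hC, fun a ha y => h1 _ (h a ha) y⟩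

lemma integrable (hf : SubE A f) {a : α} (ha : a ∈ A) (hm : Continuous (f a)) :
    Integrable (f a) (gam κ) := by
  obtain ⟨C, hC, h1⟩ := hf
  exact ((ex_integrable C).const_mul C).mono' hm.aestronglyMeasurable
    (Eventually.of_forall fun y => h1 a ha y)

/-- differentiation under the integral sign -/
lemma hasDerivAt {f f' : ℝ → (κ → ℝ) → ℝ} {A : Set ℝ} {t : ℝ} (hA : A ∈ 𝓝 t)
    (hf : SubE A f) (hf' : SubE A f') (hc : ∀ s ∈ A, Continuous (f s)) (hc' : ∀ s ∈ A, Continuous (f' s))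
    (hd : ∀ s ∈ A, ∀ y, HasDerivAt (fun s => f s y) (f' s y) s) :
    HasDerivAt (fun s => ∫ y, f s y ∂(gam κ)) (∫ y, f' t y ∂(gam κ)) t := by
  obtain ⟨C, hC, h1⟩ := id hf'
  refine (hasDerivAt_integral_of_dominated_loc_of_deriv_le (F := f) (F' := f')
    (bound := fun y => C * ex C y) hA ?_ ?_ ?_ ?_ ?_ ?_).2
  · filter_upwards [hA] with s hs
    exact (hc s hs).aestronglyMeasurable
  · exact hf.integrable (mem_of_mem_nhds hA) (hc t (mem_of_mem_nhds hA))
  · exact (hc' t (mem_of_mem_nhds hA)).aestronglyMeasurable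
  · exact Eventually.of_forall fun y s hs => h1 s hs y
  · exact (ex_integrable C).const_mul C
  · exact Eventually.of_forall fun y s hs => hd s hs y

lemma continuousAt {β : Type*} [TopologicalSpace β] [FirstCountableTopology β]
    {f : β → (κ → ℝ) → ℝ} {A : Set β} {t : β} (hA : A ∈ 𝓝 t)
    (hf : SubE A f) (hc : ∀ s ∈ A, Continuous (f s))
    (hd : ∀ y, ContinuousAt (fun s => f s y) t) :
    ContinuousAt (fun s => ∫ y, f s y ∂(gam κ)) t := by
  obtain ⟨C, hC, h1⟩ := hf
  refine continuousAt_of_dominated (bound := fun y => C * ex C y) ?_ ?_ ?_ ?_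
  · filter_upwards [hA] with s hs
    exact (hc s hs).aestronglyMeasurable
  · filter_upwards [hA] with s hs
    exact Eventually.of_forall fun y => h1 s hs y
  · exact (ex_integrable C).const_mul C
  · exact Eventually.of_forall fun y => hd y

end SubE

lemma gam_shift (v : κ → ℝ) : (gam κ).map (fun y => y + v)
    = (gam κ).withDensity (fun y => ENNReal.ofReal (Real.exp (∑ k, (v k * y k - v k ^ 2 / 2)))) := by
  have h0 : (gam κ).map (fun y => y + v) = Measure.pi (fun k => stdG.map (fun y => y + v k)) := by
    have : ∀ k : κ, IsProbabilityMeasure (stdG.map (fun y => y + v k)) := fun k =>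
      Measure.isProbabilityMeasure_map (by fun_prop)
    exact Measure.pi_map_pi (μ := fun _ : κ => stdG) (f := fun k y => y + v k)
      (fun k => by fun_prop)
  rw [h0]
  have : ∀ k : κ, IsProbabilityMeasure (stdG.map (fun y => y + v k)) := fun k =>
      Measure.isProbabilityMeasure_map (by fun_prop)
  refine Measure.pi_eq fun s hs => ?_
  have hi1 : ∀ k : κ, Integrable (fun y => Real.exp (v k * y - v k ^ 2 / 2)) (stdG.restrict (s k)) := by
    intro k
    have : Integrable (fun y => Real.exp (v k * y) * Real.exp (- v k ^ 2 / 2)) stdG := by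
      unfold stdG
      exact (integrable_exp_mul_gaussianReal (v k)).mul_const _
    refine (this.congr (Eventually.of_forall fun y => ?_)).restrict
    simp only [← Real.exp_add]; ring_nf
  rw [withDensity_apply _ (MeasurableSet.univ_pi hs)]
  unfold gam
  rw [Measure.restrict_pi_pi]
  have hprod : ∀ y : κ → ℝ, Real.exp (∑ k, (v k * y k - v k ^ 2 / 2))
     = ∏ k, Real.exp (v k * y k - v k ^ 2 / 2) := fun y => Real.exp_sum _ _
  simp_rw [hprod]
  rw [← ofReal_integral_eq_lintegral_ofReal]
  · rw [integral_fintype_prod_eq_prod (fun k (y : ℝ) => Real.exp (v k * y - v k ^ 2 / 2)),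
      ENNReal.ofReal_prod_of_nonneg]
    · refine Finset.prod_congr rfl fun k _ => ?_
      rw [stdG_shift, withDensity_apply _ (hs k), ofReal_integral_eq_lintegral_ofReal (hi1 k)]
      exact Eventually.of_forall fun _ => (Real.exp_pos _).le
    · intro k _
      exact integral_nonneg fun _ => (Real.exp_pos _).le
  · exact Integrable.fintype_prod (f := fun k (y : ℝ) => Real.exp (v k * y - v k ^ 2 / 2)) hi1
  · exact Eventually.of_forall fun _ => Finset.prod_nonneg fun _ _ => (Real.exp_pos _).le

lemma gam_integral_shift (v : κ → ℝ) (g : (κ → ℝ) → ℝ) :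
    ∫ y, g (y + v) ∂(gam κ) = ∫ y, Real.exp (∑ k, (v k * y k - v k ^ 2 / 2)) * g y ∂(gam κ) := by
  have h1 : ∫ y, g y ∂((gam κ).map (fun y => y + v)) = ∫ y, g (y + v) ∂(gam κ) :=
    (MeasurableEquiv.addRight v).measurableEmbedding.integral_map g
  rw [← h1, gam_shift, integral_withDensity_eq_integral_toReal_smul]
  · refine integral_congr_ae (Eventually.of_forall fun y => ?_)
    simp only [smul_eq_mul]
    rw [ENNReal.toReal_ofReal (Real.exp_pos _).le]
  · fun_prop
  · exact Eventually.of_forall fun _ => ENNReal.ofReal_lt_top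

/-- Gaussian integration by parts -/
lemma gam_ibp [DecidableEq κ] (k : κ) (g g' : (κ → ℝ) → ℝ) (hg : SubE (Set.univ : Set Unit) fun _ => g)
    (hg' : SubE (Set.univ : Set Unit) fun _ => g') (hc : Continuous g) (hc' : Continuous g')
    (hd0 : ∀ y : κ → ℝ, HasDerivAt (fun s : ℝ => g (y + (Pi.single k s : κ → ℝ))) (g' y) 0) :
    ∫ y, y k * g y ∂(gam κ) = ∫ y, g' y ∂(gam κ) := by
  have hd : ∀ y : κ → ℝ, ∀ s : ℝ, HasDerivAt (fun s : ℝ => g (y + (Pi.single k s : κ → ℝ)))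
      (g' (y + (Pi.single k s : κ → ℝ))) s := by
    intro y s
    have h1 : HasDerivAt (fun x : ℝ => x - s) 1 s := (hasDerivAt_id s).sub_const s
    have h2 := HasDerivAt.comp s (h₂ := fun s' : ℝ => g ((y + Pi.single k s) + (Pi.single k s' : κ → ℝ)))
      (by simpa using hd0 (y + Pi.single k s)) h1
    convert! h2 using 1
    · ext x
      simp only [Function.comp, add_assoc, ← Pi.single_add]
      simp
    · simp
  have key : ∀ s : ℝ, ∫ y, g (y + Pi.single k s) ∂(gam κ)
      = ∫ y, Real.exp (s * y k - s ^ 2 / 2) * g y ∂(gam κ) := by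
    intro s
    rw [gam_integral_shift]
    refine integral_congr_ae (Eventually.of_forall fun y => ?_)
    simp only
    congr 2
    rw [Finset.sum_eq_single k]
    · simp
    · intro j _ hj; simp [hj]
    · simp
  have hA : Set.Icc (-1 : ℝ) 1 ∈ 𝓝 (0 : ℝ) := Icc_mem_nhds (by norm_num) (by norm_num)
  have shiftE : ∀ h : (κ → ℝ) → ℝ, (SubE (Set.univ : Set Unit) fun _ => h) →
      SubE (Set.Icc (-1 : ℝ) 1) (fun s y => h (y + Pi.single k s)) := by
    rintro h ⟨C, hC, hb⟩
    refine SubE.of_bound (C := C * Real.exp C) (D := C) (by positivity) fun s hs y => ?_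
    refine (hb () trivial _).trans ?_
    rw [mul_assoc]
    refine mul_le_mul_of_nonneg_left ?_ hC
    unfold ex
    rw [← Real.exp_add]
    refine Real.exp_le_exp.2 ?_
    rw [← mul_one_add]
    refine mul_le_mul_of_nonneg_left ?_ hC
    have h1 : ∑ j, |(y + (Pi.single k s : κ → ℝ)) j| ≤ ∑ j, (|y j| + |(Pi.single k s : κ → ℝ) j|) :=
      Finset.sum_le_sum fun j _ => abs_add_le _ _
    have h2 : ∑ j, |(Pi.single k s : κ → ℝ) j| = |s| := by
      rw [Finset.sum_eq_single k]
      · simp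
      · intro j _ hj; simp [hj]
      · simp
    rw [Finset.sum_add_distrib, h2] at h1
    have : |s| ≤ 1 := abs_le.2 hs
    linarith
  have d1 : HasDerivAt (fun s : ℝ => ∫ y, g (y + Pi.single k s) ∂(gam κ))
      (∫ y, g' (y + Pi.single k (0 : ℝ)) ∂(gam κ)) 0 := by
    refine SubE.hasDerivAt (f' := fun s y => g' (y + Pi.single k s)) hA (shiftE g hg) (shiftE g' hg') ?_ ?_ ?_
    · intro s _; exact hc.comp (by fun_prop)
    · intro s _; exact hc'.comp (by fun_prop)
    · intro s _ y; exact hd y s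
  have hexp : SubE (Set.Icc (-1 : ℝ) 1) (fun s (y : κ → ℝ) => Real.exp (s * y k - s ^ 2 / 2)) := by
    refine SubE.of_bound (C := 1) (D := 1) zero_le_one fun s hs y => ?_
    rw [Real.abs_exp, one_mul]
    refine Real.exp_le_exp.2 ?_
    have h1 : |y k| ≤ ∑ k, |y k| :=
      Finset.single_le_sum (f := fun k => |y k|) (fun _ _ => abs_nonneg _) (Finset.mem_univ k)
    have h2 : |s| ≤ 1 := abs_le.2 hs
    have h3 : s * y k ≤ |s| * |y k| := by rw [← abs_mul]; exact le_abs_self _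
    nlinarith [abs_nonneg (y k), sq_nonneg s]
  have hgI : SubE (Set.Icc (-1 : ℝ) 1) (fun _ => g) := hg.comp (fun _ => ()) (fun _ _ => trivial)
  have d2 : HasDerivAt (fun s : ℝ => ∫ y, Real.exp (s * y k - s ^ 2 / 2) * g y ∂(gam κ))
      (∫ y, (Real.exp ((0 : ℝ) * y k - (0 : ℝ) ^ 2 / 2) * (y k - 0)) * g y ∂(gam κ)) 0 := by
    refine SubE.hasDerivAt (f' := fun s y => (Real.exp (s * y k - s ^ 2 / 2) * (y k - s)) * g y) hA
      (hexp.mul hgI) ((hexp.mul ((SubE.coord k).sub (SubE.of_bdd (C := 1) ?_))).mul hgI) ?_ ?_ ?_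
    · intro s hs y; exact abs_le.2 hs
    · intro s _; fun_prop
    · intro s _; fun_prop
    · intro s _ y
      refine HasDerivAt.mul_const ?_ _
      refine HasDerivAt.exp ?_
      have h1 := ((hasDerivAt_id s).mul_const (y k)).sub (((hasDerivAt_id s).pow 2).div_const 2)
      convert! h1 using 1
      simp
  have := d1.unique (by simpa only [key] using d2)
  simpa [mul_comm] using this.symm


end parta

section partb
variable {κ : Type*} [Fintype κ]

set_option linter.unusedSectionVars false
set_option linter.unusedVariables false
/-- A Gaussian channel with finitely supported signal: signal values `x ∈ T` with weights `p x`,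
observed through `y k = w k * a k x + noise`. -/
structure Ch (X : Type*) (κ : Type*) where
  T : Finset X
  p : X → ℝ
  hp : ∀ x, 0 ≤ p x
  hp1 : ∑ x ∈ T, p x = 1
  a : κ → X → ℝ
  K : ℝ
  hK : ∀ k, ∀ x ∈ T, |a k x| ≤ K

namespace Ch
variable {X : Type*} (S : Ch X κ)

def W (w : κ → ℝ) (x : X) (y : κ → ℝ) : ℝ :=
  Real.exp (∑ k, (w k * S.a k x * y k - (w k * S.a k x) ^ 2 / 2))

def Zc (c : X → ℝ) (w y : κ → ℝ) : ℝ := ∑ x ∈ S.T, S.p x * c x * S.W w x y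

def Z (w y : κ → ℝ) : ℝ := S.Zc (fun _ => 1) w y

def br (c : X → ℝ) (w y : κ → ℝ) : ℝ := S.Zc c w y / S.Z w y

def Phi (w : κ → ℝ) : ℝ := ∫ y, S.Z w y * Real.log (S.Z w y) ∂(gam κ)

def M (c : X → ℝ) (w : κ → ℝ) : ℝ := ∫ y, S.Z w y * (S.br c w y) ^ 2 ∂(gam κ)

def cov (c d : X → ℝ) (w y : κ → ℝ) : ℝ :=
  S.br (fun x => c x * d x) w y - S.br c w y * S.br d w y

def CV (c d : X → ℝ) (w : κ → ℝ) : ℝ := ∫ y, S.Z w y * (S.cov c d w y) ^ 2 ∂(gam κ)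

lemma W_pos (w : κ → ℝ) (x : X) (y : κ → ℝ) : 0 < S.W w x y := Real.exp_pos _

lemma exists_pos : ∃ x ∈ S.T, 0 < S.p x := by
  by_contra! h
  have : ∑ x ∈ S.T, S.p x ≤ 0 := Finset.sum_nonpos h
  linarith [S.hp1]

lemma Z_pos (w y : κ → ℝ) : 0 < S.Z w y := by
  obtain ⟨x, hx, hpx⟩ := S.exists_pos
  refine Finset.sum_pos' (fun x _ => ?_) ⟨x, hx, ?_⟩
  · have := S.hp x; have := S.W_pos w x y; positivity
  · have := S.W_pos w x y; positivity

lemma K_nonneg [Nonempty κ] : 0 ≤ S.K := by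
  obtain ⟨x, hx, -⟩ := S.exists_pos
  exact (abs_nonneg _).trans (S.hK (Classical.arbitrary κ) x hx)

lemma Zc_eq (c : X → ℝ) (w y : κ → ℝ) : S.Zc c w y = S.Z w y * S.br c w y := by
  unfold br
  have := S.Z_pos w y
  field_simp

@[fun_prop]
lemma W_cont (x : X) : Continuous (fun q : (κ → ℝ) × (κ → ℝ) => S.W q.1 x q.2) := by
  unfold W; fun_prop

lemma Zc_cont (c : X → ℝ) : Continuous (fun q : (κ → ℝ) × (κ → ℝ) => S.Zc c q.1 q.2) := by
  unfold Zc
  refine continuous_finsetSum _ fun x _ => ?_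
  exact continuous_const.mul (S.W_cont x)

lemma Z_cont : Continuous (fun q : (κ → ℝ) × (κ → ℝ) => S.Z q.1 q.2) := S.Zc_cont _

lemma br_cont (c : X → ℝ) : Continuous (fun q : (κ → ℝ) × (κ → ℝ) => S.br c q.1 q.2) :=
  (S.Zc_cont c).div S.Z_cont fun q => (S.Z_pos _ _).ne'

lemma log_cont : Continuous (fun q : (κ → ℝ) × (κ → ℝ) => Real.log (S.Z q.1 q.2)) :=
  S.Z_cont.log fun q => (S.Z_pos _ _).ne'

lemma cov_cont (c d : X → ℝ) : Continuous (fun q : (κ → ℝ) × (κ → ℝ) => S.cov c d q.1 q.2) :=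
  (S.br_cont _).sub ((S.br_cont _).mul (S.br_cont _))

lemma cont_pair_y (w : κ → ℝ) : Continuous (fun y : κ → ℝ => (w, y)) :=
  Continuous.prodMk continuous_const continuous_id
lemma cont_pair_w (y : κ → ℝ) : Continuous (fun w : κ → ℝ => (w, y)) :=
  Continuous.prodMk continuous_id continuous_const

@[fun_prop] lemma Zc_cont_y (c : X → ℝ) (w : κ → ℝ) : Continuous (S.Zc c w) := by
  have h := (S.Zc_cont c).comp (cont_pair_y w)
  exact h
@[fun_prop] lemma Z_cont_y (w : κ → ℝ) : Continuous (S.Z w) := by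
  have h := (S.Z_cont).comp (cont_pair_y w)
  exact h
@[fun_prop] lemma br_cont_y (c : X → ℝ) (w : κ → ℝ) : Continuous (S.br c w) := by
  have h := (S.br_cont c).comp (cont_pair_y w)
  exact h
@[fun_prop] lemma log_cont_y (w : κ → ℝ) : Continuous (fun y => Real.log (S.Z w y)) := by
  have h := (S.log_cont).comp (cont_pair_y w)
  exact h
@[fun_prop] lemma cov_cont_y (c d : X → ℝ) (w : κ → ℝ) : Continuous (S.cov c d w) := by
  have h := (S.cov_cont c d).comp (cont_pair_y w)
  exact h

lemma Zc_cont_w (c : X → ℝ) (y : κ → ℝ) : Continuous (fun w => S.Zc c w y) := by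
  have h := (S.Zc_cont c).comp (cont_pair_w y)
  exact h
lemma Z_cont_w (y : κ → ℝ) : Continuous (fun w => S.Z w y) := by
  have h := (S.Z_cont).comp (cont_pair_w y)
  exact h
lemma br_cont_w (c : X → ℝ) (y : κ → ℝ) : Continuous (fun w => S.br c w y) := by
  have h := (S.br_cont c).comp (cont_pair_w y)
  exact h
lemma log_cont_w (y : κ → ℝ) : Continuous (fun w => Real.log (S.Z w y)) := by
  have h := (S.log_cont).comp (cont_pair_w y)
  exact h
lemma cov_cont_w (c d : X → ℝ) (y : κ → ℝ) : Continuous (fun w => S.cov c d w y) := by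
  have h := (S.cov_cont c d).comp (cont_pair_w y)
  exact h

/-- bounded parameter set -/
def box (κ : Type*) (B : ℝ) : Set (κ → ℝ) := {w | ∀ k, |w k| ≤ B}

lemma lin_bound {B : ℝ} {w : κ → ℝ} (hw : w ∈ box κ B) {x : X} (hx : x ∈ S.T) (y : κ → ℝ) :
    |∑ k, w k * S.a k x * y k| ≤ |B| * |S.K| * ∑ k, |y k| := by
  rw [Finset.mul_sum]
  refine (Finset.abs_sum_le_sum_abs _ _).trans (Finset.sum_le_sum fun k _ => ?_)
  rw [abs_mul, abs_mul]
  have h1 := (hw k).trans (le_abs_self B)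
  have h2 := (S.hK k x hx).trans (le_abs_self S.K)
  gcongr

lemma quad_bound {B : ℝ} {w : κ → ℝ} (hw : w ∈ box κ B) {x : X} (hx : x ∈ S.T) :
    ∑ k, (w k * S.a k x) ^ 2 / 2 ≤ Fintype.card κ * ((|B| * |S.K|) ^ 2 / 2) := by
  rw [← nsmul_eq_mul, ← Finset.card_univ, ← Finset.sum_const]
  refine Finset.sum_le_sum fun k _ => ?_
  have h1 := (hw k).trans (le_abs_self B)
  have h2 := (S.hK k x hx).trans (le_abs_self S.K)
  have h3 : |w k * S.a k x| ≤ |B| * |S.K| := by rw [abs_mul]; gcongr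
  have := sq_le_sq' (abs_le.1 h3).1 (abs_le.1 h3).2
  linarith

lemma W_le {B : ℝ} {w : κ → ℝ} (hw : w ∈ box κ B) {x : X} (hx : x ∈ S.T) (y : κ → ℝ) :
    S.W w x y ≤ ex (|B| * |S.K|) y := by
  unfold W ex
  refine Real.exp_le_exp.2 ?_
  rw [Finset.sum_sub_distrib]
  have h1 := (abs_le.1 (S.lin_bound hw hx y)).2
  have h2 : 0 ≤ ∑ k, (w k * S.a k x) ^ 2 / 2 := Finset.sum_nonneg fun _ _ => by positivity
  linarith

lemma W_ge {B : ℝ} {w : κ → ℝ} (hw : w ∈ box κ B) {x : X} (hx : x ∈ S.T) (y : κ → ℝ) :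
    Real.exp (-(|B| * |S.K| * ∑ k, |y k|) - Fintype.card κ * ((|B| * |S.K|) ^ 2 / 2)) ≤ S.W w x y := by
  unfold W
  refine Real.exp_le_exp.2 ?_
  rw [Finset.sum_sub_distrib]
  have h1 := (abs_le.1 (S.lin_bound hw hx y)).1
  have h2 := S.quad_bound hw hx
  linarith

lemma subE_Zc (c : X → ℝ) (B : ℝ) : SubE (box κ B) (S.Zc c) := by
  refine SubE.of_bound (C := ∑ x ∈ S.T, |S.p x * c x|) (D := |B| * |S.K|)
    (Finset.sum_nonneg fun _ _ => abs_nonneg _) fun w hw y => ?_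
  unfold Zc
  rw [Finset.sum_mul]
  refine (Finset.abs_sum_le_sum_abs _ _).trans (Finset.sum_le_sum fun x hx => ?_)
  rw [abs_mul, abs_of_pos (S.W_pos w x y)]
  have := S.W_le hw hx y
  gcongr

lemma subE_Z (B : ℝ) : SubE (box κ B) S.Z := S.subE_Zc _ B

lemma Z_le {B : ℝ} {w : κ → ℝ} (hw : w ∈ box κ B) (y : κ → ℝ) :
    S.Z w y ≤ ex (|B| * |S.K|) y := by
  unfold Z Zc
  calc _ ≤ ∑ x ∈ S.T, S.p x * ex (|B| * |S.K|) y := by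
        refine Finset.sum_le_sum fun x hx => ?_
        rw [mul_one]
        exact mul_le_mul_of_nonneg_left (S.W_le hw hx y) (S.hp x)
    _ = _ := by rw [← Finset.sum_mul, S.hp1, one_mul]

lemma Z_ge {B : ℝ} {w : κ → ℝ} (hw : w ∈ box κ B) (y : κ → ℝ) :
    Real.exp (-(|B| * |S.K| * ∑ k, |y k|) - Fintype.card κ * ((|B| * |S.K|) ^ 2 / 2)) ≤ S.Z w y := by
  unfold Z Zc
  calc _ = ∑ x ∈ S.T, S.p x * Real.exp (-(|B| * |S.K| * ∑ k, |y k|) - Fintype.card κ * ((|B| * |S.K|) ^ 2 / 2)) := by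
        rw [← Finset.sum_mul, S.hp1, one_mul]
    _ ≤ _ := by
        refine Finset.sum_le_sum fun x hx => ?_
        rw [mul_one]
        exact mul_le_mul_of_nonneg_left (S.W_ge hw hx y) (S.hp x)

lemma subE_log (B : ℝ) : SubE (box κ B) (fun w y => Real.log (S.Z w y)) := by
  set b := |B| * |S.K| with hb
  have hb0 : 0 ≤ b := by positivity
  have h1 : SubE (box κ B) (fun _ (y : κ → ℝ) => b * ∑ k, |y k| + Fintype.card κ * (b ^ 2 / 2)) := by
    refine ((SubE.const b).mul (SubE.sum _ fun k _ => ?_)).add (SubE.const _)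
    exact (SubE.coord k).mono_abs fun _ _ y => by simp
  refine h1.mono_abs fun w hw y => ?_
  have hs : 0 ≤ ∑ k, |y k| := Finset.sum_nonneg fun _ _ => abs_nonneg _
  refine le_trans ?_ (le_abs_self _)
  rw [abs_le]
  constructor
  · have := Real.log_le_log (Real.exp_pos _) (S.Z_ge hw y)
    rw [Real.log_exp, ← hb] at this
    linarith
  · have := Real.log_le_log (S.Z_pos w y) (S.Z_le hw y)
    unfold ex at this
    rw [Real.log_exp, ← hb] at this
    have : 0 ≤ Fintype.card κ * (b ^ 2 / 2) := by positivity
    linarith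

lemma br_abs_le {c : X → ℝ} {C : ℝ} (hc : ∀ x ∈ S.T, |c x| ≤ C) (w y : κ → ℝ) :
    |S.br c w y| ≤ C := by
  unfold br
  have hZ := S.Z_pos w y
  rw [abs_div, abs_of_pos hZ, div_le_iff₀ hZ]
  unfold Zc Z Zc
  rw [Finset.mul_sum]
  refine (Finset.abs_sum_le_sum_abs _ _).trans (Finset.sum_le_sum fun x hx => ?_)
  have h1 := S.hp x
  have h2 := S.W_pos w x y
  rw [abs_mul, abs_mul, abs_of_nonneg h1, abs_of_pos h2]
  have := hc x hx
  have h3 : 0 ≤ S.p x * S.W w x y := by positivity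
  nlinarith [mul_le_mul_of_nonneg_right this h3]

lemma exists_bd (c : X → ℝ) : ∃ C, 0 ≤ C ∧ ∀ x ∈ S.T, |c x| ≤ C := by
  refine ⟨∑ x ∈ S.T, |c x|, Finset.sum_nonneg fun _ _ => abs_nonneg _, fun x hx => ?_⟩
  exact Finset.single_le_sum (f := fun x => |c x|) (fun _ _ => abs_nonneg _) hx

lemma subE_br (c : X → ℝ) (A : Set (κ → ℝ)) : SubE A (S.br c) := by
  obtain ⟨C, -, hC⟩ := S.exists_bd c
  exact SubE.of_bdd fun w _ y => S.br_abs_le hC w y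

lemma subE_cov (c d : X → ℝ) (A : Set (κ → ℝ)) : SubE A (S.cov c d) :=
  (S.subE_br _ A).sub ((S.subE_br _ A).mul (S.subE_br _ A))

lemma mem_box (w : κ → ℝ) : w ∈ box κ ‖w‖ := fun k => norm_le_pi_norm w k

lemma box_nhds (w : κ → ℝ) : box κ (‖w‖ + 1) ∈ 𝓝 w := by
  filter_upwards [Metric.closedBall_mem_nhds w zero_lt_one] with v hv k
  have h1 : |v k| ≤ ‖v‖ := norm_le_pi_norm v k
  have h2 : ‖v - w‖ ≤ 1 := by simpa [dist_eq_norm] using hv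
  have h3 : ‖v‖ ≤ ‖v - w‖ + ‖w‖ := by simpa using norm_add_le (v - w) w
  linarith

/-- integrability of `Z * g` for a fixed parameter -/
lemma int_Z_mul {w : κ → ℝ} {g : (κ → ℝ) → ℝ} (hg : SubE (Set.univ : Set Unit) fun _ => g)
    (hc : Continuous g) : Integrable (fun y => S.Z w y * g y) (gam κ) := by
  have h1 := (S.subE_Z ‖w‖).comp (B := (Set.univ : Set Unit)) (fun _ => w) (fun _ _ => mem_box w)
  exact (h1.mul hg).integrable (a := ()) trivial (by fun_prop)

lemma subE_fix {f : (κ → ℝ) → (κ → ℝ) → ℝ} {w : κ → ℝ} (h : SubE (box κ ‖w‖) f) :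
    SubE (Set.univ : Set Unit) fun _ => f w :=
  h.comp (fun _ => w) (fun _ _ => mem_box w)

lemma Phi_cont : Continuous S.Phi := by
  rw [continuous_iff_continuousAt]
  intro w
  refine SubE.continuousAt (f := fun w y => S.Z w y * Real.log (S.Z w y)) (box_nhds w)
    ((S.subE_Z _).mul (S.subE_log _)) (fun _ _ => by fun_prop) fun y => ?_
  exact ((S.Z_cont_w y).mul (S.log_cont_w y)).continuousAt

lemma M_cont (c : X → ℝ) : Continuous (S.M c) := by
  rw [continuous_iff_continuousAt]
  intro w
  refine SubE.continuousAt (f := fun w y => S.Z w y * S.br c w y ^ 2) (box_nhds w)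
    ((S.subE_Z _).mul (S.subE_br _ _).pow_two) (fun _ _ => by fun_prop) fun y => ?_
  exact ((S.Z_cont_w y).mul ((S.br_cont_w c y).pow 2)).continuousAt

/-- Nishimori / Bayes identity -/
lemma nishi (w : κ → ℝ) (g : (κ → ℝ) → ℝ) (hg : SubE (Set.univ : Set Unit) fun _ => g)
    (hc : Continuous g) (c : X → ℝ) :
    ∑ x ∈ S.T, S.p x * c x * ∫ z, g (z + fun k => w k * S.a k x) ∂(gam κ)
      = ∫ y, S.Z w y * (S.br c w y * g y) ∂(gam κ) := by
  have hW : ∀ x ∈ S.T, Integrable (fun y => S.W w x y * g y) (gam κ) := by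
    intro x hx
    have h1 : SubE (Set.univ : Set Unit) (fun _ => S.W w x) :=
      SubE.of_bound (C := 1) (D := |‖w‖| * |S.K|) zero_le_one fun _ _ y => by
        rw [abs_of_pos (S.W_pos w x y), one_mul]; exact S.W_le (mem_box w) hx y
    refine (h1.mul hg).integrable (a := ()) trivial ?_
    exact ((S.W_cont x).comp (cont_pair_y w)).mul hc
  have h2 : ∀ y, S.Z w y * (S.br c w y * g y) = ∑ x ∈ S.T, S.p x * c x * (S.W w x y * g y) := by
    intro y
    rw [← mul_assoc, ← Zc_eq, Zc, Finset.sum_mul]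
    exact Finset.sum_congr rfl fun x _ => by ring
  simp_rw [h2]
  rw [integral_finsetSum _ fun x hx => (hW x hx).const_mul _]
  refine Finset.sum_congr rfl fun x _ => ?_
  rw [integral_const_mul, gam_integral_shift]
  rfl

lemma br_one (w y : κ → ℝ) : S.br (fun _ => 1) w y = 1 := div_self (S.Z_pos w y).ne'

lemma nishi1 (w : κ → ℝ) (g : (κ → ℝ) → ℝ) (hg : SubE (Set.univ : Set Unit) fun _ => g)
    (hc : Continuous g) :
    ∑ x ∈ S.T, S.p x * ∫ z, g (z + fun k => w k * S.a k x) ∂(gam κ)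
      = ∫ y, S.Z w y * g y ∂(gam κ) := by
  have := S.nishi w g hg hc (fun _ => 1)
  simpa [br_one] using this

lemma int_Z (w : κ → ℝ) : ∫ y, S.Z w y ∂(gam κ) = 1 := by
  have := S.nishi1 w (fun _ => 1) (SubE.const 1) continuous_const
  simp only [mul_one, integral_const, smul_eq_mul, probReal_univ] at this
  rw [← this, S.hp1]

lemma integrable_Z (w : κ → ℝ) : Integrable (S.Z w) (gam κ) :=
  (subE_fix (S.subE_Z _)).integrable (a := ()) trivial (by fun_prop)

lemma int_Z_le {w : κ → ℝ} {g : (κ → ℝ) → ℝ} {C : ℝ} (hg : ∀ y, |g y| ≤ C)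
    (hc : Continuous g) : |∫ y, S.Z w y * g y ∂(gam κ)| ≤ C := by
  have h1 : Integrable (fun y => S.Z w y * C) (gam κ) := (S.integrable_Z w).mul_const C
  have h2 : |∫ y, S.Z w y * g y ∂(gam κ)| ≤ ∫ y, S.Z w y * C ∂(gam κ) := by
    rw [← Real.norm_eq_abs]
    refine norm_integral_le_of_norm_le h1 (Eventually.of_forall fun y => ?_)
    rw [Real.norm_eq_abs, abs_mul, abs_of_pos (S.Z_pos w y)]
    exact mul_le_mul_of_nonneg_left (hg y) (S.Z_pos w y).le
  rwa [integral_mul_const, S.int_Z, one_mul] at h2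

lemma M_nonneg (c : X → ℝ) (w : κ → ℝ) : 0 ≤ S.M c w :=
  integral_nonneg fun y => mul_nonneg (S.Z_pos w y).le (sq_nonneg _)

lemma CV_nonneg (c d : X → ℝ) (w : κ → ℝ) : 0 ≤ S.CV c d w :=
  integral_nonneg fun y => mul_nonneg (S.Z_pos w y).le (sq_nonneg _)

lemma M_le {c : X → ℝ} {C : ℝ} (hc : ∀ x ∈ S.T, |c x| ≤ C) (w : κ → ℝ) : S.M c w ≤ C ^ 2 := by
  refine (le_abs_self _).trans (S.int_Z_le (fun y => ?_) (by fun_prop))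
  rw [abs_pow]
  exact pow_le_pow_left₀ (abs_nonneg _) (S.br_abs_le hc w y) 2

lemma Phi_nonneg (w : κ → ℝ) : 0 ≤ S.Phi w := by
  have h1 : ∫ y, (S.Z w y - 1) ∂(gam κ) ≤ S.Phi w := by
    refine integral_mono ((S.integrable_Z w).sub (integrable_const 1)) ?_ fun y => ?_
    · exact S.int_Z_mul (subE_fix (S.subE_log _)) (by fun_prop)
    · have hZ := S.Z_pos w y
      have := Real.one_sub_inv_le_log_of_pos hZ
      have h2 := mul_le_mul_of_nonneg_left this hZ.le
      rw [mul_sub, mul_inv_cancel₀ hZ.ne', mul_one] at h2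
      exact h2
  rw [integral_sub (S.integrable_Z w) (integrable_const 1), S.int_Z] at h1
  simpa using h1

end Ch

end partb

section partc
variable {κ : Type*} [Fintype κ]

namespace Ch
variable {X : Type*} (S : Ch X κ)

/-- the elementary derivative of `Zc c` in the `k`-th parameter -/
def D (c : X → ℝ) (k : κ) (w y : κ → ℝ) : ℝ :=
  y k * S.Zc (fun x => c x * S.a k x) w y - w k * S.Zc (fun x => c x * S.a k x * S.a k x) w y

lemma W_hasDerivAt {w w' : ℝ → κ → ℝ} {s : ℝ}
    (hd : ∀ k, HasDerivAt (fun s => w s k) (w' s k) s) (x : X) (y : κ → ℝ) :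
    HasDerivAt (fun s => S.W (w s) x y)
      (S.W (w s) x y * ∑ k, (w' s k * S.a k x * y k - w s k * S.a k x * (w' s k * S.a k x))) s := by
  unfold W
  refine HasDerivAt.exp ?_
  refine HasDerivAt.fun_sum fun k _ => ?_
  refine (((hd k).mul_const _).mul_const _).sub ?_
  have := (((hd k).mul_const (S.a k x)).fun_pow 2).div_const 2
  refine this.congr_deriv ?_
  push_cast
  ring

lemma Zc_hasDerivAt {w w' : ℝ → κ → ℝ} {s : ℝ}
    (hd : ∀ k, HasDerivAt (fun s => w s k) (w' s k) s) (c : X → ℝ) (y : κ → ℝ) :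
    HasDerivAt (fun s => S.Zc c (w s) y) (∑ k, w' s k * S.D c k (w s) y) s := by
  unfold Zc
  refine (HasDerivAt.fun_sum fun x _ => (S.W_hasDerivAt hd x y).const_mul (S.p x * c x)).congr_deriv ?_
  simp_rw [D, Zc, Finset.mul_sum, ← Finset.sum_sub_distrib, Finset.mul_sum]
  rw [Finset.sum_comm]
  refine Finset.sum_congr rfl fun k _ => Finset.sum_congr rfl fun x _ => ?_
  ring

lemma W_hasDerivAt_y [DecidableEq κ] (w : κ → ℝ) (x : X) (y : κ → ℝ) (k : κ) :
    HasDerivAt (fun s : ℝ => S.W w x (y + (Pi.single k s : κ → ℝ)))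
      (S.W w x y * (w k * S.a k x)) 0 := by
  have h : ∀ s : ℝ, S.W w x (y + (Pi.single k s : κ → ℝ))
      = Real.exp (∑ k, (w k * S.a k x * y k - (w k * S.a k x) ^ 2 / 2) + (w k * S.a k x) * s) := by
    intro s
    unfold W
    congr 1
    have : ∑ j, w j * S.a j x * (Pi.single k s : κ → ℝ) j = w k * S.a k x * s := by
      rw [Finset.sum_eq_single k]
      · simp
      · intro j _ hj; simp [Pi.single_eq_of_ne hj]
      · simp
    rw [← this, ← Finset.sum_add_distrib]
    refine Finset.sum_congr rfl fun j _ => ?_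
    simp only [Pi.add_apply]
    ring
  simp_rw [h]
  have := (((hasDerivAt_id (0:ℝ)).const_mul (w k * S.a k x)).const_add
    (∑ k, (w k * S.a k x * y k - (w k * S.a k x) ^ 2 / 2))).exp
  refine this.congr_deriv ?_
  simp [W]

lemma Zc_hasDerivAt_y [DecidableEq κ] (c : X → ℝ) (w : κ → ℝ) (y : κ → ℝ) (k : κ) :
    HasDerivAt (fun s : ℝ => S.Zc c w (y + (Pi.single k s : κ → ℝ)))
      (w k * S.Zc (fun x => c x * S.a k x) w y) 0 := by
  unfold Zc
  refine (HasDerivAt.fun_sum fun x _ => (S.W_hasDerivAt_y w x y k).const_mul (S.p x * c x)).congr_deriv ?_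
  rw [Finset.mul_sum]
  exact Finset.sum_congr rfl fun x _ => by ring

lemma Z_hasDerivAt_y [DecidableEq κ] (w : κ → ℝ) (y : κ → ℝ) (k : κ) :
    HasDerivAt (fun s : ℝ => S.Z w (y + (Pi.single k s : κ → ℝ)))
      (w k * S.Zc (S.a k) w y) 0 := by
  have h := S.Zc_hasDerivAt_y (fun _ => 1) w y k
  simp only [one_mul] at h
  exact h

lemma log_hasDerivAt_y [DecidableEq κ] (w : κ → ℝ) (y : κ → ℝ) (k : κ) :
    HasDerivAt (fun s : ℝ => Real.log (S.Z w (y + (Pi.single k s : κ → ℝ))))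
      (w k * S.br (S.a k) w y) 0 := by
  refine ((S.Z_hasDerivAt_y w y k).log (S.Z_pos _ _).ne').congr_deriv ?_
  simp [br, mul_div_assoc]

lemma br_hasDerivAt_y [DecidableEq κ] (c : X → ℝ) (w : κ → ℝ) (y : κ → ℝ) (k : κ) :
    HasDerivAt (fun s : ℝ => S.br c w (y + (Pi.single k s : κ → ℝ)))
      (w k * S.cov c (S.a k) w y) 0 := by
  refine ((S.Zc_hasDerivAt_y c w y k).fun_div (S.Z_hasDerivAt_y w y k) (S.Z_pos _ _).ne').congr_deriv ?_
  have := S.Z_pos w y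
  simp only [Pi.single_zero, add_zero, cov, br]
  field_simp

lemma ibpZ [DecidableEq κ] (c : X → ℝ) (k : κ) (w : κ → ℝ) (G G' : (κ → ℝ) → ℝ)
    (hg : SubE (Set.univ : Set Unit) fun _ => G) (hg' : SubE (Set.univ : Set Unit) fun _ => G')
    (hc : Continuous G) (hc' : Continuous G')
    (hd : ∀ y : κ → ℝ, HasDerivAt (fun s : ℝ => G (y + (Pi.single k s : κ → ℝ))) (G' y) 0) :
    ∫ y, S.D c k w y * G y ∂(gam κ) = ∫ y, S.Zc (fun x => c x * S.a k x) w y * G' y ∂(gam κ) := by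
  have z1 := subE_fix (w := w) (S.subE_Zc (fun x => c x * S.a k x) _)
  have z2 := subE_fix (w := w) (S.subE_Zc (fun x => c x * S.a k x * S.a k x) _)
  have h := gam_ibp k (fun y => S.Zc (fun x => c x * S.a k x) w y * G y)
    (fun y => w k * S.Zc (fun x => c x * S.a k x * S.a k x) w y * G y
      + S.Zc (fun x => c x * S.a k x) w y * G' y) (z1.mul hg)
    ((((SubE.const (w k)).mul z2).mul hg).add (z1.mul hg')) (by fun_prop) (by fun_prop) (fun y => by
      refine ((S.Zc_hasDerivAt_y _ w y k).mul (hd y)).congr_deriv ?_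
      simp)
  have i1 : Integrable (fun y => w k * S.Zc (fun x => c x * S.a k x * S.a k x) w y * G y) (gam κ) :=
    (((SubE.const (w k)).mul z2).mul hg).integrable (a := ()) trivial (by fun_prop)
  have i2 : Integrable (fun y => S.Zc (fun x => c x * S.a k x) w y * G' y) (gam κ) :=
    (z1.mul hg').integrable (a := ()) trivial (by fun_prop)
  have i3 : Integrable (fun y => y k * (S.Zc (fun x => c x * S.a k x) w y * G y)) (gam κ) :=
    ((SubE.coord k).mul (z1.mul hg)).integrable (a := ()) trivial (by fun_prop)
  rw [integral_add i1 i2] at h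
  have : ∀ y, S.D c k w y * G y = y k * (S.Zc (fun x => c x * S.a k x) w y * G y)
      - w k * S.Zc (fun x => c x * S.a k x * S.a k x) w y * G y := fun y => by unfold D; ring
  simp_rw [this]
  rw [integral_sub i3 i1, h]
  ring

lemma subE_D (c : X → ℝ) (k : κ) (B : ℝ) : SubE (box κ B) (S.D c k) := by
  have : SubE (box κ B) (fun w (_ : κ → ℝ) => w k) := SubE.of_bdd (C := B) fun w hw _ => hw k
  exact ((SubE.coord k).mul (S.subE_Zc _ _)).sub (this.mul (S.subE_Zc _ _))

@[fun_prop] lemma D_cont_y (c : X → ℝ) (k : κ) (w : κ → ℝ) : Continuous (S.D c k w) := by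
  unfold D; fun_prop

/-- a differentiable path of parameters on a neighbourhood `A` -/
structure Path (w w' : ℝ → κ → ℝ) (A : Set ℝ) (B : ℝ) : Prop where
  hd : ∀ s ∈ A, ∀ k, HasDerivAt (fun s => w s k) (w' s k) s
  hw : ∀ s ∈ A, w s ∈ box κ B
  hw' : ∀ s ∈ A, w' s ∈ box κ B

lemma Phi_hasDerivAt {w w' : ℝ → κ → ℝ} {A : Set ℝ} {B t : ℝ} (hP : Path w w' A B) (hA : A ∈ 𝓝 t) :
    HasDerivAt (fun s => S.Phi (w s)) (∑ k, w t k * w' t k * S.M (S.a k) (w t)) t := by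
  classical
  have sZ := (S.subE_Z B).comp w hP.hw
  have sL := (S.subE_log B).comp w hP.hw
  have sD := fun k => (S.subE_D (fun _ => 1) k B).comp w hP.hw
  have sw : ∀ k, SubE A (fun s (_ : κ → ℝ) => w' s k) := fun k =>
    SubE.of_bdd (C := B) fun s hs _ => hP.hw' s hs k
  have key := SubE.hasDerivAt (t := t) (f := fun s y => S.Z (w s) y * Real.log (S.Z (w s) y))
    (f' := fun s y => ∑ k, w' s k * (S.D (fun _ => 1) k (w s) y * (Real.log (S.Z (w s) y) + 1))) hA
    (sZ.mul sL) (SubE.sum _ fun k _ => (sw k).mul ((sD k).mul (sL.add (SubE.const 1))))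
    (fun _ _ => by fun_prop) (fun _ _ => by fun_prop) (fun s hs y => by
      have h1 := S.Zc_hasDerivAt (hP.hd s hs) (fun _ => 1) y
      have h2 := h1.mul (h1.log (S.Z_pos _ _).ne')
      refine h2.congr_deriv ?_
      have hZ := S.Z_pos (w s) y
      change _ * Real.log (S.Z (w s) y) + S.Z (w s) y * (_ / S.Z (w s) y) = _
      rw [mul_div_cancel₀ _ hZ.ne', ← mul_add_one, Finset.sum_mul]
      exact Finset.sum_congr rfl fun k _ => by ring)
  refine key.congr_deriv ?_
  have htA := mem_of_mem_nhds hA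
  rw [integral_finsetSum _ fun k _ => ((sw k).mul ((sD k).mul (sL.add (SubE.const 1)))).integrable
    htA (by fun_prop)]
  refine Finset.sum_congr rfl fun k _ => ?_
  rw [integral_const_mul, S.ibpZ (fun _ => 1) k (w t) (fun y => Real.log (S.Z (w t) y) + 1)
    (fun y => w t k * S.br (S.a k) (w t) y) ((subE_fix (S.subE_log _)).add (SubE.const 1))
    ((SubE.const _).mul (subE_fix (S.subE_br _ _))) (by fun_prop) (by fun_prop)
    (fun y => (S.log_hasDerivAt_y (w t) y k).add_const 1), M, mul_comm (w t k), mul_assoc]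
  congr 1
  rw [← integral_const_mul]
  congr 1
  ext y
  simp only [one_mul]
  change S.Zc (S.a k) _ _ * _ = _
  rw [S.Zc_eq]
  ring

lemma M_hasDerivAt (c : X → ℝ) {w w' : ℝ → κ → ℝ} {A : Set ℝ} {B t : ℝ} (hP : Path w w' A B)
    (hA : A ∈ 𝓝 t) :
    HasDerivAt (fun s => S.M c (w s)) (∑ k, 2 * (w t k * w' t k) * S.CV c (S.a k) (w t)) t := by
  classical
  have sZ := (S.subE_Z B).comp w hP.hw
  have sb := (S.subE_br c (box κ B)).comp w hP.hw
  have sD1 := fun k => (S.subE_D (fun _ => 1) k B).comp w hP.hw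
  have sDc := fun k => (S.subE_D c k B).comp w hP.hw
  have sw : ∀ k, SubE A (fun s (_ : κ → ℝ) => w' s k) := fun k =>
    SubE.of_bdd (C := B) fun s hs _ => hP.hw' s hs k
  have sE := fun k => ((sDc k).mul ((SubE.const 2).mul sb)).add ((sD1 k).mul (sb.pow_two).neg)
  have key := SubE.hasDerivAt (t := t) (f := fun s y => S.Z (w s) y * S.br c (w s) y ^ 2)
    (f' := fun s y => ∑ k, w' s k * (S.D c k (w s) y * (2 * S.br c (w s) y)
      + S.D (fun _ => 1) k (w s) y * (- S.br c (w s) y ^ 2))) hA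
    (sZ.mul sb.pow_two) (SubE.sum _ fun k _ => (sw k).mul (sE k))
    (fun _ _ => by fun_prop) (fun _ _ => by fun_prop) (fun s hs y => by
      have h1 := S.Zc_hasDerivAt (hP.hd s hs) (fun _ => 1) y
      have h2 := S.Zc_hasDerivAt (hP.hd s hs) c y
      have hZ := S.Z_pos (w s) y
      have h3 := h1.mul ((h2.fun_div h1 hZ.ne').fun_pow 2)
      refine h3.congr_deriv ?_
      have e1 : ∑ k, w' s k * (S.D c k (w s) y * (2 * S.br c (w s) y)
        + S.D (fun _ => 1) k (w s) y * (- S.br c (w s) y ^ 2))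
         = (∑ k, w' s k * S.D c k (w s) y) * (2 * S.br c (w s) y)
          + (∑ k, w' s k * S.D (fun _ => 1) k (w s) y) * (- S.br c (w s) y ^ 2) := by
        rw [Finset.sum_mul, Finset.sum_mul, ← Finset.sum_add_distrib]
        exact Finset.sum_congr rfl fun k _ => by ring
      rw [e1]
      change _ * (S.Zc c (w s) y / S.Z (w s) y) ^ 2 + S.Z (w s) y * (((2:ℕ):ℝ) * (S.Zc c (w s) y / S.Z (w s) y) ^ (2 - 1) *
        ((_ * S.Z (w s) y - S.Zc c (w s) y * _) / S.Z (w s) y ^ 2)) = _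
      unfold br
      push_cast
      field_simp
      ring)
  refine key.congr_deriv ?_
  have htA := mem_of_mem_nhds hA
  rw [integral_finsetSum _ fun k _ => ((sw k).mul (sE k)).integrable htA (by fun_prop)]
  refine Finset.sum_congr rfl fun k _ => ?_
  rw [integral_const_mul, integral_add
    (((sDc k).mul ((SubE.const 2).mul sb)).integrable htA (by fun_prop))
    (((sD1 k).mul (sb.pow_two).neg).integrable htA (by fun_prop)),
    S.ibpZ c k (w t) (fun y => 2 * S.br c (w t) y)
    (fun y => 2 * (w t k * S.cov c (S.a k) (w t) y)) ((SubE.const 2).mul (subE_fix (S.subE_br _ _)))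
    ((SubE.const _).mul ((SubE.const _).mul (subE_fix (S.subE_cov _ _ _)))) (by fun_prop) (by fun_prop)
    (fun y => (S.br_hasDerivAt_y c (w t) y k).const_mul 2),
    S.ibpZ (fun _ => 1) k (w t) (fun y => - S.br c (w t) y ^ 2)
    (fun y => -(2 * S.br c (w t) y * (w t k * S.cov c (S.a k) (w t) y))) ((subE_fix (S.subE_br _ _)).pow_two.neg)
    (((SubE.const 2).mul (subE_fix (S.subE_br _ _))).mul
      ((SubE.const _).mul (subE_fix (S.subE_cov _ _ _)))).neg (by fun_prop) (by fun_prop)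
    (fun y => by
      refine ((S.br_hasDerivAt_y c (w t) y k).fun_pow 2).neg.congr_deriv ?_
      simp), CV, ← integral_add]
  · rw [← integral_const_mul, ← integral_const_mul]
    congr 1
    ext y
    simp only [one_mul]
    change _ * (_ + S.Zc (S.a k) _ _ * _) = _
    rw [S.Zc_eq, S.Zc_eq, cov]
    ring
  · exact ((subE_fix (S.subE_Zc _ _)).mul ((SubE.const 2).mul
      ((SubE.const (w t k)).mul (subE_fix (S.subE_cov _ _ _))))).integrable (a := ()) trivial (by fun_prop)
  · exact ((subE_fix (S.subE_Zc _ _)).mul (((SubE.const 2).mul (subE_fix (S.subE_br _ _))).mul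
      ((SubE.const (w t k)).mul (subE_fix (S.subE_cov _ _ _)))).neg).integrable (a := ()) trivial (by fun_prop)

end Ch

end partc

section partd

/-- weighted Lipschitz functions on a finite product of real lines -/
def WLip {ι : Type*} [Fintype ι] (c : ι → ℝ) (F : (ι → ℝ) → ℝ) : Prop :=
  ∀ x y, |F x - F y| ≤ ∑ k, c k * |x k - y k|

lemma WLip.continuous {ι : Type*} [Fintype ι] {c : ι → ℝ} {F : (ι → ℝ) → ℝ} (h : WLip c F) :
    Continuous F := by
  rw [continuous_iff_continuousAt]
  intro x
  rw [ContinuousAt, tendsto_iff_dist_tendsto_zero]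
  have h1 : Tendsto (fun y : ι → ℝ => ∑ k, c k * |y k - x k|) (𝓝 x) (𝓝 0) := by
    have : Continuous (fun y : ι → ℝ => ∑ k, c k * |y k - x k|) := by fun_prop
    have h2 := this.tendsto x
    simpa using h2
  exact squeeze_zero (fun _ => dist_nonneg) (fun y => h y x) h1

lemma WLip.memLp {ι : Type*} [Fintype ι] {c : ι → ℝ} {F : (ι → ℝ) → ℝ} (h : WLip c F)
    (μ : ι → Measure ℝ) [∀ i, IsProbabilityMeasure (μ i)] (hμ : ∀ i, MemLp (fun x => x) 2 (μ i)) :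
    MemLp F 2 (Measure.pi μ) := by
  have h1 : MemLp (fun x : ι → ℝ => |F 0| + ∑ k, c k * |x k|) 2 (Measure.pi μ) := by
    have h2 : ∀ k, MemLp (fun x : ι → ℝ => |x k|) 2 (Measure.pi μ) := fun k => by
      have := ((hμ k).comp_measurePreserving (measurePreserving_eval μ k)).norm
      exact this
    have h3 : MemLp (fun x : ι → ℝ => ∑ k, c k * |x k|) 2 (Measure.pi μ) :=
      memLp_finsetSum _ fun k _ => (h2 k).const_mul (c k)
    have h4 : MemLp (fun _ : ι → ℝ => |F 0|) 2 (Measure.pi μ) := memLp_const _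
    have := h4.add h3
    exact this
  refine h1.mono h.continuous.aestronglyMeasurable (Eventually.of_forall fun x => ?_)
  rw [Real.norm_eq_abs, Real.norm_eq_abs]
  refine le_trans ?_ (le_abs_self _)
  have := h x 0
  simp only [Pi.zero_apply, sub_zero] at this
  have h3 : |F x| ≤ |F x - F 0| + |F 0| := by simpa using abs_add_le (F x - F 0) (F 0)
  linarith

lemma var_lip_one (μ : Measure ℝ) [IsProbabilityMeasure μ] (hμ : MemLp (fun x => x) 2 μ) {s : ℝ}
    (hs : ∫ x, x ^ 2 ∂μ ≤ s) {c : ℝ} (F : ℝ → ℝ) (hF : ∀ x y, |F x - F y| ≤ c * |x - y|)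
    (hm : Continuous F) :
    MemLp F 2 μ ∧ Var[F; μ] ≤ c ^ 2 * s := by
  have hb : ∀ x, |F x - F 0| ≤ |c * x| := fun x => by
    have := hF x 0
    rw [sub_zero] at this
    rw [abs_mul]
    exact this.trans (mul_le_mul_of_nonneg_right (le_abs_self c) (abs_nonneg _))
  have h0 : MemLp (fun x => F x - F 0) 2 μ :=
    (hμ.const_mul c).mono (by fun_prop) (Eventually.of_forall hb)
  refine ⟨by
    have h1 := h0.add (memLp_const (F 0))
    have h2 : ((fun x => F x - F 0) + fun x => F 0) = F := by ext; simp
    rwa [h2] at h1, ?_⟩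
  rw [← variance_sub_const hm.aestronglyMeasurable (F 0)]
  refine (variance_le_expectation_sq h0.aestronglyMeasurable).trans ?_
  have h1 : ∫ x, (F x - F 0) ^ 2 ∂μ ≤ ∫ x, c ^ 2 * x ^ 2 ∂μ := by
    refine integral_mono h0.integrable_sq (hμ.integrable_sq.const_mul _) fun x => ?_
    have := sq_le_sq.2 (hb x)
    simpa [mul_pow] using this
  rw [integral_const_mul] at h1
  exact h1.trans (mul_le_mul_of_nonneg_left hs (sq_nonneg _))

lemma efron_fin : ∀ (m : ℕ) (μ : Fin m → Measure ℝ) [∀ i, IsProbabilityMeasure (μ i)]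
    (hμ : ∀ i, MemLp (fun x => x) 2 (μ i)) (s : Fin m → ℝ) (hs : ∀ i, ∫ x, x ^ 2 ∂(μ i) ≤ s i)
    (c : Fin m → ℝ) (F : (Fin m → ℝ) → ℝ) (hF : WLip c F),
    Var[F; Measure.pi μ] ≤ ∑ k, c k ^ 2 * s k := by
  intro m
  induction m with
  | zero =>
    intro μ _ hμ s hs c F hF
    have : F = fun _ => F 0 := funext fun x => congrArg F (Subsingleton.elim _ _)
    rw [this]
    simp [variance_eq_integral aemeasurable_const]
  | succ m ih =>
    intro μ _ hμ s hs c F hF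
    have hmp := (measurePreserving_piFinSuccAbove μ 0).symm
    have hFL := hF.memLp μ hμ
    set G : ℝ × (Fin m → ℝ) → ℝ := fun q => F (Fin.cons q.1 q.2) with hG
    have hGF : F ∘ (MeasurableEquiv.piFinSuccAbove (fun _ => ℝ) 0).symm = G := by
      ext q
      simp [hG, MeasurableEquiv.piFinSuccAbove_symm_apply, Fin.insertNthEquiv]
    have hGlip : ∀ a a' b b', |G (a, b) - G (a', b')| ≤ c 0 * |a - a'| + ∑ k, c (Fin.succ k) * |b k - b' k| := by
      intro a a' b b'
      have := hF (Fin.cons a b) (Fin.cons a' b')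
      rw [Fin.sum_univ_succ] at this
      simpa [hG] using this
    have hG2 : MemLp G 2 ((μ 0).prod (Measure.pi fun j => μ (Fin.succ j))) := by
      rw [← hGF]; exact hFL.comp_measurePreserving hmp
    have hvar : Var[F; Measure.pi μ] = Var[G; (μ 0).prod (Measure.pi fun j => μ (Fin.succ j))] := by
      rw [← hGF]
      exact (hmp.variance_fun_comp hF.continuous.measurable.aemeasurable).symm
    set ν := Measure.pi fun j => μ (Fin.succ j) with hν
    have hin : ∀ a, WLip (fun k => c (Fin.succ k)) (fun b => G (a, b)) := fun a b b' => by
      simpa using hGlip a a b b'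
    have hinL : ∀ a, MemLp (fun b => G (a, b)) 2 ν := fun a => (hin a).memLp _ fun j => hμ j.succ
    have hinV : ∀ a, Var[fun b => G (a, b); ν] ≤ ∑ k, c (Fin.succ k) ^ 2 * s k.succ := fun a =>
      ih (fun j => μ j.succ) (fun j => hμ j.succ) (fun j => s j.succ) (fun j => hs j.succ) _ _ (hin a)
    set H : ℝ → ℝ := fun a => ∫ b, G (a, b) ∂ν with hH
    have hHlip : ∀ a a', |H a - H a'| ≤ c 0 * |a - a'| := by
      intro a a'
      rw [hH]
      simp only
      rw [← integral_sub ((hinL a).integrable (by norm_num)) ((hinL a').integrable (by norm_num)),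
        ← Real.norm_eq_abs]
      refine (norm_integral_le_of_norm_le_const (C := c 0 * |a - a'|) (Eventually.of_forall fun b => ?_)).trans ?_
      · simpa using hGlip a a' b b
      · simp
    have hHc : Continuous H := by
      have : LipschitzWith (Real.toNNReal (c 0)) H := LipschitzWith.of_dist_le_mul fun a a' => by
        rw [Real.dist_eq, Real.dist_eq]
        refine (hHlip a a').trans ?_
        gcongr
        exact Real.le_coe_toNNReal _
      exact this.continuous
    obtain ⟨hHL, hHV⟩ := var_lip_one (μ 0) (hμ 0) (hs 0) H hHlip hHc
    have hinV' : ∀ a, ∫ b, G (a, b) ^ 2 ∂ν ≤ H a ^ 2 + ∑ k, c (Fin.succ k) ^ 2 * s k.succ := fun a => by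
      have := hinV a
      rw [variance_eq_sub (hinL a)] at this
      simp only [Pi.pow_apply] at this
      linarith
    have hI := hG2.integrable_sq
    rw [hvar, variance_eq_sub hG2]
    rw [variance_eq_sub hHL] at hHV
    simp only [Pi.pow_apply] at hHV ⊢
    rw [integral_prod _ hI, integral_prod _ (hG2.integrable (by norm_num)), Fin.sum_univ_succ]
    have h5 : ∫ a, ∫ b, G (a, b) ^ 2 ∂ν ∂(μ 0) ≤ ∫ a, (H a ^ 2 + ∑ k, c (Fin.succ k) ^ 2 * s k.succ) ∂(μ 0) := by
      refine integral_mono hI.integral_prod_left (hHL.integrable_sq.add (integrable_const _)) hinV'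
    rw [integral_add hHL.integrable_sq (integrable_const _)] at h5
    simp only [integral_const, probReal_univ, smul_eq_mul, one_mul] at h5
    linarith

/-- Efron-Stein type inequality -/
lemma efron {ι : Type*} [Fintype ι] (μ : ι → Measure ℝ) [∀ i, IsProbabilityMeasure (μ i)]
    (hμ : ∀ i, MemLp (fun x => x) 2 (μ i)) (s : ι → ℝ) (hs : ∀ i, ∫ x, x ^ 2 ∂(μ i) ≤ s i)
    (c : ι → ℝ) (F : (ι → ℝ) → ℝ) (hF : WLip c F) :
    Var[F; Measure.pi μ] ≤ ∑ k, c k ^ 2 * s k := by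
  set e := (Fintype.equivFin ι).symm
  have hmp := measurePreserving_piCongrLeft (α := fun _ : ι => ℝ) μ e
  rw [← hmp.variance_fun_comp hF.continuous.measurable.aemeasurable]
  refine (efron_fin _ (fun i => μ (e i)) (fun i => hμ _) (fun i => s (e i)) (fun i => hs _) (fun i => c (e i)) _ ?_).trans
    (le_of_eq (Equiv.sum_comp e fun k => c k ^ 2 * s k))
  intro x y
  refine (hF _ _).trans (le_of_eq ?_)
  rw [← Equiv.sum_comp e]
  refine Finset.sum_congr rfl fun k _ => ?_
  have : ∀ x : Fin (Fintype.card ι) → ℝ, (MeasurableEquiv.piCongrLeft (fun _ : ι => ℝ) e) x (e k) = x k := fun x =>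
    Equiv.piCongrLeft_apply_apply (P := fun _ : ι => ℝ) e x k
  rw [this, this]

end partd

section parte
variable {κ : Type*} [Fintype κ]

/-- amplitudes from signal-to-noise ratios -/
def sqv {κ : Type*} (ρ : κ → ℝ) : κ → ℝ := fun k => Real.sqrt (ρ k)

lemma sqv_path (α β : κ → ℝ) (t : ℝ) (h : ∀ k, β k = 0 ∨ 0 < α k + t * β k) :
    ∃ (w' : ℝ → κ → ℝ) (A : Set ℝ) (B : ℝ), A ∈ 𝓝 t ∧
      Ch.Path (fun s => sqv (fun k => α k + s * β k)) w' A B ∧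
      ∀ k, sqv (fun k => α k + t * β k) k * w' t k = β k / 2 := by
  set w : ℝ → κ → ℝ := fun s => sqv (fun k => α k + s * β k) with hw
  set w' : ℝ → κ → ℝ := fun s k => β k / (2 * Real.sqrt (α k + s * β k)) with hw'
  set B : ℝ := ∑ k, (|w t k| + |w' t k| + 1) with hB
  have hBk : ∀ k, |w t k| + |w' t k| + 1 ≤ B := fun k =>
    Finset.single_le_sum (f := fun k => |w t k| + |w' t k| + 1) (fun _ _ => by positivity) (Finset.mem_univ k)
  have key : ∀ k, ∀ᶠ s in 𝓝 t, HasDerivAt (fun s => w s k) (w' s k) s ∧ |w s k| ≤ B ∧ |w' s k| ≤ B := by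
    intro k
    rcases h k with h0 | hpos
    · refine Eventually.of_forall fun s => ?_
      have e1 : ∀ s, w s k = w t k := fun s => by simp [hw, sqv, h0]
      have e2 : ∀ s, w' s k = 0 := fun s => by simp [hw', h0]
      simp_rw [e1, e2]
      refine ⟨hasDerivAt_const _ _, ?_, ?_⟩
      · linarith [hBk k, abs_nonneg (w' t k)]
      · rw [abs_zero]; linarith [hBk k, abs_nonneg (w' t k), abs_nonneg (w t k)]
    · have c1 : ContinuousAt (fun s => w s k) t := by
        simp only [hw, sqv]; fun_prop
      have c2 : ContinuousAt (fun s => w' s k) t := by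
        simp only [hw']
        refine ContinuousAt.div (by fun_prop) (by fun_prop) ?_
        have := Real.sqrt_pos.2 hpos
        positivity
      have c3 : ContinuousAt (fun s => α k + s * β k) t := by fun_prop
      filter_upwards [c3.eventually (lt_mem_nhds hpos), c1.abs.eventually (gt_mem_nhds (lt_add_one _)),
        c2.abs.eventually (gt_mem_nhds (lt_add_one _))] with s h1 h2 h3
      refine ⟨?_, ?_, ?_⟩
      · have := ((((hasDerivAt_id s).mul_const (β k)).const_add (α k))).sqrt (by simpa using h1.ne')
        simpa [hw, sqv, hw'] using this
      · linarith [hBk k, abs_nonneg (w' t k)]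
      · linarith [hBk k, abs_nonneg (w t k)]
  refine ⟨w', {s | ∀ k, HasDerivAt (fun s => w s k) (w' s k) s ∧ |w s k| ≤ B ∧ |w' s k| ≤ B}, B,
    eventually_all.2 key, ⟨fun s hs k => (hs k).1, fun s hs k => (hs k).2.1, fun s hs k => (hs k).2.2⟩, ?_⟩
  intro k
  simp only [sqv, hw']
  rcases h k with h0 | hpos
  · simp [h0]
  · have := Real.sqrt_pos.2 hpos
    field_simp

namespace Ch
variable {X : Type*}

lemma Phi_sq (S : Ch X κ) (α β : κ → ℝ) (t : ℝ) (h : ∀ k, β k = 0 ∨ 0 < α k + t * β k) :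
    HasDerivAt (fun s => S.Phi (sqv fun k => α k + s * β k))
      (1 / 2 * ∑ k, β k * S.M (S.a k) (sqv fun k => α k + t * β k)) t := by
  obtain ⟨w', A, B, hA, hP, h2⟩ := sqv_path α β t h
  refine (S.Phi_hasDerivAt hP hA).congr_deriv ?_
  simp_rw [h2, Finset.mul_sum]
  exact Finset.sum_congr rfl fun k _ => by ring

lemma M_sq (S : Ch X κ) (c : X → ℝ) (α β : κ → ℝ) (t : ℝ) (h : ∀ k, β k = 0 ∨ 0 < α k + t * β k) :
    HasDerivAt (fun s => S.M c (sqv fun k => α k + s * β k))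
      (∑ k, β k * S.CV c (S.a k) (sqv fun k => α k + t * β k)) t := by
  obtain ⟨w', A, B, hA, hP, h2⟩ := sqv_path α β t h
  refine (S.M_hasDerivAt c hP hA).congr_deriv ?_
  simp_rw [h2]
  exact Finset.sum_congr rfl fun k _ => by ring

/-- average absolute fluctuation of the log-partition function -/
def A1 (S : Ch X κ) (w : κ → ℝ) : ℝ := ∫ y, S.Z w y * |Real.log (S.Z w y) - S.Phi w| ∂(gam κ)

lemma integral_coord (k : κ) : ∫ y : κ → ℝ, y k ∂(gam κ) = 0 := by
  classical
  have := gam_ibp k (fun _ : κ → ℝ => (1:ℝ)) (fun _ => 0) (SubE.const 1) (SubE.const 0) continuous_const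
    continuous_const (fun y => hasDerivAt_const _ _)
  simpa using this

lemma Phi_ge (S : Ch X κ) (v : κ → ℝ) (m : κ → ℝ) (hm : ∀ k, m k = ∑ x ∈ S.T, S.p x * S.a k x) :
    1 / 2 * ∑ k, v k ^ 2 * m k ^ 2 ≤ S.Phi v := by
  have icoord : ∀ k, Integrable (fun y : κ → ℝ => y k) (gam κ) := fun k =>
    (SubE.coord (A := (Set.univ : Set Unit)) k).integrable (a := ()) trivial (by fun_prop)
  have h1 : ∀ k, ∫ y, S.Z v y * y k ∂(gam κ) = v k * m k := by
    intro k
    rw [← S.nishi1 v (fun y => y k) (SubE.coord k) (by fun_prop), hm, Finset.mul_sum]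
    refine Finset.sum_congr rfl fun x _ => ?_
    simp only [Pi.add_apply]
    rw [integral_add (icoord k) (integrable_const _), integral_coord]
    simp
    ring
  have h2 : ∫ y : κ → ℝ, Real.exp (∑ k, (v k * m k * y k - (v k * m k) ^ 2 / 2)) ∂(gam κ) = 1 := by
    have := gam_integral_shift (κ := κ) (fun k => v k * m k) (fun _ => 1)
    simpa using this.symm
  have i2 : Integrable (fun y : κ → ℝ => Real.exp (∑ k, (v k * m k * y k - (v k * m k) ^ 2 / 2))) (gam κ) := by
    by_contra hc
    rw [integral_undef hc] at h2
    norm_num at h2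
  have i3 : ∀ k, Integrable (fun y => S.Z v y * y k) (gam κ) := fun k =>
    S.int_Z_mul (SubE.coord k) (by fun_prop)
  have i4 : Integrable (fun y => S.Z v y * (∑ k, (v k * m k * y k - (v k * m k) ^ 2 / 2))) (gam κ) := by
    refine S.int_Z_mul (SubE.sum _ fun k _ => ((SubE.const _).mul (SubE.coord k)).sub (SubE.const _)) (by fun_prop)
  have h3 : ∫ y, S.Z v y * (∑ k, (v k * m k * y k - (v k * m k) ^ 2 / 2)) ∂(gam κ)
      = 1 / 2 * ∑ k, v k ^ 2 * m k ^ 2 := by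
    have : ∀ y, S.Z v y * (∑ k, (v k * m k * y k - (v k * m k) ^ 2 / 2))
        = ∑ k, (v k * m k * (S.Z v y * y k) - (v k * m k) ^ 2 / 2 * S.Z v y) := fun y => by
      rw [Finset.mul_sum]; exact Finset.sum_congr rfl fun k _ => by ring
    simp_rw [this]
    have i5 : ∀ k, Integrable (fun y => v k * m k * (S.Z v y * y k) - (v k * m k) ^ 2 / 2 * S.Z v y) (gam κ) :=
      fun k => ((i3 k).const_mul _).sub ((S.integrable_Z v).const_mul _)
    rw [integral_finsetSum _ fun k _ => i5 k, Finset.mul_sum]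
    refine Finset.sum_congr rfl fun k _ => ?_
    rw [integral_sub ((i3 k).const_mul _) ((S.integrable_Z v).const_mul _), integral_const_mul,
      integral_const_mul, h1, S.int_Z]
    ring
  have iL : Integrable (fun y => S.Z v y * Real.log (S.Z v y)) (gam κ) :=
    S.int_Z_mul (subE_fix (S.subE_log _)) (by fun_prop)
  have h4 : ∫ y, (S.Z v y * (∑ k, (v k * m k * y k - (v k * m k) ^ 2 / 2)) + S.Z v y
      - Real.exp (∑ k, (v k * m k * y k - (v k * m k) ^ 2 / 2))) ∂(gam κ) ≤ S.Phi v := by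
    refine integral_mono ((i4.add (S.integrable_Z v)).sub i2) iL fun y => ?_
    have hZ := S.Z_pos v y
    set l := ∑ k, (v k * m k * y k - (v k * m k) ^ 2 / 2) with hl
    have := Real.one_sub_inv_le_log_of_pos (x := S.Z v y / Real.exp l) (by positivity)
    rw [Real.log_div hZ.ne' (Real.exp_pos _).ne', Real.log_exp] at this
    have h5 := mul_le_mul_of_nonneg_left this hZ.le
    have h6 : S.Z v y * (1 - (S.Z v y / Real.exp l)⁻¹) = S.Z v y - Real.exp l := by
      field_simp
    simp only
    nlinarith
  have i6 : Integrable (fun y => S.Z v y * (∑ k, (v k * m k * y k - (v k * m k) ^ 2 / 2)) + S.Z v y) (gam κ) :=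
    i4.add (S.integrable_Z v)
  rw [integral_sub i6 i2, integral_add i4 (S.integrable_Z v), h3, h2, S.int_Z] at h4
  linarith

variable {ι : Type*} [Fintype ι]

/-- forget the right channels -/
def left (S : Ch X (κ ⊕ ι)) : Ch X κ where
  T := S.T
  p := S.p
  hp := S.hp
  hp1 := S.hp1
  a := fun k => S.a (Sum.inl k)
  K := S.K
  hK := fun k => S.hK _

/-- forget the left channels -/
def right (S : Ch X (κ ⊕ ι)) : Ch X ι where
  T := S.T
  p := S.p
  hp := S.hp
  hp1 := S.hp1
  a := fun k => S.a (Sum.inr k)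
  K := S.K
  hK := fun k => S.hK _

/-- change the weights -/
def tilt (S : Ch X (κ ⊕ ι)) (w y : κ → ℝ) : Ch X ι where
  T := S.T
  p := fun x => S.p x * S.left.W w x y / S.left.Z w y
  hp := fun x => div_nonneg (mul_nonneg (S.hp x) (S.left.W_pos w x y).le) (S.left.Z_pos w y).le
  hp1 := by
    have h := S.left.Z_pos w y
    rw [← Finset.sum_div, div_eq_one_iff_eq h.ne']
    change _ = ∑ x ∈ S.T, S.p x * 1 * S.left.W w x y
    simp
  a := fun k => S.a (Sum.inr k)
  K := S.K
  hK := fun k => S.hK _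

lemma gam_sum_mp : MeasurePreserving (MeasurableEquiv.sumPiEquivProdPi (fun _ : κ ⊕ ι => ℝ)).symm
    ((gam κ).prod (gam ι)) (gam (κ ⊕ ι)) :=
  measurePreserving_sumPiEquivProdPi_symm (fun _ : κ ⊕ ι => stdG)

lemma sumPi_symm (q : (κ → ℝ) × (ι → ℝ)) :
    (MeasurableEquiv.sumPiEquivProdPi (fun _ : κ ⊕ ι => ℝ)).symm q = Sum.elim q.1 q.2 := by
  funext k
  cases k <;> rfl

lemma gam_sum_integrable {F : (κ ⊕ ι → ℝ) → ℝ} (hF : Integrable F (gam (κ ⊕ ι))) :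
    Integrable (fun q : (κ → ℝ) × (ι → ℝ) => F (Sum.elim q.1 q.2)) ((gam κ).prod (gam ι)) := by
  have := (gam_sum_mp (κ := κ) (ι := ι)).integrable_comp_of_integrable hF
  simpa only [Function.comp_def, sumPi_symm] using this

lemma gam_sum_integral' (F : (κ ⊕ ι → ℝ) → ℝ) : ∫ y, F y ∂(gam (κ ⊕ ι))
      = ∫ q : (κ → ℝ) × (ι → ℝ), F (Sum.elim q.1 q.2) ∂((gam κ).prod (gam ι)) := by
  rw [← (gam_sum_mp (κ := κ) (ι := ι)).integral_comp']
  simp_rw [sumPi_symm]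

lemma gam_sum_integral {F : (κ ⊕ ι → ℝ) → ℝ} (hF : Integrable F (gam (κ ⊕ ι))) :
    ∫ y, F y ∂(gam (κ ⊕ ι)) = ∫ y₁, ∫ y₂, F (Sum.elim y₁ y₂) ∂(gam ι) ∂(gam κ) := by
  rw [gam_sum_integral', integral_prod _ (gam_sum_integrable hF)]

variable (S : Ch X (κ ⊕ ι))

lemma W_sum (w : κ → ℝ) (v : ι → ℝ) (x : X) (y₁ : κ → ℝ) (y₂ : ι → ℝ) :
    S.W (Sum.elim w v) x (Sum.elim y₁ y₂) = S.left.W w x y₁ * S.right.W v x y₂ := by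
  unfold W
  rw [← Real.exp_add, Fintype.sum_sum_type]
  rfl

lemma Zc_left (c : X → ℝ) (w y₁ : κ → ℝ) (y₂ : ι → ℝ) :
    S.Zc c (Sum.elim w fun _ => 0) (Sum.elim y₁ y₂) = S.left.Zc c w y₁ := by
  unfold Zc
  refine Finset.sum_congr rfl fun x _ => ?_
  rw [W_sum]
  have : S.right.W (fun _ => 0) x y₂ = 1 := by simp [W]
  rw [this, mul_one]; rfl

lemma Zc_right (c : X → ℝ) (v : ι → ℝ) (y₁ : κ → ℝ) (y₂ : ι → ℝ) :
    S.Zc c (Sum.elim (fun _ => 0) v) (Sum.elim y₁ y₂) = S.right.Zc c v y₂ := by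
  unfold Zc
  refine Finset.sum_congr rfl fun x _ => ?_
  rw [W_sum]
  have : S.left.W (fun _ => 0) x y₁ = 1 := by simp [W]
  rw [this, one_mul]; rfl

lemma Phi_left (w : κ → ℝ) : S.Phi (Sum.elim w fun _ => 0) = S.left.Phi w := by
  unfold Phi
  rw [gam_sum_integral']
  simp only [Z, Zc_left]
  rw [integral_fun_fst (f := fun y => S.left.Zc (fun _ => 1) w y * Real.log (S.left.Zc (fun _ => 1) w y))]
  simp

lemma Phi_right (v : ι → ℝ) : S.Phi (Sum.elim (fun _ => 0) v) = S.right.Phi v := by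
  unfold Phi
  rw [gam_sum_integral']
  simp only [Z, Zc_right]
  rw [integral_fun_snd (f := fun y => S.right.Zc (fun _ => 1) v y * Real.log (S.right.Zc (fun _ => 1) v y))]
  simp

lemma M_left (c : X → ℝ) (w : κ → ℝ) : S.M c (Sum.elim w fun _ => 0) = S.left.M c w := by
  unfold M
  rw [gam_sum_integral']
  simp only [br, Z, Zc_left]
  rw [integral_fun_fst (f := fun y => S.left.Zc (fun _ => 1) w y *
    (S.left.Zc c w y / S.left.Zc (fun _ => 1) w y) ^ 2)]
  simp

lemma Z_tilt (w y₁ : κ → ℝ) (v y₂ : ι → ℝ) :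
    (S.tilt w y₁).Z v y₂ = S.Z (Sum.elim w v) (Sum.elim y₁ y₂) / S.left.Z w y₁ := by
  unfold Z Zc
  rw [Finset.sum_div]
  refine Finset.sum_congr rfl fun x _ => ?_
  rw [W_sum]
  change S.p x * S.left.W w x y₁ / S.left.Z w y₁ * 1 * S.right.W v x y₂ = _
  change _ = _ / S.left.Z w y₁
  ring

lemma mean_tilt (w y₁ : κ → ℝ) (c : X → ℝ) :
    S.left.br c w y₁ = ∑ x ∈ (S.tilt w y₁).T, (S.tilt w y₁).p x * c x := by
  unfold br Zc
  rw [Finset.sum_div]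
  refine Finset.sum_congr rfl fun x _ => ?_
  change S.p x * c x * S.left.W w x y₁ / _ = S.p x * S.left.W w x y₁ / S.left.Z w y₁ * c x
  ring

/-- concentration of the overlap from concentration of the free energy -/
lemma conc (w : κ → ℝ) (v : ι → ℝ) (Q : (κ → ℝ) → ℝ)
    (hQ : Q = fun y => 1 / 2 * ∑ i, v i ^ 2 * S.left.br (S.a (Sum.inr i)) w y ^ 2) (q : ℝ)
    (hq : q = 1 / 2 * ∑ i, v i ^ 2 * S.left.M (S.a (Sum.inr i)) w) :
    ∫ y, S.left.Z w y * |Q y - q| ∂(gam κ)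
      ≤ 2 * (S.Phi (Sum.elim w v) - S.left.Phi w - q) + S.A1 (Sum.elim w v) + S.left.A1 w := by
  set f2 : (κ ⊕ ι → ℝ) → ℝ := fun y => Real.log (S.Z (Sum.elim w v) y) with hf2
  set f1 : (κ → ℝ) → ℝ := fun y => Real.log (S.left.Z w y) with hf1
  set P2 := S.Phi (Sum.elim w v) with hP2
  set P1 := S.left.Phi w with hP1
  have sf1 : SubE (Set.univ : Set Unit) fun _ => f1 := subE_fix (S.left.subE_log _)
  have sf2 : SubE (Set.univ : Set Unit) fun _ => f2 := subE_fix (S.subE_log _)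
  have cf1 : Continuous f1 := S.left.log_cont_y w
  have cf2 : Continuous f2 := S.log_cont_y _
  have sQ : SubE (Set.univ : Set Unit) fun _ => Q := by
    rw [hQ]
    exact (SubE.const _).mul (SubE.sum _ fun i _ => (SubE.const _).mul (subE_fix (S.left.subE_br _ _)).pow_two)
  have cQ : Continuous Q := by rw [hQ]; fun_prop
  have iQ := S.left.int_Z_mul (w := w) sQ cQ
  have if1 := S.left.int_Z_mul (w := w) sf1 cf1
  have if2 := S.int_Z_mul (w := Sum.elim w v) sf2 cf2
  have iZ1 := S.left.integrable_Z w
  have iZ2 := S.integrable_Z (Sum.elim w v)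
  have if2' := gam_sum_integrable if2
  have iA2 : Integrable (fun y => S.Z (Sum.elim w v) y * |f2 y - P2|) (gam (κ ⊕ ι)) :=
    S.int_Z_mul ((sf2.sub (SubE.const P2)).mono_abs fun _ _ y => by simp) (by fun_prop)
  have iA1 : Integrable (fun y => S.left.Z w y * |f1 y - P1|) (gam κ) :=
    S.left.int_Z_mul ((sf1.sub (SubE.const P1)).mono_abs fun _ _ y => by simp) (by fun_prop)
  have iAQ : Integrable (fun y => S.left.Z w y * |Q y - q|) (gam κ) :=
    S.left.int_Z_mul ((sQ.sub (SubE.const q)).mono_abs fun _ _ y => by simp) (by fun_prop)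
  -- fixed y₁
  have hZ2 : ∀ y₁ y₂, S.Z (Sum.elim w v) (Sum.elim y₁ y₂) = S.left.Z w y₁ * (S.tilt w y₁).Z v y₂ := by
    intro y₁ y₂
    rw [Z_tilt, mul_div_cancel₀ _ (S.left.Z_pos w y₁).ne']
  have hf2' : ∀ y₁ y₂, f2 (Sum.elim y₁ y₂) = f1 y₁ + Real.log ((S.tilt w y₁).Z v y₂) := by
    intro y₁ y₂
    simp only [hf2, hf1]
    rw [hZ2, Real.log_mul (S.left.Z_pos w y₁).ne' ((S.tilt w y₁).Z_pos v y₂).ne']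
  have hin : ∀ y₁, ∫ y₂, S.Z (Sum.elim w v) (Sum.elim y₁ y₂) * f2 (Sum.elim y₁ y₂) ∂(gam ι)
      = S.left.Z w y₁ * f1 y₁ + S.left.Z w y₁ * (S.tilt w y₁).Phi v := by
    intro y₁
    have e : ∀ y₂, S.Z (Sum.elim w v) (Sum.elim y₁ y₂) * f2 (Sum.elim y₁ y₂)
        = S.left.Z w y₁ * f1 y₁ * (S.tilt w y₁).Z v y₂
          + S.left.Z w y₁ * ((S.tilt w y₁).Z v y₂ * Real.log ((S.tilt w y₁).Z v y₂)) := by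
      intro y₂; rw [hZ2, hf2']; ring
    simp_rw [e]
    rw [integral_add (((S.tilt w y₁).integrable_Z v).const_mul _)
      (((S.tilt w y₁).int_Z_mul (subE_fix ((S.tilt w y₁).subE_log _)) (by fun_prop)).const_mul _),
      integral_const_mul, integral_const_mul, (S.tilt w y₁).int_Z]
    simp [Phi]
  have iG : Integrable (fun y => S.left.Z w y * (S.tilt w y).Phi v) (gam κ) := by
    have := if2'.integral_prod_left.sub if1
    refine this.congr (Eventually.of_forall fun y => ?_)
    simp only [Pi.sub_apply]
    rw [hin]; ring
  have hG : ∫ y, S.left.Z w y * (S.tilt w y).Phi v ∂(gam κ) = P2 - P1 := by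
    have h1 : P2 = ∫ y₁, ∫ y₂, S.Z (Sum.elim w v) (Sum.elim y₁ y₂) * f2 (Sum.elim y₁ y₂) ∂(gam ι) ∂(gam κ) := by
      rw [hP2, Phi, gam_sum_integral if2]
    simp_rw [hin] at h1
    rw [integral_add if1 iG] at h1
    have h2 : P1 = ∫ y, S.left.Z w y * f1 y ∂(gam κ) := rfl
    linarith
  have hGQ : ∀ y, Q y ≤ (S.tilt w y).Phi v := by
    intro y
    rw [hQ]
    exact (S.tilt w y).Phi_ge v (fun i => S.left.br (S.a (Sum.inr i)) w y) fun i => S.mean_tilt w y _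
  have hEQ : ∫ y, S.left.Z w y * Q y ∂(gam κ) = q := by
    have e : ∀ y, S.left.Z w y * Q y = ∑ i, 1 / 2 * v i ^ 2 * (S.left.Z w y * S.left.br (S.a (Sum.inr i)) w y ^ 2) := by
      intro y
      rw [hQ]
      simp only [Finset.mul_sum]
      exact Finset.sum_congr rfl fun i _ => by ring
    simp_rw [e]
    rw [integral_finsetSum _ fun i _ => (S.left.int_Z_mul (subE_fix (S.left.subE_br _ _)).pow_two (by fun_prop)).const_mul _, hq,
      Finset.mul_sum]
    refine Finset.sum_congr rfl fun i _ => ?_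
    rw [integral_const_mul, M]; ring
  -- fluctuation of the tilted free energy
  have hdev : ∀ y₁, S.left.Z w y₁ * |(S.tilt w y₁).Phi v - (P2 - P1)|
      ≤ (∫ y₂, S.Z (Sum.elim w v) (Sum.elim y₁ y₂) * |f2 (Sum.elim y₁ y₂) - P2| ∂(gam ι))
        + S.left.Z w y₁ * |f1 y₁ - P1| := by
    intro y₁
    have hZ := S.left.Z_pos w y₁
    have T := S.tilt w y₁
    have hj : Integrable (fun y₂ => (S.tilt w y₁).Z v y₂ * (Real.log ((S.tilt w y₁).Z v y₂) + (f1 y₁ - P2))) (gam ι) :=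
      (S.tilt w y₁).int_Z_mul ((subE_fix ((S.tilt w y₁).subE_log _)).add (SubE.const _)) (by fun_prop)
    have h1 : (S.tilt w y₁).Phi v + (f1 y₁ - P2)
        = ∫ y₂, (S.tilt w y₁).Z v y₂ * (Real.log ((S.tilt w y₁).Z v y₂) + (f1 y₁ - P2)) ∂(gam ι) := by
      simp_rw [mul_add]
      rw [integral_add ((S.tilt w y₁).int_Z_mul (subE_fix ((S.tilt w y₁).subE_log _)) (by fun_prop))
        (((S.tilt w y₁).integrable_Z v).mul_const _), integral_mul_const, (S.tilt w y₁).int_Z, one_mul]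
      rfl
    have h2 : S.left.Z w y₁ * |(S.tilt w y₁).Phi v + (f1 y₁ - P2)|
        ≤ ∫ y₂, S.Z (Sum.elim w v) (Sum.elim y₁ y₂) * |f2 (Sum.elim y₁ y₂) - P2| ∂(gam ι) := by
      rw [h1]
      have := mul_le_mul_of_nonneg_left (abs_integral_le_integral_abs (μ := gam ι)
        (f := fun y₂ => (S.tilt w y₁).Z v y₂ * (Real.log ((S.tilt w y₁).Z v y₂) + (f1 y₁ - P2)))) hZ.le
      refine this.trans (le_of_eq ?_)
      rw [← integral_const_mul]
      congr 1
      ext y₂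
      rw [abs_mul, abs_of_pos ((S.tilt w y₁).Z_pos v y₂), hZ2, hf2', mul_assoc]
      congr 3
      ring
    have h3 : |(S.tilt w y₁).Phi v - (P2 - P1)| ≤ |(S.tilt w y₁).Phi v + (f1 y₁ - P2)| + |f1 y₁ - P1| := by
      have := abs_sub ((S.tilt w y₁).Phi v + (f1 y₁ - P2)) (f1 y₁ - P1)
      have e : (S.tilt w y₁).Phi v + (f1 y₁ - P2) - (f1 y₁ - P1) = (S.tilt w y₁).Phi v - (P2 - P1) := by ring
      rw [e] at this
      exact this
    nlinarith
  have hpt : ∀ y, S.left.Z w y * |Q y - q| ≤ (S.left.Z w y * (S.tilt w y).Phi v - S.left.Z w y * Q y)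
      + ((∫ y₂, S.Z (Sum.elim w v) (Sum.elim y y₂) * |f2 (Sum.elim y y₂) - P2| ∂(gam ι))
        + S.left.Z w y * |f1 y - P1|) + S.left.Z w y * (P2 - P1 - q) := by
    intro y
    have hZ := S.left.Z_pos w y
    have hpos : 0 ≤ P2 - P1 - q := by
      have : ∫ y, S.left.Z w y * Q y ∂(gam κ) ≤ ∫ y, S.left.Z w y * (S.tilt w y).Phi v ∂(gam κ) :=
        integral_mono iQ iG fun y => mul_le_mul_of_nonneg_left (hGQ y) (S.left.Z_pos w y).le
      rw [hEQ, hG] at this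
      linarith
    have h1 : |Q y - q| ≤ ((S.tilt w y).Phi v - Q y) + |(S.tilt w y).Phi v - (P2 - P1)| + (P2 - P1 - q) := by
      have h2 := hGQ y
      rw [abs_le]
      constructor
      · linarith [neg_abs_le ((S.tilt w y).Phi v - (P2 - P1))]
      · linarith [le_abs_self ((S.tilt w y).Phi v - (P2 - P1))]
    have := mul_le_mul_of_nonneg_left h1 hZ.le
    have h4 := hdev y
    nlinarith
  have iA2' := (gam_sum_integrable iA2).integral_prod_left
  have hfin := integral_mono iAQ (((iG.sub iQ).add (iA2'.add iA1)).add (iZ1.mul_const _)) hpt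
  have e1 : S.A1 (Sum.elim w v) = ∫ y, ∫ y₂, S.Z (Sum.elim w v) (Sum.elim y y₂) * |f2 (Sum.elim y y₂) - P2| ∂(gam ι) ∂(gam κ) := by
    rw [A1, gam_sum_integral iA2]
  have e2 : S.left.A1 w = ∫ y, S.left.Z w y * |f1 y - P1| ∂(gam κ) := rfl
  refine hfin.trans (le_of_eq ?_)
  rw [integral_add' ((iG.sub iQ).add (iA2'.add iA1)) (iZ1.mul_const _),
    integral_add' (iG.sub iQ) (iA2'.add iA1), integral_sub' iG iQ, integral_add' iA2' iA1, integral_mul_const,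
    hG, hEQ, ← e1, ← e2, S.left.int_Z]
  ring

end Ch

end parte

section partf

lemma integral_fin {α : Type*} [MeasurableSpace α] [MeasurableSingletonClass α] (μ : Measure α)
    [IsFiniteMeasure μ] (T : Finset α) (hT : μ ((T : Set α)ᶜ) = 0) (g : α → ℝ) :
    ∫ x, g x ∂μ = ∑ x ∈ T, μ.real {x} * g x := by
  have h1 : μ.restrict (T : Set α) = μ := Measure.restrict_eq_self_of_ae_mem hT
  have h2 : IntegrableOn g (T : Set α) μ := by
    exact IntegrableOn.finset
  have := setIntegral_finset T h2
  rw [h1] at this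
  simpa using this

lemma pi_compl_zero {n : ℕ} (P : Measure ℝ) [IsProbabilityMeasure P] (S : Finset ℝ)
    (h : P ((S : Set ℝ)ᶜ) = 0) :
    (Measure.pi fun _ : Fin n => P) ((Fintype.piFinset fun _ : Fin n => S : Finset (Fin n → ℝ)) : Set (Fin n → ℝ))ᶜ = 0 := by
  have h1 : ∀ i : Fin n, ∀ᵐ x ∂(Measure.pi fun _ : Fin n => P), x i ∈ S := by
    intro i
    have h2 : ∀ᵐ x ∂P, x ∈ S := h
    exact (measurePreserving_eval (fun _ : Fin n => P) i).quasiMeasurePreserving.ae h2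
  have h2 := ae_all_iff.2 h1
  filter_upwards [h2] with x hx
  simpa using hx

lemma prior_compl_zero {n : ℕ} (PU PV : Measure ℝ) [IsProbabilityMeasure PU] [IsProbabilityMeasure PV]
    (S : Finset ℝ) (hU : PU ((S : Set ℝ)ᶜ) = 0) (hV : PV ((S : Set ℝ)ᶜ) = 0) :
    (prior PU PV n) ((((Fintype.piFinset fun _ : Fin n => S) ×ˢ (Fintype.piFinset fun _ : Fin n => S) :
      Finset ((Fin n → ℝ) × (Fin n → ℝ)))) : Set ((Fin n → ℝ) × (Fin n → ℝ)))ᶜ = 0 := by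
  have h1 : ∀ᵐ x ∂(prior PU PV n), x.1 ∈ (Fintype.piFinset fun _ : Fin n => S : Finset (Fin n → ℝ)) :=
    Measure.quasiMeasurePreserving_fst.ae (p := fun x => x ∈ (Fintype.piFinset fun _ : Fin n => S : Finset (Fin n → ℝ)))
      (pi_compl_zero PU S hU)
  have h2 : ∀ᵐ x ∂(prior PU PV n), x.2 ∈ (Fintype.piFinset fun _ : Fin n => S : Finset (Fin n → ℝ)) :=
    Measure.quasiMeasurePreserving_snd.ae (p := fun x => x ∈ (Fintype.piFinset fun _ : Fin n => S : Finset (Fin n → ℝ)))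
      (pi_compl_zero PV S hV)
  filter_upwards [h1, h2] with x hx1 hx2
  exact Finset.mem_coe.2 (Finset.mem_product.2 ⟨hx1, hx2⟩)

instance prior_prob (PU PV : Measure ℝ) [IsProbabilityMeasure PU] [IsProbabilityMeasure PV] (n : ℕ) :
    IsProbabilityMeasure (prior PU PV n) := by unfold prior; infer_instance

/-- standing data: finitely supported priors -/
structure Dat where
  PU : Measure ℝ
  PV : Measure ℝ
  iU : IsProbabilityMeasure PU
  iV : IsProbabilityMeasure PV
  S : Finset ℝ
  hU : PU ((S : Set ℝ)ᶜ) = 0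
  hV : PV ((S : Set ℝ)ᶜ) = 0
  K : ℝ
  hK1 : 1 ≤ K
  hK : ∀ x ∈ S, |x| ≤ K

attribute [instance] Dat.iU Dat.iV

/-- channel indices: the `u`, `v` side channels, the matrix channels -/
abbrev Ix (n : ℕ) := (Fin n ⊕ Fin n) ⊕ (Fin n × Fin n)
/-- indices with additional `u` channels -/
abbrev Ix2 (n : ℕ) := Ix n ⊕ Fin n
/-- signals -/
abbrev Sg (n : ℕ) := (Fin n → ℝ) × (Fin n → ℝ)

def amp (n : ℕ) : Ix2 n → Sg n → ℝ
  | Sum.inl (Sum.inl (Sum.inl i)) => fun x => x.1 i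
  | Sum.inl (Sum.inl (Sum.inr j)) => fun x => x.2 j
  | Sum.inl (Sum.inr (i, j)) => fun x => x.1 i * x.2 j
  | Sum.inr i => fun x => x.1 i

namespace Dat
variable (d : Dat)

lemma hK0 : 0 < d.K := lt_of_lt_of_le one_pos d.hK1

def Tn (n : ℕ) : Finset (Sg n) := (Fintype.piFinset fun _ : Fin n => d.S) ×ˢ (Fintype.piFinset fun _ : Fin n => d.S)

lemma mem_Tn {n : ℕ} {x : Sg n} : x ∈ d.Tn n ↔ (∀ i, x.1 i ∈ d.S) ∧ ∀ i, x.2 i ∈ d.S := by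
  simp [Tn]

lemma amp_le {n : ℕ} (k : Ix2 n) {x : Sg n} (h1 : ∀ i, |x.1 i| ≤ d.K) (h2 : ∀ i, |x.2 i| ≤ d.K) :
    |amp n k x| ≤ d.K ^ 2 := by
  have hK := d.hK1
  rcases k with ((i | j) | ⟨i, j⟩) | i
  · have := h1 i; simp only [amp]; nlinarith
  · have := h2 j; simp only [amp]; nlinarith
  · simp only [amp]
    rw [abs_mul, pow_two]
    exact mul_le_mul (h1 i) (h2 j) (abs_nonneg _) d.hK0.le
  · have := h1 i; simp only [amp]; nlinarith

lemma sum_prior {n : ℕ} (g : Sg n → ℝ) :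
    ∫ x, g x ∂(prior d.PU d.PV n) = ∑ x ∈ d.Tn n, (prior d.PU d.PV n).real {x} * g x :=
  integral_fin _ _ (prior_compl_zero d.PU d.PV d.S d.hU d.hV) g

/-- the interpolating model -/
def md2 (n : ℕ) : Ch (Sg n) (Ix2 n) where
  T := d.Tn n
  p := fun x => (prior d.PU d.PV n).real {x}
  hp := fun _ => measureReal_nonneg
  hp1 := by
    have := d.sum_prior (n := n) (fun _ => 1)
    simpa using this.symm
  a := amp n
  K := d.K ^ 2
  hK := fun k x hx => by
    rw [mem_Tn] at hx
    exact d.amp_le k (fun i => d.hK _ (hx.1 i)) (fun i => d.hK _ (hx.2 i))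

def md (n : ℕ) : Ch (Sg n) (Ix n) := (d.md2 n).left

end Dat

lemma Ch.logZ_lip {X κ : Type*} [Fintype κ] (S : Ch X κ) (w : κ → ℝ) (y y' : κ → ℝ) :
    |Real.log (S.Z w y) - Real.log (S.Z w y')| ≤ ∑ k, |w k| * S.K * |y k - y' k| := by
  have key : ∀ y y' : κ → ℝ, Real.log (S.Z w y) - Real.log (S.Z w y') ≤ ∑ k, |w k| * S.K * |y k - y' k| := by
    intro y y'
    set L := ∑ k, |w k| * S.K * |y k - y' k| with hL
    have h1 : S.Z w y ≤ S.Z w y' * Real.exp L := by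
      unfold Ch.Z Ch.Zc
      rw [Finset.sum_mul]
      refine Finset.sum_le_sum fun x hx => ?_
      rw [mul_assoc (S.p x * 1)]
      refine mul_le_mul_of_nonneg_left ?_ (by simpa using S.hp x)
      unfold Ch.W
      rw [← Real.exp_add, Real.exp_le_exp, hL, ← Finset.sum_add_distrib]
      refine Finset.sum_le_sum fun k _ => ?_
      have h2 : w k * S.a k x * (y k - y' k) ≤ |w k| * S.K * |y k - y' k| := by
        refine (le_abs_self _).trans ?_
        rw [abs_mul, abs_mul]
        have := S.hK k x hx
        gcongr
      linarith
    have := Real.log_le_log (S.Z_pos w y) h1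
    rw [Real.log_mul (S.Z_pos w y').ne' (Real.exp_pos _).ne', Real.log_exp] at this
    linarith
  rw [abs_le]
  constructor
  · have := key y' y
    simp_rw [abs_sub_comm (y' _) (y _)] at this
    linarith
  · exact key y y'

/-- clamp to `[-K, K]` -/
def clampR (K x : ℝ) : ℝ := max (-K) (min K x)

lemma clampR_abs {K : ℝ} (hK : 0 ≤ K) (x : ℝ) : |clampR K x| ≤ K := by
  unfold clampR
  rw [abs_le]
  exact ⟨le_max_left _ _, max_le (by linarith) (min_le_left _ _)⟩

lemma clampR_eq {K x : ℝ} (h : |x| ≤ K) : clampR K x = x := by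
  unfold clampR
  rw [abs_le] at h
  rw [min_eq_right h.2, max_eq_right h.1]

lemma clampR_lip (K x y : ℝ) : |clampR K x - clampR K y| ≤ |x - y| := by
  unfold clampR
  refine (abs_max_sub_max_le_max _ _ _ _).trans ?_
  simp only [sub_self, abs_zero]
  refine max_le (abs_nonneg _) ((abs_min_sub_min_le_max _ _ _ _).trans ?_)
  simp

lemma clampR_cont (K : ℝ) : Continuous (clampR K) := by unfold clampR; fun_prop

namespace Dat
variable (d : Dat)

/-- the family of laws of all the sources of randomness -/
def fam (n : ℕ) : Ix2 n ⊕ (Fin n ⊕ Fin n) → Measure ℝ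
  | Sum.inl _ => stdG
  | Sum.inr (Sum.inl _) => d.PU
  | Sum.inr (Sum.inr _) => d.PV

instance fam_prob (n : ℕ) (k : Ix2 n ⊕ (Fin n ⊕ Fin n)) : IsProbabilityMeasure (d.fam n k) := by
  rcases k with k | k | k <;> simp only [fam] <;> infer_instance

/-- assembling map -/
def asm (n : ℕ) (q : (Ix2 n → ℝ) × Sg n) : Ix2 n ⊕ (Fin n ⊕ Fin n) → ℝ :=
  Sum.elim q.1 (Sum.elim q.2.1 q.2.2)

lemma asm_mp (n : ℕ) : MeasurePreserving (asm n) ((gam (Ix2 n)).prod (prior d.PU d.PV n)) (Measure.pi (d.fam n)) := by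
  have h1 := measurePreserving_sumPiEquivProdPi_symm (d.fam n)
  have h2 := measurePreserving_sumPiEquivProdPi_symm (fun k => d.fam n (Sum.inr k))
  have h3 := h1.comp ((MeasurePreserving.id (gam (Ix2 n))).prod h2)
  convert! h3 using 1

lemma stdG_memLp : MemLp (fun x : ℝ => x) 2 stdG := by
  unfold stdG
  have := memLp_id_gaussianReal (μ := 0) (v := 1) 2
  exact this

lemma stdG_sq : ∫ x, x ^ 2 ∂stdG = 1 := by
  have h := variance_fun_id_gaussianReal (μ := 0) (v := 1)
  have h2 := variance_eq_sub (X := fun x : ℝ => x) (μ := gaussianReal 0 1) stdG_memLp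
  rw [h] at h2
  have h3 : ∫ x : ℝ, x ∂(gaussianReal 0 1) = 0 := by simp
  rw [h3] at h2
  simp only [Pi.pow_apply] at h2
  unfold stdG
  simpa using h2.symm

lemma fin_memLp {P : Measure ℝ} [IsProbabilityMeasure P] (S : Finset ℝ) {K : ℝ} (hK : ∀ x ∈ S, |x| ≤ K)
    (h : P ((S : Set ℝ)ᶜ) = 0) : MemLp (fun x : ℝ => x) 2 P ∧ ∫ x, x ^ 2 ∂P ≤ K ^ 2 := by
  have h1 : ∀ᵐ x ∂P, x ∈ S := h
  have h2 : MemLp (fun x : ℝ => x) 2 P := MemLp.of_bound (by fun_prop) K (by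
    filter_upwards [h1] with x hx using hK x hx)
  refine ⟨h2, ?_⟩
  have := integral_mono_ae (μ := P) h2.integrable_sq (integrable_const (K ^ 2)) (by
    filter_upwards [h1] with x hx
    exact sq_le_sq' (by linarith [(abs_le.1 (hK x hx)).1]) (abs_le.1 (hK x hx)).2)
  simpa using this

end Dat

end partf

section partg

namespace Dat
variable (d : Dat)

/-- bounds on the signal to noise ratios -/
structure Bd (n : ℕ) (B : ℝ) (ρ : Ix2 n → ℝ) : Prop where
  nn : ∀ k, 0 ≤ ρ k
  hu : ∀ i, ρ (Sum.inl (Sum.inl (Sum.inl i))) ≤ B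
  hv : ∀ i, ρ (Sum.inl (Sum.inl (Sum.inr i))) ≤ B
  hij : ∀ i, ρ (Sum.inl (Sum.inr i)) ≤ B / n
  he : ∀ i, ρ (Sum.inr i) ≤ B

/-- clamped signal -/
def cl (n : ℕ) (x : Sg n) : Sg n := (fun i => clampR d.K (x.1 i), fun i => clampR d.K (x.2 i))

/-- log-partition function as a function of all sources of randomness -/
def FF (n : ℕ) (w : Ix2 n → ℝ) (q : Ix2 n ⊕ (Fin n ⊕ Fin n) → ℝ) : ℝ :=
  Real.log ((d.md2 n).Z w ((fun k => q (Sum.inl k)) + fun k => w k * amp n k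
    (d.cl n (fun i => q (Sum.inr (Sum.inl i)), fun i => q (Sum.inr (Sum.inr i))))))

lemma amp_diff {n : ℕ} (hn : 0 < n) {B : ℝ} {ρ : Ix2 n → ℝ} (h : Bd n B ρ) (hB : 0 ≤ B) (x y : Sg n)
    (hx1 : ∀ i, |x.1 i| ≤ d.K) (hx2 : ∀ i, |x.2 i| ≤ d.K)
    (hy1 : ∀ i, |y.1 i| ≤ d.K) (hy2 : ∀ i, |y.2 i| ≤ d.K) :
    ∑ k, ρ k * |amp n k x - amp n k y| ≤ 3 * d.K * B * (∑ i, |x.1 i - y.1 i| + ∑ i, |x.2 i - y.2 i|) := by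
  have hK := d.hK1
  set D1 := ∑ i, |x.1 i - y.1 i| with hD1
  set D2 := ∑ i, |x.2 i - y.2 i| with hD2
  have p1 : 0 ≤ D1 := Finset.sum_nonneg fun _ _ => abs_nonneg _
  have p2 : 0 ≤ D2 := Finset.sum_nonneg fun _ _ => abs_nonneg _
  have e1 : ∑ i, ρ (Sum.inl (Sum.inl (Sum.inl i))) * |amp n (Sum.inl (Sum.inl (Sum.inl i))) x - amp n (Sum.inl (Sum.inl (Sum.inl i))) y| ≤ B * D1 := by
    rw [hD1, Finset.mul_sum]
    exact Finset.sum_le_sum fun i _ => mul_le_mul_of_nonneg_right (h.hu i) (abs_nonneg _)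
  have e2 : ∑ i, ρ (Sum.inl (Sum.inl (Sum.inr i))) * |amp n (Sum.inl (Sum.inl (Sum.inr i))) x - amp n (Sum.inl (Sum.inl (Sum.inr i))) y| ≤ B * D2 := by
    rw [hD2, Finset.mul_sum]
    exact Finset.sum_le_sum fun i _ => mul_le_mul_of_nonneg_right (h.hv i) (abs_nonneg _)
  have e4 : ∑ i, ρ (Sum.inr i) * |amp n (Sum.inr i) x - amp n (Sum.inr i) y| ≤ B * D1 := by
    rw [hD1, Finset.mul_sum]
    exact Finset.sum_le_sum fun i _ => mul_le_mul_of_nonneg_right (h.he i) (abs_nonneg _)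
  have e3 : ∑ i, ∑ j, ρ (Sum.inl (Sum.inr (i, j))) * |amp n (Sum.inl (Sum.inr (i, j))) x - amp n (Sum.inl (Sum.inr (i, j))) y|
      ≤ B * d.K * (D1 + D2) := by
    have : ∀ i j, ρ (Sum.inl (Sum.inr (i, j))) * |amp n (Sum.inl (Sum.inr (i, j))) x - amp n (Sum.inl (Sum.inr (i, j))) y|
        ≤ B / n * (d.K * (|x.1 i - y.1 i| + |x.2 j - y.2 j|)) := by
      intro i j
      refine mul_le_mul (h.hij _) ?_ (abs_nonneg _) (by positivity)
      simp only [amp]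
      have : x.1 i * x.2 j - y.1 i * y.2 j = (x.1 i - y.1 i) * x.2 j + y.1 i * (x.2 j - y.2 j) := by ring
      rw [this]
      refine (abs_add_le _ _).trans ?_
      rw [abs_mul, abs_mul]
      have a1 := mul_le_mul_of_nonneg_left (hx2 j) (abs_nonneg (x.1 i - y.1 i))
      have a2 := mul_le_mul_of_nonneg_right (hy1 i) (abs_nonneg (x.2 j - y.2 j))
      nlinarith
    refine (Finset.sum_le_sum fun i _ => Finset.sum_le_sum fun j _ => this i j).trans (le_of_eq ?_)
    simp only [← Finset.mul_sum, Finset.sum_add_distrib, Finset.sum_const, Finset.card_univ, Fintype.card_fin, nsmul_eq_mul]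
    rw [← hD1, ← hD2]
    have : (n : ℝ) ≠ 0 := by positivity
    field_simp
  rw [Fintype.sum_sum_type, Fintype.sum_sum_type, Fintype.sum_sum_type, Fintype.sum_prod_type]
  have q1 : B * D1 ≤ d.K * B * D1 := by nlinarith [mul_nonneg hB p1]
  have q2 : B * D2 ≤ d.K * B * D2 := by nlinarith [mul_nonneg hB p2]
  have q3 : 0 ≤ d.K * B * D2 := mul_nonneg (mul_nonneg d.hK0.le hB) p2
  nlinarith [e1, e2, e3, e4]

lemma FF_lip {n : ℕ} (hn : 0 < n) {B : ℝ} {ρ : Ix2 n → ℝ} (h : Bd n B ρ) (hB : 0 ≤ B) :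
    WLip (Sum.elim (fun k => Real.sqrt (ρ k) * d.K ^ 2) fun _ => 3 * d.K ^ 3 * B) (d.FF n (sqv ρ)) := by
  intro q q'
  unfold FF
  refine ((d.md2 n).logZ_lip _ _ _).trans ?_
  set x := d.cl n (fun i => q (Sum.inr (Sum.inl i)), fun i => q (Sum.inr (Sum.inr i))) with hx
  set y := d.cl n (fun i => q' (Sum.inr (Sum.inl i)), fun i => q' (Sum.inr (Sum.inr i))) with hy
  have h1 : ∀ k, |sqv ρ k| * (d.md2 n).K * |((fun k => q (Sum.inl k)) + fun k => sqv ρ k * amp n k x) k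
      - ((fun k => q' (Sum.inl k)) + fun k => sqv ρ k * amp n k y) k|
      ≤ Real.sqrt (ρ k) * d.K ^ 2 * |q (Sum.inl k) - q' (Sum.inl k)| + d.K ^ 2 * (ρ k * |amp n k x - amp n k y|) := by
    intro k
    have e : (d.md2 n).K = d.K ^ 2 := rfl
    have e2 : ((fun k => q (Sum.inl k)) + fun k => sqv ρ k * amp n k x) k
      - ((fun k => q' (Sum.inl k)) + fun k => sqv ρ k * amp n k y) k =
      (q (Sum.inl k) - q' (Sum.inl k)) + Real.sqrt (ρ k) * (amp n k x - amp n k y) := by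
      simp only [Pi.add_apply, sqv]; ring
    rw [e, e2]
    have e3 : |sqv ρ k| = Real.sqrt (ρ k) := abs_of_nonneg (Real.sqrt_nonneg _)
    rw [e3]
    have h3 := abs_add_le (q (Sum.inl k) - q' (Sum.inl k)) (Real.sqrt (ρ k) * (amp n k x - amp n k y))
    rw [abs_mul, abs_of_nonneg (Real.sqrt_nonneg _)] at h3
    have h4 := mul_le_mul_of_nonneg_left h3 (mul_nonneg (Real.sqrt_nonneg (ρ k)) (sq_nonneg d.K))
    refine h4.trans (le_of_eq ?_)
    have := Real.mul_self_sqrt (h.nn k)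
    linear_combination d.K ^ 2 * |amp n k x - amp n k y| * this
  refine (Finset.sum_le_sum fun k _ => h1 k).trans ?_
  rw [Finset.sum_add_distrib, ← Finset.mul_sum]
  have hc := fun z => clampR_abs d.hK0.le z
  have h2 := d.amp_diff hn h hB x y (fun i => hc _) (fun i => hc _) (fun i => hc _) (fun i => hc _)
  have h5 : ∑ i, |x.1 i - y.1 i| ≤ ∑ i, |q (Sum.inr (Sum.inl i)) - q' (Sum.inr (Sum.inl i))| :=
    Finset.sum_le_sum fun i _ => clampR_lip _ _ _
  have h6 : ∑ i, |x.2 i - y.2 i| ≤ ∑ i, |q (Sum.inr (Sum.inr i)) - q' (Sum.inr (Sum.inr i))| :=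
    Finset.sum_le_sum fun i _ => clampR_lip _ _ _
  rw [Fintype.sum_sum_type (M := ℝ) (α₂ := Fin n ⊕ Fin n)]
  simp only [Sum.elim_inl, Sum.elim_inr]
  rw [Fintype.sum_sum_type (α₁ := Fin n) (M := ℝ), ← Finset.mul_sum, ← Finset.mul_sum]
  have h7 := add_le_add h5 h6
  have h8 : 0 ≤ 3 * d.K * B := by have := d.hK0; positivity
  have h9 := mul_le_mul_of_nonneg_left (h2.trans (mul_le_mul_of_nonneg_left h7 h8)) (sq_nonneg d.K)
  nlinarith [h9]

lemma cl_eq {n : ℕ} {x : Sg n} (hx : x ∈ d.Tn n) : d.cl n x = x := by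
  rw [mem_Tn] at hx
  unfold cl
  ext i
  · exact clampR_eq (d.hK _ (hx.1 i))
  · exact clampR_eq (d.hK _ (hx.2 i))

lemma FF_asm {n : ℕ} (w : Ix2 n → ℝ) (g : ℝ → ℝ) (hg : Continuous g)
    (hs : SubE (Set.univ : Set Unit) fun _ y => g (Real.log ((d.md2 n).Z w y)))
    (hi : Integrable (fun q => g (d.FF n w (asm n q))) ((gam (Ix2 n)).prod (prior d.PU d.PV n))) :
    ∫ q, g (d.FF n w (asm n q)) ∂((gam (Ix2 n)).prod (prior d.PU d.PV n))
      = ∫ y, (d.md2 n).Z w y * g (Real.log ((d.md2 n).Z w y)) ∂(gam (Ix2 n)) := by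
  rw [integral_prod_symm _ hi, d.sum_prior]
  have h0 : Continuous fun y => g (Real.log ((d.md2 n).Z w y)) := by
    refine hg.comp ?_
    fun_prop
  rw [← (d.md2 n).nishi1 w _ hs h0]
  refine Finset.sum_congr rfl fun x hx => ?_
  congr 1
  refine integral_congr_ae (Eventually.of_forall fun z => ?_)
  simp only [FF, asm, Sum.elim_inl, Sum.elim_inr, Prod.mk.eta]
  rw [d.cl_eq hx]
  rfl

lemma fam_memLp (n : ℕ) (k) : MemLp (fun x : ℝ => x) 2 (d.fam n k) := by
  rcases k with k | k | k
  · exact stdG_memLp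
  · exact (fin_memLp d.S d.hK d.hU).1
  · exact (fin_memLp d.S d.hK d.hV).1

lemma var_bd {n : ℕ} (hn : 0 < n) {B : ℝ} {ρ : Ix2 n → ℝ} (h : Bd n B ρ) (hB : 0 ≤ B) :
    Var[d.FF n (sqv ρ); Measure.pi (d.fam n)] ≤ (4 * B * d.K ^ 4 + 18 * d.K ^ 8 * B ^ 2) * n := by
  refine (efron (d.fam n) (d.fam_memLp n) (Sum.elim (fun _ => 1) fun _ => d.K ^ 2) ?_ _ _ (d.FF_lip hn h hB)).trans ?_
  · intro k
    rcases k with k | k | k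
    · exact stdG_sq.le
    · exact (fin_memLp d.S d.hK d.hU).2
    · exact (fin_memLp d.S d.hK d.hV).2
  · rw [Fintype.sum_sum_type]
    simp only [Sum.elim_inl, Sum.elim_inr, mul_one]
    have h1 : ∑ k, (Real.sqrt (ρ k) * d.K ^ 2) ^ 2 = d.K ^ 4 * ∑ k, ρ k := by
      rw [Finset.mul_sum]
      refine Finset.sum_congr rfl fun k _ => ?_
      rw [mul_pow, Real.sq_sqrt (h.nn k)]; ring
    have h2 : ∑ k, ρ k ≤ 4 * B * n := by
      rw [Fintype.sum_sum_type, Fintype.sum_sum_type, Fintype.sum_sum_type]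
      have a1 := Finset.sum_le_sum fun i (_ : i ∈ Finset.univ) => h.hu i
      have a2 := Finset.sum_le_sum fun i (_ : i ∈ Finset.univ) => h.hv i
      have a3 := Finset.sum_le_sum fun i (_ : i ∈ Finset.univ) => h.hij i
      have a4 := Finset.sum_le_sum fun i (_ : i ∈ Finset.univ) => h.he i
      simp only [Finset.sum_const, Finset.card_univ, Fintype.card_prod, Fintype.card_fin, nsmul_eq_mul] at a1 a2 a3 a4
      have : ((n * n : ℕ) : ℝ) * (B / n) = n * B := by
        have : (n : ℝ) ≠ 0 := by positivity
        push_cast; field_simp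
      rw [this] at a3
      linarith
    rw [h1]
    simp only [Finset.sum_const, Finset.card_univ, Fintype.card_sum, Fintype.card_fin, nsmul_eq_mul]
    push_cast
    have := mul_le_mul_of_nonneg_left h2 (by positivity : 0 ≤ d.K ^ 4)
    nlinarith [this]

lemma A2_bd {n : ℕ} (hn : 0 < n) {B : ℝ} {ρ : Ix2 n → ℝ} (h : Bd n B ρ) (hB : 0 ≤ B) :
    ∫ y, (d.md2 n).Z (sqv ρ) y * (Real.log ((d.md2 n).Z (sqv ρ) y) - (d.md2 n).Phi (sqv ρ)) ^ 2 ∂(gam (Ix2 n))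
      ≤ (4 * B * d.K ^ 4 + 18 * d.K ^ 8 * B ^ 2) * n := by
  have hF := (d.FF_lip hn h hB)
  have hm : MemLp (d.FF n (sqv ρ)) 2 (Measure.pi (d.fam n)) := hF.memLp _ (d.fam_memLp n)
  have hm2 : MemLp (fun q => d.FF n (sqv ρ) (asm n q)) 2 ((gam (Ix2 n)).prod (prior d.PU d.PV n)) :=
    hm.comp_measurePreserving (d.asm_mp n)
  have hv := (d.asm_mp n).variance_fun_comp hF.continuous.measurable.aemeasurable
  have hs : SubE (Set.univ : Set Unit) fun _ y => Real.log ((d.md2 n).Z (sqv ρ) y) :=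
    Ch.subE_fix ((d.md2 n).subE_log _)
  have e1 : ∫ q, d.FF n (sqv ρ) (asm n q) ∂((gam (Ix2 n)).prod (prior d.PU d.PV n)) = (d.md2 n).Phi (sqv ρ) :=
    d.FF_asm (sqv ρ) (fun x => x) continuous_id hs (hm2.integrable (by norm_num))
  have e2 := d.FF_asm (sqv ρ) (fun x => (x - (d.md2 n).Phi (sqv ρ)) ^ 2) (by fun_prop)
    (by
      have := (hs.sub (SubE.const ((d.md2 n).Phi (sqv ρ)))).pow_two
      exact this) (by
      exact (hm2.sub (memLp_const _)).integrable_sq)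
  rw [← e2]
  rw [variance_eq_integral hm2.1.aemeasurable, e1] at hv
  have := d.var_bd hn h hB
  rw [← hv] at this
  exact this

lemma A1_bd {n : ℕ} (hn : 0 < n) {B : ℝ} {ρ : Ix2 n → ℝ} (h : Bd n B ρ) (hB : 0 ≤ B) {θ : ℝ} (hθ : 0 < θ)
    (hC : (4 * B * d.K ^ 4 + 18 * d.K ^ 8 * B ^ 2) * n ≤ θ ^ 2) :
    (d.md2 n).A1 (sqv ρ) ≤ θ := by
  have h2 := (d.A2_bd hn h hB).trans hC
  set S := d.md2 n
  set w := sqv ρ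
  have hs : SubE (Set.univ : Set Unit) fun _ y => Real.log (S.Z w y) - S.Phi w :=
    (Ch.subE_fix (S.subE_log _)).sub (SubE.const _)
  have i1 : Integrable (fun y => S.Z w y * (Real.log (S.Z w y) - S.Phi w) ^ 2) (gam (Ix2 n)) :=
    S.int_Z_mul hs.pow_two (by fun_prop)
  have i2 := S.integrable_Z w
  have h3 : S.A1 w ≤ ∫ y, (θ / 2 * S.Z w y + 1 / (2 * θ) * (S.Z w y * (Real.log (S.Z w y) - S.Phi w) ^ 2)) ∂(gam (Ix2 n)) := by
    refine integral_mono_of_nonneg (Eventually.of_forall fun y => ?_) ((i2.const_mul _).add (i1.const_mul _))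
      (Eventually.of_forall fun y => ?_)
    · exact mul_nonneg (S.Z_pos w y).le (abs_nonneg _)
    · have hZ := S.Z_pos w y
      simp only
      set g := Real.log (S.Z w y) - S.Phi w
      have : |g| ≤ θ / 2 + 1 / (2 * θ) * g ^ 2 := by
        rw [← sq_abs g]
        have : 0 ≤ (|g| - θ) ^ 2 / (2 * θ) := by positivity
        have e : (|g| - θ) ^ 2 / (2 * θ) = θ / 2 + 1 / (2 * θ) * |g| ^ 2 - |g| := by field_simp; ring
        linarith
      nlinarith [mul_le_mul_of_nonneg_left this hZ.le]
  rw [integral_add (i2.const_mul _) (i1.const_mul _), integral_const_mul, integral_const_mul, S.int_Z] at h3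
  have h4 : 1 / (2 * θ) * ∫ y, S.Z w y * (Real.log (S.Z w y) - S.Phi w) ^ 2 ∂(gam (Ix2 n)) ≤ 1 / (2 * θ) * θ ^ 2 :=
    mul_le_mul_of_nonneg_left h2 (by positivity)
  have h5 : 1 / (2 * θ) * θ ^ 2 = θ / 2 := by field_simp
  linarith

end Dat

lemma Ch.A1_left {X κ ι : Type*} [Fintype κ] [Fintype ι] (S : Ch X (κ ⊕ ι)) (w : κ → ℝ) :
    S.A1 (Sum.elim w fun _ => 0) = S.left.A1 w := by
  unfold Ch.A1
  rw [S.Phi_left, Ch.gam_sum_integral']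
  simp only [Ch.Z, Ch.Zc_left]
  rw [integral_fun_fst (f := fun y => S.left.Zc (fun _ => 1) w y * |Real.log (S.left.Zc (fun _ => 1) w y) - S.left.Phi w|)]
  simp

lemma sqv_elim {κ ι : Type*} (a : κ → ℝ) (b : ι → ℝ) : sqv (Sum.elim a b) = Sum.elim (sqv a) (sqv b) := by
  funext k; rcases k with k | k <;> rfl

lemma sqv_cont {κ : Type*} [Fintype κ] {T : Type*} [TopologicalSpace T] {f : T → κ → ℝ} (hf : Continuous f) :
    Continuous fun t => sqv (f t) := by
  unfold sqv
  fun_prop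

/-- signal to noise profile along the interpolation -/
def rho (lam g : ℝ) (n : ℕ) (t r : ℝ) : Ix n → ℝ
  | Sum.inl (Sum.inl _) => r
  | Sum.inl (Sum.inr _) => (1 - t) * g
  | Sum.inr _ => t * lam / n

lemma rho_cont (lam g : ℝ) (n : ℕ) : Continuous fun q : ℝ × ℝ => rho lam g n q.1 q.2 := by
  refine continuous_pi fun k => ?_
  rcases k with (k | k) | k <;> simp only [rho] <;> fun_prop

lemma rho2_cont (lam g : ℝ) (n : ℕ) (t : ℝ) :
    Continuous fun q : ℝ × ℝ => (Sum.elim (rho lam g n t q.1) (fun _ => q.2) : Ix2 n → ℝ) := by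
  refine continuous_pi fun k => ?_
  rcases k with ((k | k) | k) | k <;> simp only [rho, Sum.elim_inl, Sum.elim_inr] <;> fun_prop

namespace Dat
variable (d : Dat)

lemma merge (lam g : ℝ) (n : ℕ) (t r δ : ℝ) (hr : 0 ≤ r) (hδ : 0 < δ) :
    (d.md2 n).Phi (sqv (Sum.elim (rho lam g n t r) fun _ => δ)) = (d.md n).Phi (sqv (rho lam g n t (r + δ))) := by
  set α : Ix2 n → ℝ := Sum.elim (rho lam g n t (r + δ)) fun _ => 0 with hα
  set β : Ix2 n → ℝ := Sum.elim (Sum.elim (Sum.elim (fun _ => -1) fun _ => 0) fun _ => 0) fun _ => 1 with hβ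
  have hαβ : ∀ s, (fun k => α k + s * β k) = Sum.elim (rho lam g n t (r + δ - s)) fun _ => s := by
    intro s
    funext k
    rcases k with ((k | k) | k) | k <;> simp [hα, hβ, rho, sub_eq_add_neg]
  have hc : Continuous fun s => (d.md2 n).Phi (sqv fun k => α k + s * β k) := by
    refine (d.md2 n).Phi_cont.comp (sqv_cont ?_)
    fun_prop
  obtain ⟨s, hs, he⟩ := exists_hasDerivAt_eq_slope (fun s => (d.md2 n).Phi (sqv fun k => α k + s * β k))
    (fun _ => 0) hδ hc.continuousOn (fun s hs => by
      have := (d.md2 n).Phi_sq α β s (by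
        intro k
        have h1 := congrFun (hαβ s) k
        rw [h1]
        rcases k with ((k | k) | k) | k
        · right; simp only [rho, Sum.elim_inl]; linarith [hs.2]
        · left; rfl
        · left; rfl
        · right; exact hs.1)
      convert this using 1
      rw [Fintype.sum_sum_type, Fintype.sum_sum_type, Fintype.sum_sum_type]
      simp only [hβ, Sum.elim_inl, Sum.elim_inr, zero_mul, Finset.sum_const_zero, add_zero, neg_mul, one_mul, Finset.sum_neg_distrib]
      have : ∀ i : Fin n, (d.md2 n).a (Sum.inr i) = (d.md2 n).a (Sum.inl (Sum.inl (Sum.inl i))) := fun i => rfl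
      simp only [this]
      ring)
  simp only [hαβ] at he
  have hδ' : δ - 0 ≠ 0 := by simpa using hδ.ne'
  have h2 : (d.md2 n).Phi (sqv (Sum.elim (rho lam g n t (r + δ - δ)) fun _ => δ))
    = (d.md2 n).Phi (sqv (Sum.elim (rho lam g n t (r + δ - 0)) fun _ => 0)) := by
    field_simp at he
    linarith
  rw [add_sub_cancel_right, sub_zero] at h2
  rw [h2, sqv_elim]
  have : (sqv fun _ : Fin n => (0 : ℝ)) = fun _ => 0 := by funext k; simp [sqv]
  rw [this, Ch.Phi_left]
  rfl

end Dat

end partg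

section parth

lemma Ch.CV_cont {X κ : Type*} [Fintype κ] (S : Ch X κ) (c e : X → ℝ) : Continuous (S.CV c e) := by
  rw [continuous_iff_continuousAt]
  intro w
  refine SubE.continuousAt (f := fun w y => S.Z w y * S.cov c e w y ^ 2) (Ch.box_nhds w)
    ((S.subE_Z _).mul (S.subE_cov _ _ _).pow_two) (fun _ _ => by fun_prop) fun y => ?_
  exact ((S.Z_cont_w y).mul ((S.cov_cont_w c e y).pow 2)).continuousAt

namespace Dat
variable (d : Dat) (lam g : ℝ) (n : ℕ)

def cu (n : ℕ) (i : Fin n) : Sg n → ℝ := fun x => x.1 i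
def cv (n : ℕ) (i : Fin n) : Sg n → ℝ := fun x => x.2 i
def cuv (n : ℕ) (i j : Fin n) : Sg n → ℝ := fun x => x.1 i * x.2 j

/-- amplitudes along the interpolation -/
def ww (t r : ℝ) : Ix n → ℝ := sqv (rho lam g n t r)

def phi (t r : ℝ) : ℝ := 1 / n * (d.md n).Phi (ww lam g n t r)
def Qu (t r : ℝ) : ℝ := 1 / n * ∑ i, (d.md n).M (cu n i) (ww lam g n t r)
def Qv (t r : ℝ) : ℝ := 1 / n * ∑ i, (d.md n).M (cv n i) (ww lam g n t r)
def Quv (t r : ℝ) : ℝ := 1 / (n : ℝ) ^ 2 * ∑ i, ∑ j, (d.md n).M (cuv n i j) (ww lam g n t r)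
def Rr (t r : ℝ) : ℝ := 1 / (n : ℝ) ^ 2 * ∑ i, ∑ j, (d.md n).CV (cv n j) (cu n i) (ww lam g n t r)

lemma ww_cont : Continuous fun q : ℝ × ℝ => ww lam g n q.1 q.2 := sqv_cont (rho_cont lam g n)

lemma ww_cont_r (t : ℝ) : Continuous fun r => ww lam g n t r :=
  (ww_cont lam g n).comp (Continuous.prodMk continuous_const continuous_id)

lemma phi_cont : Continuous fun q : ℝ × ℝ => d.phi lam g n q.1 q.2 :=
  ((d.md n).Phi_cont.comp (ww_cont lam g n)).const_mul _

lemma phi_cont_r (t : ℝ) : Continuous fun r => d.phi lam g n t r :=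
  ((d.md n).Phi_cont.comp (ww_cont_r lam g n t)).const_mul _

lemma Qu_cont (t : ℝ) : Continuous (d.Qu lam g n t) :=
  (continuous_finsetSum _ fun i _ => ((d.md n).M_cont _).comp (ww_cont_r lam g n t)).const_mul _

lemma Qv_cont (t : ℝ) : Continuous (d.Qv lam g n t) :=
  (continuous_finsetSum _ fun i _ => ((d.md n).M_cont _).comp (ww_cont_r lam g n t)).const_mul _

lemma Quv_cont (t : ℝ) : Continuous (d.Quv lam g n t) :=
  (continuous_finsetSum _ fun i _ => continuous_finsetSum _ fun j _ =>
    ((d.md n).M_cont _).comp (ww_cont_r lam g n t)).const_mul _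

lemma Rr_cont (t : ℝ) : Continuous (d.Rr lam g n t) :=
  (continuous_finsetSum _ fun i _ => continuous_finsetSum _ fun j _ =>
    ((d.md n).CV_cont _ _).comp (ww_cont_r lam g n t)).const_mul _

lemma phi_nonneg (t r : ℝ) : 0 ≤ d.phi lam g n t r :=
  mul_nonneg (by positivity) ((d.md n).Phi_nonneg _)

lemma Rr_nonneg (t r : ℝ) : 0 ≤ d.Rr lam g n t r :=
  mul_nonneg (by positivity) (Finset.sum_nonneg fun _ _ => Finset.sum_nonneg fun _ _ => (d.md n).CV_nonneg _ _ _)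

lemma cu_le (i : Fin n) : ∀ x ∈ (d.md n).T, |cu n i x| ≤ d.K := fun x hx => d.hK _ ((d.mem_Tn.1 hx).1 i)
lemma cv_le (i : Fin n) : ∀ x ∈ (d.md n).T, |cv n i x| ≤ d.K := fun x hx => d.hK _ ((d.mem_Tn.1 hx).2 i)
lemma cuv_le (i j : Fin n) : ∀ x ∈ (d.md n).T, |cuv n i j x| ≤ d.K ^ 2 := fun x hx => by
  unfold cuv
  rw [abs_mul, pow_two]
  exact mul_le_mul (d.cu_le n i x hx) (d.cv_le n j x hx) (abs_nonneg _) d.hK0.le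

variable {n}

lemma avg_le (hn : 0 < n) {f : Fin n → ℝ} {C : ℝ} (h : ∀ i, f i ≤ C) : 1 / (n : ℝ) * ∑ i, f i ≤ C := by
  have h1 := Finset.sum_le_sum fun i (_ : i ∈ Finset.univ) => h i
  simp only [Finset.sum_const, Finset.card_univ, Fintype.card_fin, nsmul_eq_mul] at h1
  have : (0 : ℝ) < n := by positivity
  rw [one_div, inv_mul_le_iff₀ this]
  exact h1

lemma avg2_eq (f : Fin n → Fin n → ℝ) : 1 / (n : ℝ) ^ 2 * ∑ i, ∑ j, f i j
    = 1 / (n : ℝ) * ∑ i, (1 / (n : ℝ) * ∑ j, f i j) := by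
  rw [← Finset.mul_sum]
  ring

lemma avg2_le (hn : 0 < n) {f : Fin n → Fin n → ℝ} {C : ℝ} (h : ∀ i j, f i j ≤ C) :
    1 / (n : ℝ) ^ 2 * ∑ i, ∑ j, f i j ≤ C := by
  rw [avg2_eq]
  exact avg_le hn fun i => avg_le hn fun j => h i j

lemma Qu_nonneg (t r : ℝ) : 0 ≤ d.Qu lam g n t r :=
  mul_nonneg (by positivity) (Finset.sum_nonneg fun _ _ => (d.md n).M_nonneg _ _)
lemma Qv_nonneg (t r : ℝ) : 0 ≤ d.Qv lam g n t r :=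
  mul_nonneg (by positivity) (Finset.sum_nonneg fun _ _ => (d.md n).M_nonneg _ _)
lemma Quv_nonneg (t r : ℝ) : 0 ≤ d.Quv lam g n t r :=
  mul_nonneg (by positivity) (Finset.sum_nonneg fun _ _ => Finset.sum_nonneg fun _ _ => (d.md n).M_nonneg _ _)
lemma Qu_le (hn : 0 < n) (t r : ℝ) : d.Qu lam g n t r ≤ d.K ^ 2 :=
  avg_le hn fun i => (d.md n).M_le (d.cu_le n i) _
lemma Qv_le (hn : 0 < n) (t r : ℝ) : d.Qv lam g n t r ≤ d.K ^ 2 :=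
  avg_le hn fun i => (d.md n).M_le (d.cv_le n i) _
lemma Quv_le (hn : 0 < n) (t r : ℝ) : d.Quv lam g n t r ≤ d.K ^ 4 :=
  avg2_le hn fun i j => ((d.md n).M_le (d.cuv_le n i j) _).trans (le_of_eq (by ring))

lemma phi_dt (hn : 0 < n) (hlam : 0 < lam) (hg : 0 ≤ g) {t : ℝ} (ht : t ∈ Set.Ioo (0 : ℝ) 1) (r : ℝ) :
    HasDerivAt (fun s => d.phi lam g n s r) (lam / 2 * d.Quv lam g n t r - g / 2 * d.Qv lam g n t r) t := by
  have hn' : (0 : ℝ) < n := by positivity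
  set α : Ix n → ℝ := Sum.elim (Sum.elim (fun _ => r) fun _ => g) fun _ => 0 with hα
  set β : Ix n → ℝ := Sum.elim (Sum.elim (fun _ => 0) fun _ => -g) fun _ => lam / n with hβ
  have hαβ : ∀ s, (fun k => α k + s * β k) = rho lam g n s r := by
    intro s
    funext k
    rcases k with (k | k) | k <;> simp [hα, hβ, rho] <;> ring
  have h := (d.md n).Phi_sq α β t (by
    intro k
    have h1 := congrFun (hαβ t) k
    rw [h1]
    rcases k with (k | k) | k
    · left; rfl
    · rcases hg.eq_or_lt with h0 | h0
      · left; simp [hβ, ← h0]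
      · right; exact mul_pos (by linarith [ht.2]) h0
    · right; have := ht.1; simp only [rho]; positivity)
  simp only [hαβ] at h
  have h2 := h.const_mul (1 / (n : ℝ))
  refine h2.congr_deriv ?_
  rw [Fintype.sum_sum_type, Fintype.sum_sum_type, Fintype.sum_prod_type]
  simp only [hβ, Sum.elim_inl, Sum.elim_inr, zero_mul, Finset.sum_const_zero, zero_add, ← Finset.mul_sum]
  have e1 : d.Qv lam g n t r = 1 / n * ∑ i, (d.md n).M ((d.md n).a (Sum.inl (Sum.inr i))) (sqv (rho lam g n t r)) := rfl
  have e2 : d.Quv lam g n t r = 1 / (n : ℝ) ^ 2 * ∑ i, ∑ j, (d.md n).M ((d.md n).a (Sum.inr (i, j))) (sqv (rho lam g n t r)) := rfl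
  rw [e1, e2]
  field_simp
  ring

lemma rpath (lam g : ℝ) (t : ℝ) :
    ∀ s, (fun k : Ix n => rho lam g n t 0 k + s * (Sum.elim (Sum.elim (fun _ => 1) fun _ => 0) (fun _ => 0) : Ix n → ℝ) k)
      = rho lam g n t s := by
  intro s
  funext k
  rcases k with (k | k) | k <;> simp [rho]

lemma rpath_ok (lam g : ℝ) (t : ℝ) {r : ℝ} (hr : 0 < r) (k : Ix n) :
    (Sum.elim (Sum.elim (fun _ => 1) fun _ => 0) (fun _ => 0) : Ix n → ℝ) k = 0 ∨
    0 < rho lam g n t 0 k + r * (Sum.elim (Sum.elim (fun _ => 1) fun _ => 0) (fun _ => 0) : Ix n → ℝ) k := by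
  rcases k with (k | k) | k
  · right; simpa [rho] using hr
  · left; rfl
  · left; rfl

lemma phi_dr (hn : 0 < n) (t : ℝ) {r : ℝ} (hr : 0 < r) :
    HasDerivAt (d.phi lam g n t) (d.Qu lam g n t r / 2) r := by
  have h := (d.md n).Phi_sq _ _ r (rpath_ok lam g t hr)
  simp only [rpath] at h
  refine (h.const_mul (1 / (n : ℝ))).congr_deriv ?_
  rw [Fintype.sum_sum_type, Fintype.sum_sum_type]
  simp only [Sum.elim_inl, Sum.elim_inr, zero_mul, Finset.sum_const_zero, add_zero, one_mul]
  have e1 : d.Qu lam g n t r = 1 / n * ∑ i, (d.md n).M ((d.md n).a (Sum.inl (Sum.inl i))) (sqv (rho lam g n t r)) := rfl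
  rw [e1]; ring

lemma M_dr (c : Sg n → ℝ) (t : ℝ) {r : ℝ} (hr : 0 < r) :
    HasDerivAt (fun s => (d.md n).M c (ww lam g n t s)) (∑ i, (d.md n).CV c (cu n i) (ww lam g n t r)) r := by
  have h := (d.md n).M_sq c _ _ r (rpath_ok lam g t hr)
  simp only [rpath] at h
  refine h.congr_deriv ?_
  rw [Fintype.sum_sum_type, Fintype.sum_sum_type]
  simp only [Sum.elim_inl, Sum.elim_inr, zero_mul, Finset.sum_const_zero, add_zero, one_mul]
  rfl

lemma Qv_dr (hn : 0 < n) (t : ℝ) {r : ℝ} (hr : 0 < r) :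
    HasDerivAt (d.Qv lam g n t) (n * d.Rr lam g n t r) r := by
  have h := (HasDerivAt.fun_sum fun j (_ : j ∈ Finset.univ) => d.M_dr lam g (cv n j) t hr).const_mul (1 / (n : ℝ))
  refine h.congr_deriv ?_
  unfold Rr
  rw [Finset.sum_comm]
  have hn' : (n : ℝ) ≠ 0 := by positivity
  field_simp

lemma Qu_mono (hn : 0 < n) (t : ℝ) : MonotoneOn (d.Qu lam g n t) (Set.Ici 0) := by
  refine monotoneOn_of_deriv_nonneg (convex_Ici 0) (d.Qu_cont lam g n t).continuousOn ?_ ?_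
  · intro r hr
    rw [interior_Ici] at hr
    exact ((HasDerivAt.fun_sum fun j (_ : j ∈ Finset.univ) => d.M_dr lam g (cu n j) t hr).const_mul
      (1 / (n : ℝ))).differentiableAt.differentiableWithinAt
  · intro r hr
    rw [interior_Ici] at hr
    have h := ((HasDerivAt.fun_sum fun j (_ : j ∈ Finset.univ) => d.M_dr lam g (cu n j) t hr).const_mul
      (1 / (n : ℝ)))
    have h2 : HasDerivAt (d.Qu lam g n t) _ r := h
    rw [h2.deriv]
    exact mul_nonneg (by positivity) (Finset.sum_nonneg fun _ _ => Finset.sum_nonneg fun _ _ => (d.md n).CV_nonneg _ _ _)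

/-- deviation of the overlap -/
def dev (d : Dat) (lam g : ℝ) (n : ℕ) (t r : ℝ) : ℝ :=
  ∫ y, (d.md n).Z (ww lam g n t r) y * |1 / (n : ℝ) * ∑ i, (d.md n).br (cu n i) (ww lam g n t r) y ^ 2 - d.Qu lam g n t r| ∂(gam (Ix n))

lemma phi_slope (hn : 0 < n) (t : ℝ) {r δ : ℝ} (hr : 0 ≤ r) (hδ : 0 < δ) :
    d.phi lam g n t (r + δ) - d.phi lam g n t r ≤ δ / 2 * d.Qu lam g n t (r + δ) := by
  obtain ⟨s, hs, he⟩ := exists_hasDerivAt_eq_slope (d.phi lam g n t) (fun s => d.Qu lam g n t s / 2)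
    (by linarith : r < r + δ) (d.phi_cont_r lam g n t).continuousOn
    (fun s hs => d.phi_dr lam g hn t (by linarith [hs.1]))
  have h1 : d.Qu lam g n t s ≤ d.Qu lam g n t (r + δ) :=
    d.Qu_mono lam g hn t (by simp only [Set.mem_Ici]; linarith [hs.1]) (by simp only [Set.mem_Ici]; linarith) hs.2.le
  rw [add_sub_cancel_left, eq_div_iff hδ.ne'] at he
  nlinarith

lemma dev_le (hn : 0 < n) {B t r δ θ : ℝ} (ht : t ∈ Set.Icc (0 : ℝ) 1) (hlam : 0 ≤ lam) (hlB : lam ≤ B)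
    (hg : 0 ≤ g) (hgB : g ≤ B) (hr : 0 ≤ r) (hrB : r ≤ B) (hδ : 0 < δ) (hδB : δ ≤ B) (hθ : 0 < θ)
    (hC : (4 * B * d.K ^ 4 + 18 * d.K ^ 8 * B ^ 2) * n ≤ θ ^ 2) :
    d.dev lam g n t r ≤ 2 * (d.Qu lam g n t (r + δ) - d.Qu lam g n t r) + 4 * θ / (n * δ) := by
  have hn' : (0 : ℝ) < n := by positivity
  have hB : 0 ≤ B := hr.trans hrB
  have hbd : ∀ e, 0 ≤ e → e ≤ B → Bd n B (Sum.elim (rho lam g n t r) fun _ => e) := by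
    intro e he0 heB
    have h1 : 0 ≤ (1 - t) := by linarith [ht.2]
    have h0 := ht.1
    refine ⟨fun k => ?_, fun i => hrB, fun i => ?_, fun i => ?_, fun i => heB⟩
    · rcases k with ((k | k) | k) | k <;> simp only [rho, Sum.elim_inl, Sum.elim_inr]
      · exact hr
      · exact mul_nonneg h1 hg
      · positivity
      · exact he0
    · simp only [rho, Sum.elim_inl]; nlinarith
    · simp only [rho, Sum.elim_inl, Sum.elim_inr]
      gcongr
      nlinarith [ht.2]
  have a1 := d.A1_bd hn (hbd δ hδ.le hδB) hB hθ hC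
  have a2 := d.A1_bd hn (hbd 0 le_rfl hB) hB hθ hC
  have e0 : (sqv fun _ : Fin n => (0 : ℝ)) = fun _ => 0 := by funext k; simp [sqv]
  rw [sqv_elim, e0, Ch.A1_left] at a2
  have hm := d.merge lam g n t r δ hr hδ
  rw [sqv_elim] at a1 hm
  have hc := (d.md2 n).conc (ww lam g n t r) (sqv fun _ => δ) _ rfl _ rfl
  change _ ≤ 2 * ((d.md2 n).Phi (Sum.elim (sqv (rho lam g n t r)) (sqv fun _ => δ)) - _ - _) + (d.md2 n).A1 (Sum.elim (sqv (rho lam g n t r)) (sqv fun _ => δ)) + (d.md2 n).left.A1 (sqv (rho lam g n t r)) at hc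
  rw [hm] at hc
  have p1 : (d.md n).Phi (sqv (rho lam g n t (r + δ))) = n * d.phi lam g n t (r + δ) := by
    unfold phi ww; field_simp
  have p2 : (d.md2 n).left.Phi (ww lam g n t r) = n * d.phi lam g n t r := by
    unfold phi ww; field_simp; rfl
  have hs2 : ∀ i : Fin n, (sqv (fun _ : Fin n => δ) i) ^ 2 = δ := fun i => Real.sq_sqrt hδ.le
  simp only [hs2, ← Finset.mul_sum] at hc
  have p3 : (1 / 2 * (δ * ∑ i, (d.md2 n).left.M ((d.md2 n).a (Sum.inr i)) (ww lam g n t r))) = n * δ / 2 * d.Qu lam g n t r := by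
    have : d.Qu lam g n t r = 1 / n * ∑ i, (d.md2 n).left.M ((d.md2 n).a (Sum.inr i)) (ww lam g n t r) := rfl
    rw [this]; field_simp
  rw [p3] at hc
  have p4 : ∀ y, |1 / 2 * (δ * ∑ i, (d.md2 n).left.br ((d.md2 n).a (Sum.inr i)) (ww lam g n t r) y ^ 2) - n * δ / 2 * d.Qu lam g n t r|
      = n * δ / 2 * |1 / (n : ℝ) * ∑ i, (d.md n).br (cu n i) (ww lam g n t r) y ^ 2 - d.Qu lam g n t r| := by
    intro y
    rw [← abs_of_pos (by positivity : 0 < n * δ / 2), ← abs_mul, abs_of_pos (by positivity : 0 < n * δ / 2)]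
    congr 1
    have : ∑ i, (d.md n).br (cu n i) (ww lam g n t r) y ^ 2 = ∑ i, (d.md2 n).left.br ((d.md2 n).a (Sum.inr i)) (ww lam g n t r) y ^ 2 := rfl
    rw [this]; field_simp
  have p5 : ∫ y, (d.md2 n).left.Z (ww lam g n t r) y * |1 / 2 * (δ * ∑ i, (d.md2 n).left.br ((d.md2 n).a (Sum.inr i)) (ww lam g n t r) y ^ 2) - n * δ / 2 * d.Qu lam g n t r| ∂(gam (Ix n))
      = n * δ / 2 * d.dev lam g n t r := by
    unfold dev
    rw [← integral_const_mul]
    refine integral_congr_ae (Eventually.of_forall fun y => ?_)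
    simp only [p4]
    have : (d.md2 n).left.Z (ww lam g n t r) y = (d.md n).Z (ww lam g n t r) y := rfl
    rw [this]; ring
  rw [p5, p1, p2] at hc
  have hsl := d.phi_slope lam g hn t hr hδ
  have h6 : n * δ / 2 * d.dev lam g n t r ≤ n * δ / 2 * (2 * (d.Qu lam g n t (r + δ) - d.Qu lam g n t r) + 4 * θ / (n * δ)) := by
    have e : n * δ / 2 * (2 * (d.Qu lam g n t (r + δ) - d.Qu lam g n t r) + 4 * θ / (n * δ))
      = n * δ * (d.Qu lam g n t (r + δ) - d.Qu lam g n t r) + 2 * θ := by field_simp; ring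
    rw [e]
    have := mul_le_mul_of_nonneg_left hsl hn'.le
    linarith
  exact le_of_mul_le_mul_left h6 (by positivity)

lemma sq_diff_le {a b K : ℝ} (ha : |a| ≤ K) (hb : |b| ≤ K) : |a ^ 2 - b ^ 2| ≤ 2 * K * |a - b| := by
  have : a ^ 2 - b ^ 2 = (a + b) * (a - b) := by ring
  rw [this, abs_mul]
  have := abs_add_le a b
  exact mul_le_mul_of_nonneg_right (by linarith) (abs_nonneg _)

lemma sq_young {K c α : ℝ} (hα : 0 < α) (hK : 0 ≤ K) : 2 * K * |c| ≤ K * (α + c ^ 2 / α) := by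
  have h : 0 ≤ (|c| - α) ^ 2 / α := by positivity
  have e : (|c| - α) ^ 2 / α = α + c ^ 2 / α - 2 * |c| := by
    rw [← sq_abs c]; field_simp; ring
  rw [e] at h
  nlinarith

lemma err_le (hn : 0 < n) (t r : ℝ) {α : ℝ} (hα : 0 < α) :
    |d.Quv lam g n t r - d.Qu lam g n t r * d.Qv lam g n t r|
      ≤ d.K ^ 2 * (α + d.Rr lam g n t r / α) + d.K ^ 2 * d.dev lam g n t r := by
  set S := d.md n with hS
  set w := ww lam g n t r with hw
  have hn' : (0 : ℝ) < n := by positivity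
  have hK := d.hK0
  set hu : (Ix n → ℝ) → ℝ := fun y => 1 / (n : ℝ) * ∑ i, S.br (cu n i) w y ^ 2 with hhu
  set hv : (Ix n → ℝ) → ℝ := fun y => 1 / (n : ℝ) * ∑ i, S.br (cv n i) w y ^ 2 with hhv
  set huv : (Ix n → ℝ) → ℝ := fun y => 1 / (n : ℝ) ^ 2 * ∑ i, ∑ j, S.br (cuv n i j) w y ^ 2 with hhuv
  set hR : (Ix n → ℝ) → ℝ := fun y => 1 / (n : ℝ) ^ 2 * ∑ i, ∑ j, S.cov (cv n j) (cu n i) w y ^ 2 with hhR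
  have sb : ∀ c : Sg n → ℝ, SubE (Set.univ : Set Unit) fun _ y => S.br c w y ^ 2 := fun c =>
    (Ch.subE_fix (S.subE_br c _)).pow_two
  have sc : ∀ c e : Sg n → ℝ, SubE (Set.univ : Set Unit) fun _ y => S.cov c e w y ^ 2 := fun c e =>
    (Ch.subE_fix (S.subE_cov c e _)).pow_two
  have Ib : ∀ c : Sg n → ℝ, Integrable (fun y => S.Z w y * S.br c w y ^ 2) (gam (Ix n)) := fun c =>
    S.int_Z_mul (sb c) (by fun_prop)
  have Ic : ∀ c e : Sg n → ℝ, Integrable (fun y => S.Z w y * S.cov c e w y ^ 2) (gam (Ix n)) := fun c e =>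
    S.int_Z_mul (sc c e) (by fun_prop)
  have bu : ∀ y, 0 ≤ hu y ∧ hu y ≤ d.K ^ 2 := fun y =>
    ⟨mul_nonneg (by positivity) (Finset.sum_nonneg fun _ _ => sq_nonneg _),
      avg_le hn fun i => by rw [← sq_abs]; exact pow_le_pow_left₀ (abs_nonneg _) (S.br_abs_le (d.cu_le n i) w y) 2⟩
  have bv : ∀ y, 0 ≤ hv y ∧ hv y ≤ d.K ^ 2 := fun y =>
    ⟨mul_nonneg (by positivity) (Finset.sum_nonneg fun _ _ => sq_nonneg _),
      avg_le hn fun i => by rw [← sq_abs]; exact pow_le_pow_left₀ (abs_nonneg _) (S.br_abs_le (d.cv_le n i) w y) 2⟩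
  have cu' : Continuous hu := by simp only [hhu]; fun_prop
  have cv' : Continuous hv := by simp only [hhv]; fun_prop
  have cuv' : Continuous huv := by simp only [hhuv]; fun_prop
  have eqv : d.Qv lam g n t r = ∫ y, S.Z w y * hv y ∂(gam (Ix n)) := by
    have : ∀ y, S.Z w y * hv y = 1 / (n : ℝ) * ∑ i, S.Z w y * S.br (cv n i) w y ^ 2 := fun y => by
      simp only [hhv, Finset.mul_sum]; exact Finset.sum_congr rfl fun _ _ => by ring
    simp_rw [this]
    rw [integral_const_mul, integral_finsetSum _ fun i _ => Ib _]; rfl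
  have equv : d.Quv lam g n t r = ∫ y, S.Z w y * huv y ∂(gam (Ix n)) := by
    have : ∀ y, S.Z w y * huv y = 1 / (n : ℝ) ^ 2 * ∑ i, ∑ j, S.Z w y * S.br (cuv n i j) w y ^ 2 := fun y => by
      simp only [hhuv, Finset.mul_sum]; exact Finset.sum_congr rfl fun _ _ => Finset.sum_congr rfl fun _ _ => by ring
    simp_rw [this]
    rw [integral_const_mul, integral_finsetSum _ fun i _ => integrable_finsetSum _ fun j _ => Ib _]
    simp_rw [integral_finsetSum _ fun j _ => Ib _]; rfl
  have eR : d.Rr lam g n t r = ∫ y, S.Z w y * hR y ∂(gam (Ix n)) := by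
    have : ∀ y, S.Z w y * hR y = 1 / (n : ℝ) ^ 2 * ∑ i, ∑ j, S.Z w y * S.cov (cv n j) (cu n i) w y ^ 2 := fun y => by
      simp only [hhR, Finset.mul_sum]; exact Finset.sum_congr rfl fun _ _ => Finset.sum_congr rfl fun _ _ => by ring
    simp_rw [this]
    rw [integral_const_mul, integral_finsetSum _ fun i _ => integrable_finsetSum _ fun j _ => Ic _ _]
    simp_rw [integral_finsetSum _ fun j _ => Ic _ _]; rfl
  have key : ∀ y, |huv y - hu y * hv y| ≤ d.K ^ 2 * (α + hR y / α) := by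
    intro y
    have e1 : hu y * hv y = 1 / (n : ℝ) ^ 2 * ∑ i, ∑ j, (S.br (cu n i) w y * S.br (cv n j) w y) ^ 2 := by
      simp only [hhu, hhv, mul_pow, ← Finset.mul_sum, ← Finset.sum_mul]; ring
    have e2 : d.K ^ 2 * (α + hR y / α) = 1 / (n : ℝ) ^ 2 * ∑ i : Fin n, ∑ j : Fin n, d.K ^ 2 * (α + S.cov (cv n j) (cu n i) w y ^ 2 / α) := by
      simp only [hhR, ← Finset.mul_sum, Finset.sum_add_distrib, ← Finset.sum_div, Finset.sum_const, Finset.card_univ, Fintype.card_fin, nsmul_eq_mul]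
      field_simp
    rw [e1, e2, hhuv]
    simp only
    rw [← mul_sub, ← Finset.sum_sub_distrib, abs_mul, abs_of_nonneg (by positivity : 0 ≤ 1 / (n : ℝ) ^ 2)]
    refine mul_le_mul_of_nonneg_left ?_ (by positivity)
    refine (Finset.abs_sum_le_sum_abs _ _).trans (Finset.sum_le_sum fun i _ => ?_)
    rw [← Finset.sum_sub_distrib]
    refine (Finset.abs_sum_le_sum_abs _ _).trans (Finset.sum_le_sum fun j _ => ?_)
    have e3 : S.cov (cv n j) (cu n i) w y = S.br (cuv n i j) w y - S.br (cu n i) w y * S.br (cv n j) w y := by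
      unfold Ch.cov
      have : (fun x => cv n j x * cu n i x) = cuv n i j := by funext x; simp only [cv, cu, cuv]; ring
      rw [this]; ring
    rw [e3]
    refine (sq_diff_le (K := d.K ^ 2) (S.br_abs_le (d.cuv_le n i j) w y) ?_).trans (sq_young hα (by positivity))
    rw [abs_mul, pow_two]
    exact mul_le_mul (S.br_abs_le (d.cu_le n i) w y) (S.br_abs_le (d.cv_le n j) w y) (abs_nonneg _) hK.le
  have bdd : ∀ {f : (Ix n → ℝ) → ℝ} {C : ℝ}, Continuous f → (∀ y, |f y| ≤ C) → Integrable (fun y => S.Z w y * f y) (gam (Ix n)) := by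
    intro f C hf hfC
    exact S.int_Z_mul (SubE.of_bdd (C := C) fun _ _ y => hfC y) hf
  have IR : Integrable (fun y => S.Z w y * hR y) (gam (Ix n)) := by
    have : ∀ y, S.Z w y * hR y = 1 / (n : ℝ) ^ 2 * ∑ i, ∑ j, S.Z w y * S.cov (cv n j) (cu n i) w y ^ 2 := fun y => by
      simp only [hhR, Finset.mul_sum]; exact Finset.sum_congr rfl fun _ _ => Finset.sum_congr rfl fun _ _ => by ring
    simp_rw [this]
    exact (integrable_finsetSum _ fun i _ => integrable_finsetSum _ fun j _ => Ic _ _).const_mul _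
  have Iuv : Integrable (fun y => S.Z w y * huv y) (gam (Ix n)) := by
    have : ∀ y, S.Z w y * huv y = 1 / (n : ℝ) ^ 2 * ∑ i, ∑ j, S.Z w y * S.br (cuv n i j) w y ^ 2 := fun y => by
      simp only [hhuv, Finset.mul_sum]; exact Finset.sum_congr rfl fun _ _ => Finset.sum_congr rfl fun _ _ => by ring
    simp_rw [this]
    exact (integrable_finsetSum _ fun i _ => integrable_finsetSum _ fun j _ => Ib _).const_mul _
  have Iv : Integrable (fun y => S.Z w y * hv y) (gam (Ix n)) :=
    bdd cv' fun y => abs_le.2 ⟨by linarith [(bv y).1, sq_nonneg d.K], (bv y).2⟩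
  have ID : Integrable (fun y => S.Z w y * |hu y - d.Qu lam g n t r|) (gam (Ix n)) :=
    bdd (C := d.K ^ 2) (by fun_prop) fun y => by
      rw [abs_abs, abs_le]
      have q1 := d.Qu_nonneg lam g (n := n) t r
      have q2 := d.Qu_le lam g hn t r
      constructor <;> linarith [(bu y).1, (bu y).2]
  have e5 : d.Quv lam g n t r - d.Qu lam g n t r * d.Qv lam g n t r
      = ∫ y, (S.Z w y * huv y - d.Qu lam g n t r * (S.Z w y * hv y)) ∂(gam (Ix n)) := by
    rw [integral_sub Iuv (Iv.const_mul _), integral_const_mul, ← equv, ← eqv]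
  have e6 : d.K ^ 2 * (α + d.Rr lam g n t r / α) + d.K ^ 2 * d.dev lam g n t r
      = ∫ y, ((d.K ^ 2 * α) * S.Z w y + (d.K ^ 2 / α) * (S.Z w y * hR y) + d.K ^ 2 * (S.Z w y * |hu y - d.Qu lam g n t r|)) ∂(gam (Ix n)) := by
    have IA : Integrable (fun y => (d.K ^ 2 * α) * S.Z w y + (d.K ^ 2 / α) * (S.Z w y * hR y)) (gam (Ix n)) :=
      ((S.integrable_Z w).const_mul _).add (IR.const_mul _)
    rw [integral_add IA (ID.const_mul _),
      integral_add ((S.integrable_Z w).const_mul _) (IR.const_mul _), integral_const_mul, integral_const_mul, integral_const_mul, S.int_Z, ← eR]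
    have : d.dev lam g n t r = ∫ y, S.Z w y * |hu y - d.Qu lam g n t r| ∂(gam (Ix n)) := rfl
    rw [this]
    ring
  rw [e5, e6, ← Real.norm_eq_abs]
  refine norm_integral_le_of_norm_le ((((S.integrable_Z w).const_mul _).add (IR.const_mul _)).add (ID.const_mul _))
    (Eventually.of_forall fun y => ?_)
  have hZ := S.Z_pos w y
  have e7 : S.Z w y * huv y - d.Qu lam g n t r * (S.Z w y * hv y)
    = S.Z w y * ((huv y - hu y * hv y) + (hu y - d.Qu lam g n t r) * hv y) := by ring
  rw [e7, Real.norm_eq_abs, abs_mul, abs_of_pos hZ]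
  have h8 : |(huv y - hu y * hv y) + (hu y - d.Qu lam g n t r) * hv y| ≤ d.K ^ 2 * (α + hR y / α) + d.K ^ 2 * |hu y - d.Qu lam g n t r| := by
    refine (abs_add_le _ _).trans (add_le_add (key y) ?_)
    rw [abs_mul, abs_of_nonneg (bv y).1, mul_comm]
    exact mul_le_mul_of_nonneg_right (bv y).2 (abs_nonneg _)
  refine (mul_le_mul_of_nonneg_left h8 hZ.le).trans (le_of_eq ?_)
  ring

end Dat

end parth

section parti

/-- squared positive part -/
def pp (x : ℝ) : ℝ := max x 0

lemma pp_cont : Continuous pp := by unfold pp; fun_prop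
lemma pp_nonneg (x : ℝ) : 0 ≤ pp x := le_max_right _ _
lemma pp_le {x C : ℝ} (h : x ≤ C) (hC : 0 ≤ C) : pp x ≤ C := max_le h hC
lemma le_pp (x : ℝ) : x ≤ pp x := le_max_left _ _

lemma pp_sq_deriv (x : ℝ) : HasDerivAt (fun y => pp y ^ 2) (2 * pp x) x := by
  rcases lt_trichotomy x 0 with h | h | h
  · have e : (fun y => pp y ^ 2) =ᶠ[𝓝 x] fun _ => 0 := by
      filter_upwards [Iio_mem_nhds h] with y hy
      simp [pp, max_eq_right (le_of_lt (Set.mem_Iio.1 hy))]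
    have : pp x = 0 := max_eq_right h.le
    rw [this, mul_zero]
    exact (hasDerivAt_const x (0 : ℝ)).congr_of_eventuallyEq e
  · subst h
    have : pp 0 = 0 := by simp [pp]
    rw [this, mul_zero, hasDerivAt_iff_isLittleO]
    have : (fun y : ℝ => y ^ 2) =o[𝓝 0] fun y => y := by
      simpa using Asymptotics.isLittleO_pow_id (𝕜 := ℝ) (n := 2) (by norm_num)
    refine Asymptotics.IsBigO.trans_isLittleO (g := fun y : ℝ => y ^ 2) ?_ (by simpa using this)
    refine Asymptotics.IsBigO.of_bound 1 (Eventually.of_forall fun y => ?_)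
    simp only [‹pp 0 = 0›, smul_eq_mul, mul_zero, sub_zero, one_mul, Real.norm_eq_abs, zero_pow (two_ne_zero)]
    rw [abs_of_nonneg (sq_nonneg _), abs_of_nonneg (sq_nonneg y)]
    have h1 := pp_nonneg y
    rw [← sq_abs y]
    exact pow_le_pow_left₀ h1 (max_le (le_abs_self y) (abs_nonneg y)) 2
  · have e : (fun y => pp y ^ 2) =ᶠ[𝓝 x] fun y => y ^ 2 := by
      filter_upwards [Ioi_mem_nhds h] with y hy
      simp [pp, max_eq_left (le_of_lt (Set.mem_Ioi.1 hy))]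
    have : pp x = x := max_eq_left h.le
    rw [this]
    refine HasDerivAt.congr_of_eventuallyEq ?_ e
    simpa using hasDerivAt_pow 2 x

set_option maxHeartbeats 2000000 in
lemma transport (φ Qu Qv Quv Rr : ℝ → ℝ → ℝ) {lam K q2 c η r0 Rm α δ τ m : ℝ}
    (hlam : 0 < lam) (hK : 0 ≤ K) (hq2 : 0 ≤ q2) (hη : 0 ≤ η) (hr0 : 0 < r0) (hrR : r0 ≤ Rm)
    (hα : 0 < α) (hδ : 0 < δ) (hτ : 0 ≤ τ) (hm : 0 < m)
    (cφ : Continuous fun q : ℝ × ℝ => φ q.1 q.2)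
    (cQu : ∀ t, Continuous (Qu t)) (cQv : ∀ t, Continuous (Qv t)) (cQuv : ∀ t, Continuous (Quv t))
    (cR : ∀ t, Continuous (Rr t))
    (dt : ∀ t ∈ Set.Ioo (0 : ℝ) 1, ∀ r, HasDerivAt (fun s => φ s r) (lam / 2 * Quv t r - lam * q2 / 2 * Qv t r) t)
    (dr : ∀ t r, 0 < r → HasDerivAt (φ t) (Qu t r / 2) r)
    (dv : ∀ t r, 0 < r → HasDerivAt (Qv t) (m * Rr t r) r)
    (nu : ∀ t r, 0 ≤ Qu t r) (nv : ∀ t r, 0 ≤ Qv t r) (nuv : ∀ t r, 0 ≤ Quv t r) (nR : ∀ t r, 0 ≤ Rr t r)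
    (lu : ∀ t r, Qu t r ≤ K ^ 2) (lv : ∀ t r, Qv t r ≤ K ^ 2) (luv : ∀ t r, Quv t r ≤ K ^ 4)
    (herr : ∀ t ∈ Set.Ioo (0 : ℝ) 1, ∀ r ∈ Set.Icc r0 Rm, |Quv t r - Qu t r * Qv t r| ≤
      K ^ 2 * (α + Rr t r / α) + K ^ 2 * (2 * (Qu t (r + δ) - Qu t r) + τ))
    (hφ : ∀ t r, 0 ≤ φ t r) (h0 : ∀ r, 0 ≤ r → c + r * q2 / 2 ≤ φ 0 r)
    (hR : c ≤ - (Rm * q2 / 2) + η * Rm ^ 2) :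
    ∫ r in r0..Rm, pp (c - (φ 1 r - r * q2 / 2 + η * (r + lam * K ^ 2 * 1) ^ 2)) ^ 2
      ≤ lam * (|c| + Rm * q2 / 2) * (K ^ 2 * α * Rm + K ^ 4 / (α * m) + 2 * K ^ 4 * δ + K ^ 2 * τ * Rm) := by
  set Λ := lam * K ^ 2 with hΛ
  have hΛ0 : 0 ≤ Λ := by positivity
  set G : ℝ → ℝ → ℝ := fun t r => c - (φ t r - r * q2 / 2 + η * (r + Λ * t) ^ 2) with hG
  set Pm := |c| + Rm * q2 / 2 with hPm
  have hRm : 0 < Rm := hr0.trans_le hrR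
  have hPm0 : 0 ≤ Pm := by positivity
  have cG : Continuous fun q : ℝ × ℝ => G q.1 q.2 := by
    simp only [hG]
    fun_prop
  have cGr : ∀ t, Continuous (G t) := fun t => cG.comp (Continuous.prodMk continuous_const continuous_id)
  have cGt : ∀ r, Continuous (fun t => G t r) := fun r => cG.comp (Continuous.prodMk continuous_id continuous_const)
  have bP : ∀ t, ∀ r ∈ Set.Icc r0 Rm, pp (G t r) ≤ Pm := by
    intro t r hr
    refine pp_le ?_ hPm0
    simp only [hG, hPm]
    have := hφ t r
    have h1 := le_abs_self c
    have h2 : r * q2 ≤ Rm * q2 := mul_le_mul_of_nonneg_right hr.2 hq2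
    have h3 : 0 ≤ η * (r + Λ * t) ^ 2 := by positivity
    linarith
  set N : ℝ → ℝ := fun t => ∫ r in r0..Rm, pp (G t r) ^ 2 with hN
  set Gt : ℝ → ℝ → ℝ := fun t r => - (lam / 2 * Quv t r - lam * q2 / 2 * Qv t r + 2 * η * Λ * (r + Λ * t)) with hGt
  set Gr : ℝ → ℝ → ℝ := fun t r => - (Qu t r / 2 - q2 / 2 + 2 * η * (r + Λ * t)) with hGr
  have dG : ∀ t ∈ Set.Ioo (0 : ℝ) 1, ∀ r, HasDerivAt (fun s => G s r) (Gt t r) t := by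
    intro t ht r
    have h1 : HasDerivAt (fun s => η * (r + Λ * s) ^ 2) (η * (2 * (r + Λ * t) * Λ)) t := by
      have := ((((hasDerivAt_id t).const_mul Λ).const_add r).pow 2).const_mul η
      simpa using this
    have := (((dt t ht r).sub_const (r * q2 / 2)).add h1).const_sub c
    refine this.congr_deriv ?_
    simp only [hGt]; ring
  have dGr : ∀ t r, 0 < r → HasDerivAt (G t) (Gr t r) r := by
    intro t r hr
    have h1 : HasDerivAt (fun s => η * (s + Λ * t) ^ 2) (η * (2 * (r + Λ * t))) r := by
      have := (((hasDerivAt_id r).add_const (Λ * t)).pow 2).const_mul η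
      simpa using this
    have h2 : HasDerivAt (fun s : ℝ => s * q2 / 2) (q2 / 2) r := by
      have := ((hasDerivAt_id r).mul_const q2).div_const 2
      simpa using this
    have := (((dr t r hr).sub h2).add h1).const_sub c
    refine this.congr_deriv ?_
    simp only [hGr]; ring
  have cGt' : ∀ t, Continuous (Gt t) := by
    intro t
    have := cQuv t; have := cQv t
    simp only [hGt]; fun_prop
  have cGr' : ∀ t, Continuous (Gr t) := by
    intro t
    have := cQu t
    simp only [hGr]; fun_prop
  have cP : ∀ t, Continuous fun r => pp (G t r) := fun t => pp_cont.comp (cGr t)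
  -- derivative of N
  set CG := lam * K ^ 4 + lam * q2 * K ^ 2 + 2 * η * Λ * (Rm + Λ) with hCG
  have bGt : ∀ t ∈ Set.Ioo (0 : ℝ) 1, ∀ r ∈ Set.Icc r0 Rm, |Gt t r| ≤ CG := by
    intro t ht r hr
    simp only [hGt, abs_neg, hCG]
    have hr' : 0 ≤ r := hr0.le.trans hr.1
    have h1 : |lam / 2 * Quv t r| ≤ lam * K ^ 4 := by
      rw [abs_of_nonneg (mul_nonneg (by positivity) (nuv t r))]
      have := mul_le_mul_of_nonneg_left (luv t r) hlam.le
      have := mul_nonneg hlam.le (nuv t r)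
      linarith
    have h2 : |lam * q2 / 2 * Qv t r| ≤ lam * q2 * K ^ 2 := by
      rw [abs_of_nonneg (mul_nonneg (by positivity) (nv t r))]
      have h5 : 0 ≤ lam * q2 := by positivity
      have := mul_le_mul_of_nonneg_left (lv t r) h5
      have := mul_nonneg h5 (nv t r)
      linarith
    have h3 : |2 * η * Λ * (r + Λ * t)| ≤ 2 * η * Λ * (Rm + Λ) := by
      have ht0 := ht.1.le
      rw [abs_of_nonneg (by positivity)]
      refine mul_le_mul_of_nonneg_left ?_ (by positivity)
      have := mul_le_mul_of_nonneg_left ht.2.le hΛ0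
      linarith [hr.2]
    have h4 := abs_add_le (lam / 2 * Quv t r - lam * q2 / 2 * Qv t r) (2 * η * Λ * (r + Λ * t))
    have h5 := abs_sub (lam / 2 * Quv t r) (lam * q2 / 2 * Qv t r)
    linarith
  have dN : ∀ t ∈ Set.Ioo (0 : ℝ) 1, HasDerivAt N (∫ r in r0..Rm, 2 * pp (G t r) * Gt t r) t := by
    intro t ht
    have := (intervalIntegral.hasDerivAt_integral_of_dominated_loc_of_deriv_le (μ := volume) (a := r0) (b := Rm)
      (F := fun t r => pp (G t r) ^ 2) (F' := fun t r => 2 * pp (G t r) * Gt t r) (x₀ := t) (s := Set.Ioo 0 1)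
      (bound := fun _ => 2 * Pm * CG) (Ioo_mem_nhds ht.1 ht.2)
      (Eventually.of_forall fun s => ((cP s).pow 2).aestronglyMeasurable)
      (((cP t).pow 2).intervalIntegrable _ _)
      ((((cP t).const_mul 2).mul (cGt' t)).aestronglyMeasurable)
      (Eventually.of_forall fun r hr s hs => by
        rw [Set.uIoc_of_le hrR] at hr
        have hr' : r ∈ Set.Icc r0 Rm := ⟨hr.1.le, hr.2⟩
        rw [Real.norm_eq_abs, abs_mul, abs_of_nonneg (mul_nonneg zero_le_two (pp_nonneg _))]
        refine mul_le_mul ?_ (bGt s hs r hr') (abs_nonneg _) (by positivity)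
        exact mul_le_mul_of_nonneg_left (bP s r hr') zero_le_two)
      intervalIntegrable_const
      (Eventually.of_forall fun r hr s hs => by
        exact (pp_sq_deriv (G s r)).comp s (dG s hs r))).2
    exact this
  have cN : Continuous N := by
    refine intervalIntegral.continuous_parametric_intervalIntegral_of_continuous' ?_ _ _
    exact (pp_cont.comp cG).pow 2
  -- bound on N'
  set E := K ^ 2 * α * Rm + K ^ 4 / (α * m) + 2 * K ^ 4 * δ + K ^ 2 * τ * Rm with hE
  have bN : ∀ t ∈ Set.Ioo (0 : ℝ) 1, ∫ r in r0..Rm, 2 * pp (G t r) * Gt t r ≤ lam * Pm * E := by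
    intro t ht
    set e : ℝ → ℝ := fun r => K ^ 2 * (α + Rr t r / α) + K ^ 2 * (2 * (Qu t (r + δ) - Qu t r) + τ) with he
    have ce : Continuous e := by
      have := cR t; have := cQu t
      simp only [he]; fun_prop
    -- pointwise inequality
    have pw : ∀ r ∈ Set.Icc r0 Rm, 2 * pp (G t r) * Gt t r ≤
        lam * Pm * e r + lam * Qv t r * (2 * pp (G t r) * Gr t r) := by
      intro r hr
      have hr' : 0 ≤ r := hr0.le.trans hr.1
      have h1 := herr t ht r hr
      have h2 := (abs_le.1 h1).1
      have e0 : 0 ≤ e r := (abs_nonneg _).trans h1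
      have h3 : Gt t r ≤ lam / 2 * e r + lam * Qv t r * Gr t r := by
        have h4 : 0 ≤ (Λ - lam * Qv t r) * (2 * η * (r + Λ * t)) := by
          have ht0 := ht.1.le
          refine mul_nonneg ?_ (by positivity)
          have := mul_le_mul_of_nonneg_left (lv t r) hlam.le
          linarith
        have h5 := mul_le_mul_of_nonneg_left h2 hlam.le
        simp only [hGt, hGr]
        simp only [he]
        nlinarith
      have hP := pp_nonneg (G t r)
      have h6 := mul_le_mul_of_nonneg_left h3 (mul_nonneg zero_le_two hP)
      have h7 := mul_le_mul_of_nonneg_right (bP t r hr) (mul_nonneg hlam.le e0)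
      nlinarith
    have hcP := cP t
    have hcQ := cQv t
    have hcGr := cGr' t
    have hcGt := cGt' t
    have i1 : IntervalIntegrable (fun r => 2 * pp (G t r) * Gt t r) volume r0 Rm :=
      Continuous.intervalIntegrable (by fun_prop) _ _
    have i2 : IntervalIntegrable (fun r => lam * Pm * e r) volume r0 Rm :=
      Continuous.intervalIntegrable (by fun_prop) _ _
    have i3 : IntervalIntegrable (fun r => lam * Qv t r * (2 * pp (G t r) * Gr t r)) volume r0 Rm :=
      Continuous.intervalIntegrable (by fun_prop) _ _
    have h1 := intervalIntegral.integral_mono_on hrR i1 (i2.add i3) pw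
    rw [intervalIntegral.integral_add i2 i3, intervalIntegral.integral_const_mul] at h1
    -- integration by parts
    have ibp := intervalIntegral.integral_mul_deriv_eq_deriv_mul (a := r0) (b := Rm)
      (u := fun r => lam * Qv t r) (v := fun r => pp (G t r) ^ 2)
      (u' := fun r => lam * (m * Rr t r)) (v' := fun r => 2 * pp (G t r) * Gr t r)
      (fun r hr => by
        rw [Set.uIcc_of_le hrR] at hr
        exact (dv t r (hr0.trans_le hr.1)).const_mul lam)
      (fun r hr => by
        rw [Set.uIcc_of_le hrR] at hr
        exact (pp_sq_deriv (G t r)).comp r (dGr t r (hr0.trans_le hr.1)))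
      (by have := cR t; exact Continuous.intervalIntegrable (by fun_prop) _ _)
      (Continuous.intervalIntegrable (by fun_prop) _ _)
    have hPR : pp (G t Rm) = 0 := by
      refine max_eq_right ?_
      simp only [hG]
      have := hφ t Rm
      have ht0 := ht.1.le
      have h2 : η * Rm ^ 2 ≤ η * (Rm + Λ * t) ^ 2 := by
        refine mul_le_mul_of_nonneg_left ?_ hη
        refine pow_le_pow_left₀ hRm.le ?_ 2
        have : 0 ≤ Λ * t := by positivity
        linarith
      linarith
    have h2 : ∫ r in r0..Rm, lam * Qv t r * (2 * pp (G t r) * Gr t r) ≤ 0 := by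
      rw [ibp, hPR]
      have a1 : 0 ≤ ∫ r in r0..Rm, lam * (m * Rr t r) * pp (G t r) ^ 2 :=
        intervalIntegral.integral_nonneg hrR fun r _ => by
          have := nR t r
          positivity
      have a2 : 0 ≤ lam * Qv t r0 * pp (G t r0) ^ 2 := by
        have := nv t r0
        positivity
      nlinarith
    -- integral of the error
    have h3 : ∫ r in r0..Rm, e r ≤ E := by
      have hcR := cR t
      have hcQu := cQu t
      have j1 : IntervalIntegrable (Rr t) volume r0 Rm := hcR.intervalIntegrable _ _
      have ee : ∀ r, e r = (K ^ 2 * α + K ^ 2 * τ) + (K ^ 2 / (α * m) * (m * Rr t r) + 2 * K ^ 2 * (Qu t (r + δ) - Qu t r)) := by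
        intro r
        simp only [he]; field_simp; ring
      simp_rw [ee]
      have i1 : IntervalIntegrable (fun r => K ^ 2 / (α * m) * (m * Rr t r)) volume r0 Rm :=
        Continuous.intervalIntegrable (by fun_prop) _ _
      have i2 : IntervalIntegrable (fun r => 2 * K ^ 2 * (Qu t (r + δ) - Qu t r)) volume r0 Rm :=
        Continuous.intervalIntegrable (by fun_prop) _ _
      have i0 : IntervalIntegrable (fun _ : ℝ => K ^ 2 * α + K ^ 2 * τ) volume r0 Rm := intervalIntegrable_const
      rw [intervalIntegral.integral_add i0 (i1.add i2),
        intervalIntegral.integral_add i1 i2,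
        intervalIntegral.integral_const_mul (K ^ 2 / (α * m)) (fun r => m * Rr t r),
        intervalIntegral.integral_const_mul (2 * K ^ 2) (fun r => Qu t (r + δ) - Qu t r), intervalIntegral.integral_const]
      have b1 : ∫ r in r0..Rm, m * Rr t r = Qv t Rm - Qv t r0 := by
        refine intervalIntegral.integral_eq_sub_of_hasDerivAt (fun r hr => ?_) (Continuous.intervalIntegrable (by fun_prop) _ _)
        rw [Set.uIcc_of_le hrR] at hr
        exact dv t r (hr0.trans_le hr.1)
      have b2 : ∫ r in r0..Rm, (Qu t (r + δ) - Qu t r) ≤ δ * K ^ 2 := by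
        rw [intervalIntegral.integral_sub (Continuous.intervalIntegrable (by fun_prop) _ _) (Continuous.intervalIntegrable (by fun_prop) _ _),
          intervalIntegral.integral_comp_add_right (fun r => Qu t r)]
        have k : ∀ a b, IntervalIntegrable (Qu t) volume a b := fun a b => hcQu.intervalIntegrable _ _
        have s1 := intervalIntegral.integral_add_adjacent_intervals (k r0 (r0 + δ)) (k (r0 + δ) (Rm + δ))
        have s2 := intervalIntegral.integral_add_adjacent_intervals (k r0 Rm) (k Rm (Rm + δ))
        have s3 : 0 ≤ ∫ r in r0..(r0 + δ), Qu t r := intervalIntegral.integral_nonneg (by linarith) fun r _ => nu t r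
        have s4 : ∫ r in Rm..(Rm + δ), Qu t r ≤ ∫ r in Rm..(Rm + δ), K ^ 2 :=
          intervalIntegral.integral_mono_on (by linarith) (k _ _) intervalIntegrable_const fun r _ => lu t r
        rw [intervalIntegral.integral_const, add_sub_cancel_left, smul_eq_mul] at s4
        linarith
      rw [b1, hE, smul_eq_mul]
      have b3 : K ^ 2 / (α * m) * (Qv t Rm - Qv t r0) ≤ K ^ 4 / (α * m) := by
        have : K ^ 4 / (α * m) = K ^ 2 / (α * m) * K ^ 2 := by ring
        rw [this]
        refine mul_le_mul_of_nonneg_left ?_ (by positivity)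
        linarith [lv t Rm, nv t r0]
      have b4 := mul_le_mul_of_nonneg_left b2 (by positivity : 0 ≤ 2 * K ^ 2)
      have b5 : (Rm - r0) * (K ^ 2 * α + K ^ 2 * τ) ≤ Rm * (K ^ 2 * α + K ^ 2 * τ) :=
        mul_le_mul_of_nonneg_right (by linarith) (by positivity)
      linarith
    have h4 := mul_le_mul_of_nonneg_left h3 (mul_nonneg hlam.le hPm0)
    linarith
  -- conclusion
  have hN0 : N 0 = 0 := by
    simp only [hN]
    have : ∫ r in r0..Rm, pp (G 0 r) ^ 2 = ∫ r in r0..Rm, (0 : ℝ) := by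
      refine intervalIntegral.integral_congr fun r hr => ?_
      rw [Set.uIcc_of_le hrR] at hr
      have hr' : 0 ≤ r := hr0.le.trans hr.1
      have : pp (G 0 r) = 0 := by
        refine max_eq_right ?_
        simp only [hG]
        have := h0 r hr'
        have : 0 ≤ η * (r + Λ * 0) ^ 2 := by positivity
        linarith
      simp [this]
    rw [this]; simp
  obtain ⟨s, hs, hse⟩ := exists_hasDerivAt_eq_slope N (fun t => ∫ r in r0..Rm, 2 * pp (G t r) * Gt t r)
    (zero_lt_one) cN.continuousOn dN
  have := bN s hs
  rw [hse, hN0, sub_zero, sub_zero, div_one] at this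
  exact this

end parti

section partj

lemma integrable_fin {α : Type*} [MeasurableSpace α] [MeasurableSingletonClass α] (μ : Measure α)
    [IsFiniteMeasure μ] (T : Finset α) (hT : μ ((T : Set α)ᶜ) = 0) (g : α → ℝ) :
    Integrable g μ := by
  have h1 : μ.restrict (T : Set α) = μ := Measure.restrict_eq_self_of_ae_mem hT
  have h2 : IntegrableOn g (T : Set α) μ := by
    exact IntegrableOn.finset
  rwa [IntegrableOn, h1] at h2

lemma integral_prod_fin {α β : Type*} [MeasurableSpace α] [MeasurableSingletonClass α] [MeasurableSpace β]
    (μ : Measure α) [IsFiniteMeasure μ] (T : Finset α) (hT : μ ((T : Set α)ᶜ) = 0)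
    (ν : Measure β) [IsFiniteMeasure ν] (f : α × β → ℝ) (hf : AEStronglyMeasurable f (μ.prod ν))
    (hi : ∀ x ∈ T, Integrable (fun z => f (x, z)) ν) :
    ∫ q, f q ∂(μ.prod ν) = ∑ x ∈ T, μ.real {x} * ∫ z, f (x, z) ∂ν := by
  have h1 : ∀ᵐ x ∂μ, x ∈ T := hT
  rw [integral_prod, integral_fin μ T hT]
  rw [integrable_prod_iff hf]
  refine ⟨?_, integrable_fin μ T hT _⟩
  filter_upwards [h1] with x hx using hi x hx

lemma SubE.shift {κ : Type*} [Fintype κ] {h : (κ → ℝ) → ℝ} (hh : SubE (Set.univ : Set Unit) fun _ => h) (v : κ → ℝ) :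
    SubE (Set.univ : Set Unit) fun _ y => h (y + v) := by
  obtain ⟨C, hC, hb⟩ := hh
  refine SubE.of_bound (C := C * Real.exp (C * ∑ k, |v k|)) (D := C) (by positivity) fun s hs y => ?_
  refine (hb () trivial _).trans ?_
  rw [mul_assoc]
  refine mul_le_mul_of_nonneg_left ?_ hC
  unfold ex
  rw [← Real.exp_add]
  refine Real.exp_le_exp.2 ?_
  rw [← mul_add]
  refine mul_le_mul_of_nonneg_left ?_ hC
  rw [← Finset.sum_add_distrib]
  refine Finset.sum_le_sum fun j _ => ?_
  rw [add_comm]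
  exact abs_add_le _ _

lemma Ch.log_int_shift {X κ : Type*} [Fintype κ] (S : Ch X κ) (w v : κ → ℝ) :
    Integrable (fun z => Real.log (S.Z w (z + v))) (gam κ) := by
  have h : SubE (Set.univ : Set Unit) fun _ y => Real.log (S.Z w y) := Ch.subE_fix (S.subE_log _)
  have hc : Continuous fun y => Real.log (S.Z w y) := by fun_prop
  exact (SubE.shift h v).integrable (a := ()) trivial (hc.comp (by fun_prop))

lemma Ch.Phi_nishi {X κ : Type*} [Fintype κ] (S : Ch X κ) (w : κ → ℝ) :
    S.Phi w = ∑ x ∈ S.T, S.p x * ∫ z, Real.log (S.Z w (z + fun k => w k * S.a k x)) ∂(gam κ) := by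
  have h : SubE (Set.univ : Set Unit) fun _ y => Real.log (S.Z w y) := Ch.subE_fix (S.subE_log _)
  have hc : Continuous fun y => Real.log (S.Z w y) := by fun_prop
  exact (S.nishi1 w (fun y => Real.log (S.Z w y)) h hc).symm

/-- scalar channel -/
def sch (P : Measure ℝ) [IsProbabilityMeasure P] (S : Finset ℝ) (hP : P ((S : Set ℝ)ᶜ) = 0) (K : ℝ)
    (hK : ∀ x ∈ S, |x| ≤ K) : Ch ℝ Unit where
  T := S
  p := fun x => P.real {x}
  hp := fun _ => measureReal_nonneg
  hp1 := by
    have := integral_fin P S hP (fun _ => 1)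
    simpa using this.symm
  a := fun _ x => x
  K := K
  hK := fun _ x hx => hK x hx

lemma gam_unit (f : (Unit → ℝ) → ℝ) : ∫ y, f y ∂(gam Unit) = ∫ z, f (fun _ => z) ∂stdG := by
  have := (measurePreserving_funUnique stdG Unit).symm
  exact (this.integral_comp' f).symm

lemma gam_unit_integrable {f : (Unit → ℝ) → ℝ} (h : Integrable f (gam Unit)) :
    Integrable (fun z : ℝ => f (fun _ => z)) stdG := by
  have := (measurePreserving_funUnique stdG Unit).symm
  exact this.integrable_comp_of_integrable h

section scalar
variable (P : Measure ℝ) [IsProbabilityMeasure P] (S : Finset ℝ) (hP : P ((S : Set ℝ)ᶜ) = 0) (K : ℝ)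
    (hK : ∀ x ∈ S, |x| ≤ K)

lemma sch_Zc (c : ℝ → ℝ) {γ : ℝ} (hγ : 0 ≤ γ) (x₀ z : ℝ) :
    ∫ x, c x * scalarWeight γ x₀ z x ∂P =
      (sch P S hP K hK).Zc c (fun _ => Real.sqrt γ) (fun _ => z + Real.sqrt γ * x₀) := by
  rw [integral_fin P S hP]
  unfold Ch.Zc
  refine Finset.sum_congr rfl fun x _ => ?_
  change _ = P.real {x} * c x * _
  rw [mul_assoc]
  congr 2
  unfold scalarWeight Ch.W
  congr 1
  simp only [Finset.univ_unique, Finset.sum_singleton]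
  change _ = Real.sqrt γ * x * (z + Real.sqrt γ * x₀) - (Real.sqrt γ * x) ^ 2 / 2
  have := Real.sq_sqrt hγ
  linear_combination (x ^ 2 / 2 - x * x₀) * this

lemma sch_Z {γ : ℝ} (hγ : 0 ≤ γ) (x₀ z : ℝ) :
    ∫ x, scalarWeight γ x₀ z x ∂P =
      (sch P S hP K hK).Z (fun _ => Real.sqrt γ) (fun _ => z + Real.sqrt γ * x₀) := by
  have := sch_Zc P S hP K hK (fun _ => 1) hγ x₀ z
  simp only [one_mul] at this
  exact this

lemma sch_log_int (w x₀ : ℝ) : Integrable (fun z => Real.log ((sch P S hP K hK).Z (fun _ => w) (fun _ => z + w * x₀))) stdG := by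
  exact gam_unit_integrable ((sch P S hP K hK).log_int_shift (fun _ => w) (fun _ => w * x₀))

lemma psiF_eq {γ : ℝ} (hγ : 0 ≤ γ) : psiF P γ = (sch P S hP K hK).Phi (sqv fun _ => γ) := by
  unfold psiF
  simp_rw [sch_Z P S hP K hK hγ]
  have hc : Continuous fun q : ℝ × ℝ => Real.log ((sch P S hP K hK).Z (fun _ => Real.sqrt γ) (fun _ => q.2 + Real.sqrt γ * q.1)) := by
    have : Continuous fun y => Real.log ((sch P S hP K hK).Z (fun _ => Real.sqrt γ) y) := by fun_prop
    exact this.comp (by fun_prop)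
  rw [integral_prod_fin P S hP stdG _ hc.aestronglyMeasurable (fun x _ => sch_log_int P S hP K hK _ x)]
  rw [Ch.Phi_nishi]
  refine Finset.sum_congr rfl fun x _ => ?_
  rw [gam_unit]
  rfl

lemma Fov_eq {γ : ℝ} (hγ : 0 ≤ γ) : Fov P γ = (sch P S hP K hK).M (fun x => x) (sqv fun _ => γ) := by
  set C := sch P S hP K hK with hC
  have hpm : ∀ x z, postMean P γ x z = C.br (fun x => x) (fun _ => Real.sqrt γ) (fun _ => z + Real.sqrt γ * x) := by
    intro x z
    unfold postMean
    rw [sch_Z P S hP K hK hγ, sch_Zc P S hP K hK (fun x => x) hγ]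
    rfl
  unfold Fov
  simp_rw [hpm]
  have h0 : Continuous fun y => C.br (fun x => x) (fun _ => Real.sqrt γ) y := by fun_prop
  have hs : SubE (Set.univ : Set Unit) fun _ => C.br (fun x => x) (fun _ => Real.sqrt γ) :=
    Ch.subE_fix (C.subE_br _ _)
  have hc : Continuous fun q : ℝ × ℝ => q.1 * C.br (fun x => x) (fun _ => Real.sqrt γ) (fun _ => q.2 + Real.sqrt γ * q.1) := by
    refine continuous_fst.mul (h0.comp (by fun_prop))
  rw [integral_prod_fin P S hP stdG _ hc.aestronglyMeasurable]
  · unfold Ch.M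
    simp_rw [pow_two]
    refine Eq.trans ?_ (C.nishi (fun _ => Real.sqrt γ) _ hs h0 (fun x => x))
    refine Finset.sum_congr rfl fun x _ => ?_
    rw [gam_unit, integral_const_mul, ← mul_assoc]
    rfl
  · intro x _
    refine Integrable.const_mul ?_ x
    have h := (SubE.shift hs (fun _ => Real.sqrt γ * x)).integrable
      (a := ()) trivial (by fun_prop)
    exact gam_unit_integrable h

lemma psiF_tangent (P : Measure ℝ) [IsProbabilityMeasure P] (S : Finset ℝ)
    (hP : P ((S : Set ℝ)ᶜ) = 0) (K : ℝ) (hK : ∀ x ∈ S, |x| ≤ K) {r s : ℝ} (hr : 0 ≤ r) (hs : 0 ≤ s) :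
    psiF P s + (r - s) * Fov P s / 2 ≤ psiF P r := by
  rw [psiF_eq P S hP K hK hr, psiF_eq P S hP K hK hs, Fov_eq P S hP K hK hs]
  set C := sch P S hP K hK with hC
  set f : ℝ → ℝ := fun r => C.Phi (sqv fun _ => r) with hf
  set m : ℝ → ℝ := fun r => C.M (fun x => x) (sqv fun _ => r) with hm
  change f s + (r - s) * m s / 2 ≤ f r
  have hsq : Continuous fun r : ℝ => (sqv (fun _ : Unit => r)) := sqv_cont (by fun_prop)
  have cf : Continuous f := C.Phi_cont.comp hsq
  have cm : Continuous m := (C.M_cont _).comp hsq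
  have df : ∀ t, 0 < t → HasDerivAt f (1 / 2 * m t) t := by
    intro t ht
    have := C.Phi_sq (fun _ => 0) (fun _ => 1) t (fun _ => Or.inr (by simpa using ht))
    simp only [zero_add, mul_one, one_mul, Finset.univ_unique, Finset.sum_singleton] at this
    exact this
  have dm : ∀ t, 0 < t → HasDerivAt m (C.CV (fun x => x) (fun x => x) (sqv fun _ => t)) t := by
    intro t ht
    have := C.M_sq (fun x => x) (fun _ => 0) (fun _ => 1) t (fun _ => Or.inr (by simpa using ht))
    simp only [zero_add, mul_one, one_mul, Finset.univ_unique, Finset.sum_singleton] at this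
    exact this
  have mm : MonotoneOn m (Set.Ici 0) := by
    refine monotoneOn_of_deriv_nonneg (convex_Ici 0) cm.continuousOn ?_ ?_
    · intro t ht
      rw [interior_Ici] at ht
      exact (dm t ht).differentiableAt.differentiableWithinAt
    · intro t ht
      rw [interior_Ici] at ht
      rw [(dm t ht).deriv]
      exact C.CV_nonneg _ _ _
  rcases lt_trichotomy s r with h | h | h
  · obtain ⟨x, hx, hxe⟩ := exists_hasDerivAt_eq_slope f (fun t => 1 / 2 * m t) h cf.continuousOn
      (fun t ht => df t (hs.trans_lt ht.1))
    have h1 := mm hs (hs.trans hx.1.le) hx.1.le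
    rw [eq_div_iff (by linarith)] at hxe
    nlinarith
  · subst h; simp
  · obtain ⟨x, hx, hxe⟩ := exists_hasDerivAt_eq_slope f (fun t => 1 / 2 * m t) h cf.continuousOn
      (fun t ht => df t (hr.trans_lt ht.1))
    have h1 := mm (hr.trans hx.1.le) hs hx.2.le
    rw [eq_div_iff (by linarith)] at hxe
    nlinarith

end scalar

end partj

section partk

lemma noise_mp (n : ℕ) : MeasurePreserving (MeasurableEquiv.curry (Fin n) (Fin n) ℝ).symm (noiseM n) (gam (Fin n × Fin n)) := by
  refine ⟨MeasurableEquiv.measurable _, ?_⟩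
  have := Measure.infinitePi_map_curry_symm (fun _ _ : Fin n => stdG)
  simp only [Measure.infinitePi_eq_pi] at this
  exact this

instance noise_prob (n : ℕ) : IsProbabilityMeasure (noiseM n) := by unfold noiseM; infer_instance

lemma Dat.prior_fst (d : Dat) {n : ℕ} (G : ℝ → ℝ) (i : Fin n) :
    ∫ x, G (x.1 i) ∂(prior d.PU d.PV n) = ∫ x, G x ∂d.PU := by
  unfold prior
  rw [integral_fun_fst (f := fun u : Fin n → ℝ => G (u i))]
  have h := measurePreserving_eval (fun _ : Fin n => d.PU) i
  have h2 := integral_map (μ := Measure.pi fun _ : Fin n => d.PU) (φ := Function.eval i) h.measurable.aemeasurable (f := G)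
    (by rw [h.map_eq]; exact (integrable_fin d.PU d.S d.hU G).aestronglyMeasurable)
  rw [h.map_eq] at h2
  rw [h2]; simp

lemma Dat.prior_snd (d : Dat) {n : ℕ} (G : ℝ → ℝ) (i : Fin n) :
    ∫ x, G (x.2 i) ∂(prior d.PU d.PV n) = ∫ x, G x ∂d.PV := by
  unfold prior
  rw [integral_fun_snd (f := fun u : Fin n → ℝ => G (u i))]
  have h := measurePreserving_eval (fun _ : Fin n => d.PV) i
  have h2 := integral_map (μ := Measure.pi fun _ : Fin n => d.PV) (φ := Function.eval i) h.measurable.aemeasurable (f := G)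
    (by rw [h.map_eq]; exact (integrable_fin d.PV d.S d.hV G).aestronglyMeasurable)
  rw [h.map_eq] at h2
  rw [h2]; simp

lemma gam_eval {κ : Type*} [Fintype κ] {f : ℝ → ℝ} (hf : Integrable f stdG) (k : κ) :
    Integrable (fun y : κ → ℝ => f (y k)) (gam κ) ∧ ∫ y, f (y k) ∂(gam κ) = ∫ z, f z ∂stdG := by
  have h := measurePreserving_eval (fun _ : κ => stdG) k
  refine ⟨h.integrable_comp_of_integrable hf, ?_⟩
  have h2 := integral_map (μ := Measure.pi fun _ : κ => stdG) (φ := Function.eval k) h.measurable.aemeasurable (f := f)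
    (by rw [h.map_eq]; exact hf.aestronglyMeasurable)
  rw [h.map_eq] at h2
  exact h2.symm

namespace Dat
variable (d : Dat)

def cA : Ch ℝ Unit := sch d.PU d.S d.hU d.K d.hK
def cB : Ch ℝ Unit := sch d.PV d.S d.hV d.K d.hK

lemma Z_left {n : ℕ} (a b : ℝ) (y : Fin n ⊕ Fin n → ℝ) :
    (d.md n).left.Z (Sum.elim (fun _ => a) (fun _ => b)) y =
      (∏ i, d.cA.Z (fun _ => a) (fun _ => y (Sum.inl i))) * ∏ j, d.cB.Z (fun _ => b) (fun _ => y (Sum.inr j)) := by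
  have hA : ∀ y, d.cA.Z (fun _ => a) (fun _ => y) = ∫ x, Real.exp (a * x * y - (a * x) ^ 2 / 2) ∂d.PU := by
    intro y
    rw [integral_fin d.PU d.S d.hU]
    refine Finset.sum_congr rfl fun x _ => ?_
    change d.PU.real {x} * 1 * _ = _
    rw [mul_one]
    congr 1
    unfold Ch.W
    simp only [Finset.univ_unique, Finset.sum_singleton]
    rfl
  have hB : ∀ y, d.cB.Z (fun _ => b) (fun _ => y) = ∫ x, Real.exp (b * x * y - (b * x) ^ 2 / 2) ∂d.PV := by
    intro y
    rw [integral_fin d.PV d.S d.hV]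
    refine Finset.sum_congr rfl fun x _ => ?_
    change d.PV.real {x} * 1 * _ = _
    rw [mul_one]
    congr 1
    unfold Ch.W
    simp only [Finset.univ_unique, Finset.sum_singleton]
    rfl
  simp_rw [hA, hB]
  rw [← integral_fintype_prod_eq_prod (μ := fun _ : Fin n => d.PU) (fun i x => Real.exp (a * x * y (Sum.inl i) - (a * x) ^ 2 / 2)),
    ← integral_fintype_prod_eq_prod (μ := fun _ : Fin n => d.PV) (fun i x => Real.exp (b * x * y (Sum.inr i) - (b * x) ^ 2 / 2)),
    ← integral_prod_mul]
  change _ = ∫ z, _ ∂(prior d.PU d.PV n)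
  rw [d.sum_prior]
  refine Finset.sum_congr rfl fun x _ => ?_
  change (prior d.PU d.PV n).real {x} * 1 * _ = _
  rw [mul_one, ← Real.exp_sum, ← Real.exp_sum, ← Real.exp_add]
  congr 1
  unfold Ch.W
  rw [Fintype.sum_sum_type]
  rfl

lemma phi_zero (lam g : ℝ) {n : ℕ} (hn : 0 < n) (hg : 0 ≤ g) {r : ℝ} (hr : 0 ≤ r) :
    d.phi lam g n 0 r = psiF d.PU r + psiF d.PV g := by
  have hw : ww lam g n 0 r = Sum.elim (Sum.elim (fun _ => Real.sqrt r) (fun _ => Real.sqrt g)) (fun _ => 0) := by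
    funext k
    rcases k with (k | k) | k <;> simp [ww, sqv, rho]
  unfold phi
  rw [hw, Ch.Phi_left, Ch.Phi_nishi]
  set gA : ℝ → ℝ := fun x => ∫ z, Real.log (d.cA.Z (fun _ => Real.sqrt r) (fun _ => z + Real.sqrt r * x)) ∂stdG with hgA
  set gB : ℝ → ℝ := fun x => ∫ z, Real.log (d.cB.Z (fun _ => Real.sqrt g) (fun _ => z + Real.sqrt g * x)) ∂stdG with hgB
  have iA : ∀ x, Integrable (fun z => Real.log (d.cA.Z (fun _ => Real.sqrt r) (fun _ => z + Real.sqrt r * x))) stdG :=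
    fun x => sch_log_int d.PU d.S d.hU d.K d.hK _ x
  have iB : ∀ x, Integrable (fun z => Real.log (d.cB.Z (fun _ => Real.sqrt g) (fun _ => z + Real.sqrt g * x))) stdG :=
    fun x => sch_log_int d.PV d.S d.hV d.K d.hK _ x
  have hA : ∫ x, gA x ∂d.PU = psiF d.PU r := by
    rw [psiF_eq d.PU d.S d.hU d.K d.hK hr, Ch.Phi_nishi, integral_fin d.PU d.S d.hU]
    refine Finset.sum_congr rfl fun x _ => ?_
    rw [gam_unit]
    rfl
  have hB : ∫ x, gB x ∂d.PV = psiF d.PV g := by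
    rw [psiF_eq d.PV d.S d.hV d.K d.hK hg, Ch.Phi_nishi, integral_fin d.PV d.S d.hV]
    refine Finset.sum_congr rfl fun x _ => ?_
    rw [gam_unit]
    rfl
  have key : ∀ x : Sg n, ∫ z, Real.log ((d.md n).left.Z (Sum.elim (fun _ => Real.sqrt r) (fun _ => Real.sqrt g))
      (z + fun k => (Sum.elim (fun _ => Real.sqrt r) (fun _ => Real.sqrt g) : Fin n ⊕ Fin n → ℝ) k * (d.md n).left.a k x)) ∂(gam (Fin n ⊕ Fin n))
      = (∑ i, gA (x.1 i)) + ∑ j, gB (x.2 j) := by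
    intro x
    have e : ∀ z : Fin n ⊕ Fin n → ℝ, Real.log ((d.md n).left.Z (Sum.elim (fun _ => Real.sqrt r) (fun _ => Real.sqrt g))
      (z + fun k => (Sum.elim (fun _ => Real.sqrt r) (fun _ => Real.sqrt g) : Fin n ⊕ Fin n → ℝ) k * (d.md n).left.a k x))
      = (∑ i, Real.log (d.cA.Z (fun _ => Real.sqrt r) (fun _ => z (Sum.inl i) + Real.sqrt r * x.1 i))) +
        ∑ j, Real.log (d.cB.Z (fun _ => Real.sqrt g) (fun _ => z (Sum.inr j) + Real.sqrt g * x.2 j)) := by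
      intro z
      rw [Z_left, Real.log_mul (Finset.prod_pos fun i _ => d.cA.Z_pos _ _).ne' (Finset.prod_pos fun i _ => d.cB.Z_pos _ _).ne',
        Real.log_prod (fun i _ => (d.cA.Z_pos _ _).ne'), Real.log_prod (fun i _ => (d.cB.Z_pos _ _).ne')]
      rfl
    simp_rw [e]
    have jA := fun i : Fin n => gam_eval (iA (x.1 i)) (Sum.inl i : Fin n ⊕ Fin n)
    have jB := fun i : Fin n => gam_eval (iB (x.2 i)) (Sum.inr i : Fin n ⊕ Fin n)
    rw [integral_add (integrable_finsetSum _ fun i _ => (jA i).1) (integrable_finsetSum _ fun i _ => (jB i).1),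
      integral_finsetSum _ fun i _ => (jA i).1, integral_finsetSum _ fun i _ => (jB i).1]
    simp_rw [fun i => (jA i).2, fun i => (jB i).2]
    rfl
  simp_rw [key]
  have h1 := d.sum_prior (n := n) (fun x => (∑ i, gA (x.1 i)) + ∑ j, gB (x.2 j))
  have hIntg : ∀ f : Sg n → ℝ, Integrable f (prior d.PU d.PV n) := fun f =>
    integrable_fin _ _ (prior_compl_zero d.PU d.PV d.S d.hU d.hV) f
  rw [integral_add (hIntg _) (hIntg _), integral_finsetSum _ (fun _ _ => hIntg _), integral_finsetSum _ (fun _ _ => hIntg _)] at h1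
  simp_rw [prior_fst, prior_snd, hA, hB] at h1
  change 1 / (n : ℝ) * ∑ x ∈ d.Tn n, (prior d.PU d.PV n).real {x} * ((∑ i, gA (x.1 i)) + ∑ j, gB (x.2 j)) = _
  rw [← h1]
  have : (n : ℝ) ≠ 0 := by positivity
  simp
  field_simp

lemma phi_one (lam g : ℝ) (hlam : 0 ≤ lam) {n : ℕ} (hn : 0 < n) :
    d.phi lam g n 1 0 = freeEnergy d.PU d.PV n lam := by
  have hw : ww lam g n 1 0 = Sum.elim (fun _ => 0) (fun _ => Real.sqrt (lam / n)) := by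
    funext k
    rcases k with (k | k) | k <;> simp [ww, sqv, rho]
  unfold phi freeEnergy
  rw [hw, Ch.Phi_right, Ch.Phi_nishi]
  congr 1
  set R := (d.md n).right with hR
  set w : Fin n × Fin n → ℝ := fun _ => Real.sqrt (lam / n) with hwd
  have hs : Real.sqrt (lam / n) ^ 2 = lam / n := Real.sq_sqrt (by positivity)
  have hn' : (n : ℝ) ≠ 0 := by positivity
  have e : ∀ ω, partFun d.PU d.PV lam n ω = R.Z w (fun k => ω.2 k.1 k.2 + w k * (ω.1.1 k.1 * ω.1.2 k.2)) := by
    intro ω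
    unfold partFun
    rw [d.sum_prior]
    refine Finset.sum_congr rfl fun x _ => ?_
    change _ = (prior d.PU d.PV n).real {x} * 1 * _
    rw [mul_one]
    congr 1
    unfold Ch.W Ham
    congr 1
    rw [Fintype.sum_prod_type]
    refine Finset.sum_congr rfl fun i _ => Finset.sum_congr rfl fun j _ => ?_
    change _ = Real.sqrt (lam / n) * (x.1 i * x.2 j) * (ω.2 i j + Real.sqrt (lam / n) * (ω.1.1 i * ω.1.2 j))
      - (Real.sqrt (lam / n) * (x.1 i * x.2 j)) ^ 2 / 2
    have : lam / (2 * n) = lam / n / 2 := by field_simp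
    rw [this]
    linear_combination (x.1 i ^ 2 * x.2 j ^ 2 / 2 - x.1 i * ω.1.1 i * x.2 j * ω.1.2 j) * hs
  simp_rw [e]
  have hc : Continuous fun y => Real.log (R.Z w y) := by fun_prop
  have hc2 : Continuous fun ω : Sg n × (Fin n → Fin n → ℝ) =>
      Real.log (R.Z w (fun k => ω.2 k.1 k.2 + w k * (ω.1.1 k.1 * ω.1.2 k.2))) := hc.comp (by fun_prop)
  have hmp := noise_mp n
  unfold sampleM
  rw [integral_prod_fin (prior d.PU d.PV n) (d.Tn n) (prior_compl_zero d.PU d.PV d.S d.hU d.hV) (noiseM n) _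
    hc2.aestronglyMeasurable]
  · refine Finset.sum_congr rfl fun x _ => ?_
    rw [← hmp.integral_comp']
    rfl
  · intro x _
    have := hmp.integrable_comp_of_integrable (R.log_int_shift w (fun k => w k * (x.1 k.1 * x.2 k.2)))
    exact this

end Dat

end partk

section partl

namespace Dat
variable (d : Dat)

lemma free_upper {lam : ℝ} (hlam : 0 < lam) {n : ℕ} (hn : 0 < n) :
    freeEnergy d.PU d.PV n lam ≤ psiF d.PU 0 + psiF d.PV 0 + lam / 2 * d.K ^ 4 := by
  rw [← d.phi_one lam 0 hlam.le hn, ← d.phi_zero lam 0 hn le_rfl le_rfl]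
  obtain ⟨s, hs, he⟩ := exists_hasDerivAt_eq_slope (fun t => d.phi lam 0 n t 0)
    (fun t => lam / 2 * d.Quv lam 0 n t 0 - 0 / 2 * d.Qv lam 0 n t 0) zero_lt_one
    ((d.phi_cont lam 0 n).comp (Continuous.prodMk continuous_id continuous_const)).continuousOn
    (fun t ht => d.phi_dt lam 0 hn hlam le_rfl ht 0)
  have h1 := mul_le_mul_of_nonneg_left (d.Quv_le lam 0 hn s 0) (by positivity : 0 ≤ lam / 2)
  simp only [sub_zero, div_one, zero_div, zero_mul] at he
  linarith

lemma free_nonneg {lam : ℝ} (hlam : 0 < lam) {n : ℕ} (hn : 0 < n) : 0 ≤ freeEnergy d.PU d.PV n lam := by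
  rw [← d.phi_one lam 0 hlam.le hn]
  exact d.phi_nonneg _ _ _ _ _

lemma quant {lam q1 q2 : ℝ} (hlam : 0 < lam) (hq1 : 0 ≤ q1) (hq2 : 0 ≤ q2) (hq : q2 = Fov d.PU (lam * q1))
    {c : ℝ} (hc : c = rsF d.PU d.PV lam q1 q2) {η r0 Rm B C : ℝ} (hη : 0 ≤ η) (hr0 : 0 < r0) (hrR : r0 ≤ Rm)
    (hR : c ≤ - (Rm * q2 / 2) + η * Rm ^ 2) (hB : B = lam + lam * q2 + Rm + 1)
    (hC : C = 4 * B * d.K ^ 4 + 18 * d.K ^ 8 * B ^ 2)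
    {n : ℕ} (hn : 0 < n) {s : ℝ} (hs : 0 < s) (hs1 : s ≤ 1) (hsn : s ^ 4 * n = 1) :
    ∫ r in r0..Rm, pp (c - (d.phi lam (lam * q2) n 1 r - r * q2 / 2 + η * (r + lam * d.K ^ 2 * 1) ^ 2)) ^ 2
      ≤ lam * (|c| + Rm * q2 / 2) * (d.K ^ 2 * s * Rm + d.K ^ 4 * s ^ 3 + 2 * d.K ^ 4 * s
        + d.K ^ 2 * (4 * Real.sqrt C * s) * Rm) := by
  have hK := d.hK0
  have hn' : (0 : ℝ) < n := by positivity
  have hg : 0 ≤ lam * q2 := by positivity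
  have hRm : 0 < Rm := hr0.trans_le hrR
  have hB0 : 0 < B := by rw [hB]; positivity
  have hC0 : 0 < C := by rw [hC]; positivity
  have hsC : 0 < Real.sqrt C := Real.sqrt_pos.2 hC0
  have hni : (n : ℝ) = 1 / s ^ 4 := by
    rw [eq_div_iff (by positivity)]; linarith
  have hτ : 4 * (Real.sqrt C / s ^ 2) / (n * s) = 4 * Real.sqrt C * s := by
    rw [hni]; field_simp
  have hθ : C * n ≤ (Real.sqrt C / s ^ 2) ^ 2 := by
    rw [div_pow, Real.sq_sqrt hC0.le, hni]
    apply le_of_eq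
    field_simp
  have h := transport (d.phi lam (lam * q2) n) (d.Qu lam (lam * q2) n) (d.Qv lam (lam * q2) n)
    (d.Quv lam (lam * q2) n) (d.Rr lam (lam * q2) n) (lam := lam) (K := d.K) (q2 := q2) (c := c) (η := η)
    (r0 := r0) (Rm := Rm) (α := s) (δ := s) (τ := 4 * Real.sqrt C * s) (m := n)
    hlam hK.le hq2 hη hr0 hrR hs hs (by positivity) hn'
    (d.phi_cont lam (lam * q2) n) (d.Qu_cont lam (lam * q2) n) (d.Qv_cont lam (lam * q2) n)
    (d.Quv_cont lam (lam * q2) n) (d.Rr_cont lam (lam * q2) n)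
    (fun t ht r => d.phi_dt lam (lam * q2) hn hlam hg ht r)
    (fun t r hr => d.phi_dr lam (lam * q2) hn t hr)
    (fun t r hr => d.Qv_dr lam (lam * q2) hn t hr)
    (d.Qu_nonneg lam (lam * q2)) (d.Qv_nonneg lam (lam * q2)) (d.Quv_nonneg lam (lam * q2))
    (d.Rr_nonneg lam (lam * q2) n) (d.Qu_le lam (lam * q2) hn) (d.Qv_le lam (lam * q2) hn)
    (d.Quv_le lam (lam * q2) hn)
    (by
      intro t ht r hr
      refine (d.err_le lam (lam * q2) hn t r hs).trans ?_
      have h1 := d.dev_le lam (lam * q2) hn (B := B) (t := t) (r := r) (δ := s) (θ := Real.sqrt C / s ^ 2)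
        ⟨ht.1.le, ht.2.le⟩ hlam.le (by linarith) hg (by linarith) (hr0.le.trans hr.1) (by linarith [hr.2]) hs
        (by linarith) (by positivity) (by rw [← hC]; exact hθ)
      rw [hτ] at h1
      have := mul_le_mul_of_nonneg_left h1 (by positivity : 0 ≤ d.K ^ 2)
      linarith)
    (d.phi_nonneg lam (lam * q2) n)
    (by
      intro r hr
      rw [d.phi_zero lam (lam * q2) hn hg hr]
      have := psiF_tangent d.PU d.S d.hU d.K d.hK hr (by positivity : 0 ≤ lam * q1)
      rw [← hq] at this
      rw [hc, rsF]
      linarith)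
    hR
  refine h.trans (le_of_eq ?_)
  have : d.K ^ 4 / (s * n) = d.K ^ 4 * s ^ 3 := by
    rw [hni]; field_simp
  rw [this]

lemma main_lb {lam q1 q2 : ℝ} (hlam : 0 < lam) (hq1 : 0 ≤ q1) (hq2 : 0 ≤ q2) (hq : q2 = Fov d.PU (lam * q1))
    {ε : ℝ} (hε : 0 < ε) :
    ∀ᶠ n : ℕ in atTop, rsF d.PU d.PV lam q1 q2 - ε ≤ freeEnergy d.PU d.PV n lam := by
  have hK := d.hK0
  set c := rsF d.PU d.PV lam q1 q2 with hc
  set Λ := lam * d.K ^ 2 with hΛ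
  have hΛ0 : 0 < Λ := by positivity
  set η := ε / (4 * (2 + Λ) ^ 2) with hη
  have hη0 : 0 < η := by positivity
  set r0 := min 1 (ε / (4 * d.K ^ 2)) with hr0
  have hr00 : 0 < r0 := lt_min one_pos (by positivity)
  have hr1 : r0 ≤ 1 := min_le_left _ _
  have hr2 : d.K ^ 2 * r0 ≤ ε / 4 := by
    have : r0 ≤ ε / (4 * d.K ^ 2) := min_le_right _ _
    rw [le_div_iff₀ (by positivity)] at this
    linarith
  set Rm := 2 + (q2 / 2 + |c|) / η with hRm
  have hRm2 : 2 ≤ Rm := by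
    have : 0 ≤ (q2 / 2 + |c|) / η := by positivity
    linarith
  have hR : c ≤ - (Rm * q2 / 2) + η * Rm ^ 2 := by
    have h1 : q2 / 2 + |c| ≤ η * Rm := by
      have : η * Rm = 2 * η + (q2 / 2 + |c|) := by rw [hRm]; field_simp
      linarith
    have h2 := mul_le_mul_of_nonneg_right h1 (by linarith : 0 ≤ Rm)
    have h3 := le_abs_self c
    have h4 : |c| ≤ |c| * Rm := le_mul_of_one_le_right (abs_nonneg _) (by linarith)
    nlinarith
  set B := lam + lam * q2 + Rm + 1 with hB
  set C := 4 * B * d.K ^ 4 + 18 * d.K ^ 8 * B ^ 2 with hC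
  set sn : ℕ → ℝ := fun n => 1 / Real.sqrt (Real.sqrt n) with hsn
  set E : ℝ → ℝ := fun s => lam * (|c| + Rm * q2 / 2) * (d.K ^ 2 * s * Rm + d.K ^ 4 * s ^ 3 + 2 * d.K ^ 4 * s
        + d.K ^ 2 * (4 * Real.sqrt C * s) * Rm) with hE
  have hsl : Tendsto sn atTop (𝓝 0) := by
    simp only [hsn, one_div]
    exact tendsto_inv_atTop_zero.comp (Real.tendsto_sqrt_atTop.comp (Real.tendsto_sqrt_atTop.comp tendsto_natCast_atTop_atTop))
  have hEl : Tendsto (fun n => E (sn n)) atTop (𝓝 0) := by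
    have h1 : Continuous E := by simp only [hE]; fun_prop
    have h2 := (h1.tendsto 0).comp hsl
    have h3 : E 0 = 0 := by simp [hE]
    rw [h3] at h2
    exact h2
  have hEs := hEl.eventually (gt_mem_nhds (by positivity : (0 : ℝ) < r0 * (ε ^ 2 / 4)))
  filter_upwards [hEs, eventually_gt_atTop 0] with n hnE hn
  by_contra! hcon
  have hn1 : (1 : ℝ) ≤ n := by exact_mod_cast hn
  have hs1 : 1 ≤ Real.sqrt (Real.sqrt n) := by
    rw [Real.one_le_sqrt, Real.one_le_sqrt]; exact hn1
  have hs4 : Real.sqrt (Real.sqrt n) ^ 4 = n := by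
    have : Real.sqrt (Real.sqrt n) ^ 4 = (Real.sqrt (Real.sqrt n) ^ 2) ^ 2 := by ring
    rw [this, Real.sq_sqrt (Real.sqrt_nonneg _), Real.sq_sqrt (by positivity)]
  have hq' := d.quant hlam hq1 hq2 hq hc hη0.le hr00 (by linarith : r0 ≤ Rm) hR hB hC hn (s := sn n)
    (by simp only [hsn]; positivity) (by simp only [hsn]; rw [div_le_one (by linarith)]; exact hs1)
    (by simp only [hsn]; rw [div_pow, hs4]; field_simp)
  have hpc := d.phi_cont_r lam (lam * q2) n 1
  set f : ℝ → ℝ := fun r => pp (c - (d.phi lam (lam * q2) n 1 r - r * q2 / 2 + η * (r + lam * d.K ^ 2 * 1) ^ 2)) ^ 2 with hf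
  have hfc : Continuous f := by
    simp only [hf]
    exact (pp_cont.comp (by fun_prop)).pow 2
  have hf0 : ∀ r, 0 ≤ f r := fun r => sq_nonneg _
  have hlow : ∀ r ∈ Set.Icc r0 (2 * r0), ε ^ 2 / 4 ≤ f r := by
    intro r hr
    have hrp : 0 < r := hr00.trans_le hr.1
    have h1 := d.phi_slope lam (lam * q2) hn 1 le_rfl hrp
    rw [zero_add, d.phi_one lam (lam * q2) hlam.le hn] at h1
    have h2 := mul_le_mul_of_nonneg_left (d.Qu_le lam (lam * q2) hn 1 r) (by positivity : 0 ≤ r / 2)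
    have h3 : r / 2 * d.K ^ 2 ≤ d.K ^ 2 * r0 := by
      have : r / 2 ≤ r0 := by linarith [hr.2]
      rw [mul_comm]
      exact mul_le_mul_of_nonneg_left this (by positivity)
    have h4 : η * (r + lam * d.K ^ 2 * 1) ^ 2 ≤ ε / 4 := by
      have : (r + lam * d.K ^ 2 * 1) ^ 2 ≤ (2 + Λ) ^ 2 := by
        rw [mul_one, ← hΛ]
        refine pow_le_pow_left₀ (by positivity) ?_ 2
        linarith [hr.2]
      have h5 := mul_le_mul_of_nonneg_left this hη0.le
      have h6 : η * (2 + Λ) ^ 2 = ε / 4 := by rw [hη]; field_simp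
      linarith
    have h7 : 0 ≤ r * q2 / 2 := by positivity
    have h8 : ε / 2 ≤ pp (c - (d.phi lam (lam * q2) n 1 r - r * q2 / 2 + η * (r + lam * d.K ^ 2 * 1) ^ 2)) := by
      refine le_trans ?_ (le_pp _)
      linarith
    have h9 := pow_le_pow_left₀ (by positivity) h8 2
    simp only [hf]
    refine le_trans (le_of_eq (by ring)) h9
  have hi : ∀ a b, IntervalIntegrable f volume a b := fun a b => hfc.intervalIntegrable _ _
  have hsplit := intervalIntegral.integral_add_adjacent_intervals (hi r0 (2 * r0)) (hi (2 * r0) Rm)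
  have hpos : 0 ≤ ∫ r in (2 * r0)..Rm, f r := intervalIntegral.integral_nonneg (by linarith) fun r _ => hf0 r
  have hmono : ∫ r in r0..(2 * r0), ε ^ 2 / 4 ≤ ∫ r in r0..(2 * r0), f r :=
    intervalIntegral.integral_mono_on (by linarith) intervalIntegrable_const (hi _ _) hlow
  rw [intervalIntegral.integral_const, smul_eq_mul] at hmono
  have e2 : 2 * r0 - r0 = r0 := by ring
  rw [e2] at hmono
  have hq2' : ∫ r in r0..Rm, f r ≤ E (sn n) := hq'
  linarith

end Dat

end partl

/-- **Lower bound via Guerra's interpolation:**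
`liminf_{n→∞} F_n(λ) ≥ sup_{(q₁,q₂) ∈ Γ(λ)} 𝓕(λ,q₁,q₂)`. -/
theorem guerra_lower_bound
    (K₀ : ℝ) (S : Finset ℝ) (hSK : ∀ x ∈ S, |x| ≤ K₀)
    (PU PV : Measure ℝ) [IsProbabilityMeasure PU] [IsProbabilityMeasure PV]
    (hUS : PU ((↑S : Set ℝ)ᶜ) = 0) (hVS : PV ((↑S : Set ℝ)ᶜ) = 0)
    (hUvar : 0 < (∫ x, x ^ 2 ∂PU) - (∫ x, x ∂PU) ^ 2)
    (hVvar : 0 < (∫ x, x ^ 2 ∂PV) - (∫ x, x ∂PV) ^ 2)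
    (lam : ℝ) (hlam : 0 < lam) :
    sSup ((fun q : ℝ × ℝ => rsF PU PV lam q.1 q.2) '' Gam PU PV lam)
      ≤ Filter.liminf (fun n => freeEnergy PU PV n lam) atTop := by
  let d : Dat := ⟨PU, PV, inferInstance, inferInstance, S, hUS, hVS, max K₀ 1, le_max_right _ _,
    fun x hx => (hSK x hx).trans (le_max_left _ _)⟩
  have hcob : IsCoboundedUnder (· ≥ ·) atTop (fun n => freeEnergy PU PV n lam) := by
    refine IsBoundedUnder.isCoboundedUnder_ge ?_
    refine isBoundedUnder_of_eventually_le (a := psiF PU 0 + psiF PV 0 + lam / 2 * (max K₀ 1) ^ 4) ?_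
    filter_upwards [eventually_gt_atTop 0] with n hn
    exact d.free_upper hlam hn
  have hpos : 0 ≤ Filter.liminf (fun n => freeEnergy PU PV n lam) atTop := by
    refine le_liminf_of_le hcob ?_
    filter_upwards [eventually_gt_atTop 0] with n hn
    exact d.free_nonneg hlam hn
  refine Real.sSup_le ?_ hpos
  rintro _ ⟨q, ⟨h1, h2, h3, h4⟩, rfl⟩
  refine le_of_forall_pos_le_add fun ε hε => ?_
  have : rsF PU PV lam q.1 q.2 - ε ≤ Filter.liminf (fun n => freeEnergy PU PV n lam) atTop := by
    refine le_liminf_of_le hcob ?_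
    exact d.main_lb hlam h1 h2 h3 hε
  linarith
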